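/- Let n ≥ 2. If φ is a partial proper edge coloring of at most n+1 edges of K_{2n−1} □ K_2, then φ is extendable to a proper 2n-edge coloring of K_{2n−1} □ K_2. -/

import Mathlib

open SimpleGraph

variable {V : Type*}

/-- Two edges of `G` are adjacent if both are edges, they are distinct,
and they share a vertex. -/
def EdgeAdj (G : SimpleGraph V) (e f : Sym2 V) : Prop :=
  e ∈ G.edgeSet ∧ f ∈ G.edgeSet ∧ e ≠ f ∧ ∃ v, v ∈ e ∧ v ∈ f

/-- A proper edge coloring (with natural-number colors). -/
def IsProperEdgeColoring (G : SimpleGraph V) (C : Sym2 V → ℕ) : Prop :=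
  ∀ ⦃e f⦄, EdgeAdj G e f → C e ≠ C f

/-- A partial proper edge coloring: colored edges are edges of `G`, and
adjacent colored edges receive distinct colors. -/
def IsPartialProperEdgeColoring (G : SimpleGraph V) (φ : Sym2 V → Option ℕ) : Prop :=
  (∀ e, φ e ≠ none → e ∈ G.edgeSet) ∧
  ∀ ⦃e f⦄, EdgeAdj G e f → φ e ≠ none → φ e ≠ φ f

/-- The partial coloring uses colors from `{0, ..., t-1}`. -/
def UsesColors (φ : Sym2 V → Option ℕ) (t : ℕ) : Prop :=
  ∀ e a, φ e = some a → a < t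

/-- The (total) coloring uses colors from `{0, ..., t-1}` on all edges of `G`. -/
def ColorsBelow (G : SimpleGraph V) (C : Sym2 V → ℕ) (t : ℕ) : Prop :=
  ∀ e ∈ G.edgeSet, C e < t

/-- `C` agrees with the partial coloring `φ` on all precolored edges. -/
def ExtendsColoring (C : Sym2 V → ℕ) (φ : Sym2 V → Option ℕ) : Prop :=
  ∀ e a, φ e = some a → C e = a

/-- `φ` extends to a proper edge coloring of `G` with `t` colors. -/
def Extendable (G : SimpleGraph V) (φ : Sym2 V → Option ℕ) (t : ℕ) : Prop :=
  ∃ C, IsProperEdgeColoring G C ∧ ColorsBelow G C t ∧ ExtendsColoring C φ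

/-- The set of precolored edges of `φ`. -/
def Precolored (φ : Sym2 V → Option ℕ) : Set (Sym2 V) := {e | φ e ≠ none}

/-- The chromatic index: least `t` admitting a proper edge coloring with `t` colors. -/
noncomputable def chromaticIndex (G : SimpleGraph V) : ℕ :=
  sInf {t | ∃ C, IsProperEdgeColoring G C ∧ ColorsBelow G C t}

/-- A set of edges is independent (a matching) if no two distinct members share a vertex. -/
def IndependentEdges (S : Set (Sym2 V)) : Prop :=
  ∀ e ∈ S, ∀ f ∈ S, e ≠ f → ∀ v, v ∈ e → v ∉ f

namespace PartialEdgeColoring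

section

open scoped Classical

variable {V κ : Type*}

/-- A partial edge coloring in which edges of the same color sharing a vertex coincide. -/
def Proper (C : Sym2 V → Option κ) : Prop :=
  ∀ u v w c, C s(u, v) = some c → C s(u, w) = some c → v = w

/-- The color `c` does not occur at the vertex `v`. -/
def Misses (C : Sym2 V → Option κ) (v : V) (c : κ) : Prop :=
  ∀ w, C s(v, w) ≠ some c

theorem proper_update_some {C : Sym2 V → Option κ} (hC : Proper C) {x y : V} {c : κ}
    (hx : Misses C x c) (hy : Misses C y c) :
    Proper (Function.update C s(x, y) (some c)) := by
  intro u v w d h1 h2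
  rw [Function.update_apply] at h1 h2
  split_ifs at h1 h2 with e1 e2 e2
  · have := e1.trans e2.symm
    exact Sym2.congr_right.1 this
  · obtain rfl : c = d := by simpa using h1
    rcases Sym2.eq_iff.1 e1 with ⟨rfl, rfl⟩ | ⟨rfl, rfl⟩
    · exact absurd h2 (hx _)
    · exact absurd h2 (hy _)
  · obtain rfl : c = d := by simpa using h2
    rcases Sym2.eq_iff.1 e2 with ⟨rfl, rfl⟩ | ⟨rfl, rfl⟩
    · exact absurd h1 (hx _)
    · exact absurd h1 (hy _)
  · exact hC _ _ _ _ h1 h2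

theorem proper_update_none {C : Sym2 V → Option κ} (hC : Proper C) (e : Sym2 V) :
    Proper (Function.update C e none) := by
  intro u v w d h1 h2
  rw [Function.update_apply] at h1 h2
  split_ifs at h1 h2
  exact hC _ _ _ _ h1 h2

/-- Rotating the colors along a fan centered at `x`. -/
theorem exists_rotation {x : V} {γ : κ} (l : ℕ) : ∀ (C : Sym2 V → Option κ) (y : ℕ → V),
    Proper C → Set.InjOn y (Set.Iic l) → C s(x, y 0) = none →
    (∀ i < l, ∃ c, C s(x, y (i + 1)) = some c ∧ Misses C (y i) c) →
    Misses C x γ → Misses C (y l) γ →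
    ∃ C' : Sym2 V → Option κ, Proper C' ∧
      ∀ e, (C' e).isSome ↔ (C e).isSome ∨ e = s(x, y 0) := by
  induction l with
  | zero =>
    intro C y hC _ h0 _ hx hy
    refine ⟨Function.update C s(x, y 0) (some γ), proper_update_some hC hx hy, fun e => ?_⟩
    rw [Function.update_apply]
    split_ifs with h <;> simp [h]
  | succ l ih =>
    intro C y hC hinj h0 hstep hx hy
    obtain ⟨c, hc, hm⟩ := hstep 0 (by omega)
    rw [zero_add] at hc
    have hne : ∀ i, i ≤ l + 1 → ∀ j, j ≤ l + 1 → i ≠ j → y i ≠ y j := fun i hi j hj hij h =>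
      hij (hinj hi hj h)
    have h01 : s(x, y 0) ≠ s(x, y 1) := by
      rw [Ne, Sym2.congr_right]; exact hne 0 (by omega) 1 (by omega) (by omega)
    set C0 := Function.update C s(x, y 1) none with hC0
    have hC0p : Proper C0 := proper_update_none hC _
    have hC0x : Misses C0 x c := by
      intro w hw
      rw [hC0, Function.update_apply] at hw
      split_ifs at hw with h
      have := hC _ _ _ _ hw hc
      exact h (by rw [this])
    have hC0m : ∀ v d, Misses C v d → Misses C0 v d := by
      intro v d h w hw
      rw [hC0, Function.update_apply] at hw
      split_ifs at hw
      exact h _ hw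
    set C1 := Function.update C0 s(x, y 0) (some c) with hC1
    have hC1p : Proper C1 := proper_update_some hC0p hC0x (hC0m _ _ hm)
    have hC1m : ∀ i d, 0 < i → i ≤ l + 1 → Misses C (y i) d → (∃ w, C s(x, w) = some d) →
        Misses C1 (y i) d := by
      intro i d hi hil h hxd w hw
      rw [hC1, Function.update_apply] at hw
      split_ifs at hw with he
      · rcases Sym2.eq_iff.1 he with ⟨h1, h2⟩ | ⟨h1, h2⟩
        · obtain ⟨w', hw'⟩ := hxd
          rw [← h1] at hw'
          exact h _ hw'
        · exact hne i hil 0 (by omega) (by omega) h1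
      · exact hC0m _ _ h _ hw
    have hxγ : Misses C1 x γ := by
      intro w hw
      rw [hC1, Function.update_apply] at hw
      split_ifs at hw with he
      · obtain rfl : c = γ := by simpa using hw
        exact hx _ hc
      · exact hC0m _ _ hx _ hw
    obtain ⟨C', hC', hs⟩ := ih C1 (fun i => y (i + 1)) hC1p (by
        intro i hi j hj hij
        have := hinj (show i + 1 ≤ l + 1 by simpa using hi)
          (show j + 1 ≤ l + 1 by simpa using hj) hij
        omega) (by
        simp only [zero_add, hC1]
        rw [Function.update_of_ne h01.symm, hC0, Function.update_self]) (by
        intro i hi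
        obtain ⟨d, hd, hdm⟩ := hstep (i + 1) (by omega)
        refine ⟨d, ?_, hC1m _ _ (by omega) (by omega) hdm ⟨_, hd⟩⟩
        show C1 s(x, y (i + 1 + 1)) = some d
        rw [hC1, Function.update_of_ne, hC0, Function.update_of_ne, hd]
        · rw [Ne, Sym2.congr_right]; exact hne _ (by omega) _ (by omega) (by omega)
        · rw [Ne, Sym2.congr_right]; exact hne _ (by omega) _ (by omega) (by omega)) hxγ (by
        intro w hw
        change C1 s(y (l + 1), w) = _ at hw
        rw [hC1, Function.update_apply] at hw
        split_ifs at hw with he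
        · obtain rfl : c = γ := by simpa using hw
          exact hx _ hc
        · exact hC0m _ _ hy _ hw)
    refine ⟨C', hC', fun e => ?_⟩
    rw [hs]
    simp only [zero_add]
    rw [hC1, Function.update_apply, hC0, Function.update_apply]
    split_ifs with h1 h2
    · simp [h1]
    · simp [h2, hc]
    · simp [h1, h2]

/-- Exchanging two colors on a vertex set closed under edges of these colors. -/
theorem exists_swap {C : Sym2 V → Option κ} (hC : Proper C) (α β : κ) (K : Set V)
    (hK : ∀ u v, C s(u, v) = some α ∨ C s(u, v) = some β → (u ∈ K ↔ v ∈ K)) :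
    ∃ C' : Sym2 V → Option κ, Proper C' ∧ (∀ e, (C' e).isSome ↔ (C e).isSome) ∧
      (∀ u v, u ∉ K → C' s(u, v) = C s(u, v)) ∧
      (∀ u, u ∈ K → Misses C u α → Misses C' u β) ∧
      (∀ u c, u ∉ K ∨ c ≠ α ∧ c ≠ β → Misses C u c → Misses C' u c) := by
  let C' : Sym2 V → Option κ := fun e =>
    if ∃ v ∈ e, v ∈ K then (C e).map (Equiv.swap α β) else C e
  have key : ∀ u v, C' s(u, v) =
      if u ∈ K then (C s(u, v)).map (Equiv.swap α β) else C s(u, v) := by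
    intro u v
    by_cases hu : u ∈ K
    · have : ∃ w ∈ s(u, v), w ∈ K := ⟨u, by simp, hu⟩
      simp only [C', if_pos this, if_pos hu]
    · by_cases hv : v ∈ K
      · have : ∃ w ∈ s(u, v), w ∈ K := ⟨v, by simp, hv⟩
        simp only [C', if_pos this, if_neg hu]
        have hn : ¬ (C s(u, v) = some α ∨ C s(u, v) = some β) := fun h => hu ((hK u v h).2 hv)
        rcases hcc : C s(u, v) with _ | c
        · rfl
        · rw [hcc] at hn
          simp only [Option.some.injEq, not_or] at hn
          simp [Equiv.swap_apply_of_ne_of_ne hn.1 hn.2]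
      · have : ¬ ∃ w ∈ s(u, v), w ∈ K := by
          rintro ⟨w, hw, hwK⟩
          rcases Sym2.mem_iff.1 hw with rfl | rfl
          · exact hu hwK
          · exact hv hwK
        simp only [C', if_neg this, if_neg hu]
  refine ⟨C', ?_, ?_, ?_, ?_, ?_⟩
  · intro u v w c h1 h2
    rw [key] at h1 h2
    split_ifs at h1 h2
    · rw [Option.map_eq_some_iff] at h1 h2
      obtain ⟨a, ha, hac⟩ := h1
      obtain ⟨b, hb, hbc⟩ := h2
      obtain rfl : a = b := (Equiv.swap α β).injective (hac.trans hbc.symm)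
      exact hC _ _ _ _ ha hb
    · exact hC _ _ _ _ h1 h2
  · intro e
    simp only [C']
    split_ifs <;> simp
  · intro u v hu
    rw [key, if_neg hu]
  · intro u hu hm w hw
    rw [key, if_pos hu, Option.map_eq_some_iff] at hw
    obtain ⟨a, ha, hab⟩ := hw
    rw [Equiv.swap_apply_eq_iff, Equiv.swap_apply_right] at hab
    exact hm w (hab ▸ ha)
  · intro u c h hm w hw
    rw [key] at hw
    split_ifs at hw with hu
    · obtain ⟨h1, h2⟩ := h.resolve_left (not_not.2 hu)
      rw [Option.map_eq_some_iff] at hw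
      obtain ⟨a, ha, hab⟩ := hw
      rw [Equiv.swap_apply_eq_iff, Equiv.swap_apply_of_ne_of_ne h1 h2] at hab
      exact hm w (hab ▸ ha)
    · exact hm w hw

/-- In a graph of maximum degree at most two, a component has at most two vertices of degree
at most one. -/
theorem not_reachable_three [Fintype V] (G : SimpleGraph V) (h2 : ∀ v, G.degree v ≤ 2)
    {x a b : V} (hxa : x ≠ a) (hxb : x ≠ b) (hab : a ≠ b)
    (hx : G.degree x ≤ 1) (ha : G.degree a ≤ 1) (hb : G.degree b ≤ 1)
    (hra : G.Reachable x a) (hrb : G.Reachable x b) : False := by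
  let K := (G.connectedComponentMk x).supp
  have hconn : (G.induce K).Connected := (G.connectedComponentMk x).connected_toSimpleGraph
  have h1 := hconn.card_vert_le_card_edgeSet_add_one
  have h3 := (G.induce K).sum_degrees_eq_twice_card_edges
  have hd : ∀ v : K, (G.induce K).degree v ≤ G.degree v := fun v => by
    rw [← card_neighborFinset_eq_degree, ← card_neighborFinset_eq_degree]
    refine Finset.card_le_card_of_injOn Subtype.val (fun w hw => ?_) (Subtype.val_injective.injOn)
    simpa using hw
  let X : K := ⟨x, by simp [K]⟩
  let A : K := ⟨a, by simpa [K, ConnectedComponent.eq] using hra.symm⟩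
  let B : K := ⟨b, by simpa [K, ConnectedComponent.eq] using hrb.symm⟩
  have hsum : ∑ v : K, ((G.induce K).degree v + (if v ∈ ({X, A, B} : Finset K) then 1 else 0))
      ≤ ∑ v : K, 2 := by
    refine Finset.sum_le_sum fun v _ => ?_
    have := hd v
    split_ifs with h
    · simp only [Finset.mem_insert, Finset.mem_singleton] at h
      rcases h with rfl | rfl | rfl
      · have : G.degree (X : V) ≤ 1 := hx
        omega
      · have : G.degree (A : V) ≤ 1 := ha
        omega
      · have : G.degree (B : V) ≤ 1 := hb
        omega
    · have := h2 v
      omega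
  rw [Finset.sum_add_distrib, h3] at hsum
  have hc : ({X, A, B} : Finset K).card = 3 := by
    rw [Finset.card_eq_three]
    exact ⟨X, A, B, by simpa [X, A] using hxa, by simpa [X, B] using hxb,
      by simpa [A, B] using hab, rfl⟩
  rw [Finset.sum_boole, Finset.filter_mem_eq_inter, Finset.univ_inter, hc] at hsum
  simp only [Finset.sum_const, Finset.card_univ, smul_eq_mul] at hsum
  rw [Nat.card_eq_fintype_card, Nat.card_eq_fintype_card, ← edgeFinset_card] at h1
  push_cast at hsum
  omega

set_option maxHeartbeats 1000000 in
/-- Vizing's fan argument: a further edge can be colored when its ends and the neighbors of the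
center miss a color. -/
theorem exists_color_edge [Fintype V] {C : Sym2 V → Option κ} (hC : Proper C) {x y₀ : V}
    (hne : x ≠ y₀) (h0 : C s(x, y₀) = none) (hx : ∃ c, Misses C x c)
    (hy : ∃ c, Misses C y₀ c) (hz : ∀ z, C s(x, z) ≠ none → ∃ c, Misses C z c) :
    ∃ C' : Sym2 V → Option κ, Proper C' ∧
      ∀ e, (C' e).isSome ↔ (C e).isSome ∨ e = s(x, y₀) := by
  by_contra hcon
  obtain ⟨β, hβ⟩ := hx
  have hm : ∀ z, ∃ c, z = y₀ ∨ C s(x, z) ≠ none → Misses C z c := by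
    intro z
    by_cases h : z = y₀ ∨ C s(x, z) ≠ none
    · rcases h with rfl | h
      · exact hy.imp fun c hc _ => hc
      · exact (hz z h).imp fun c hc _ => hc
    · exact ⟨β, fun h' => absurd h' h⟩
  choose m hm using hm
  let nxt : V → V := fun z => if h : ∃ w, C s(x, w) = some (m z) then h.choose else y₀
  have hnxt : ∀ z, (∃ w, C s(x, w) = some (m z)) → C s(x, nxt z) = some (m z) := by
    intro z h
    simp only [nxt, dif_pos h]
    exact h.choose_spec
  let y : ℕ → V := fun i => nxt^[i] y₀
  have hy0 : y 0 = y₀ := rfl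
  have hys : ∀ i, y (i + 1) = nxt (y i) := fun i => Function.iterate_succ_apply' _ _ _
  -- the least repetition
  have hrep : ∃ k, ¬ Set.InjOn y (Set.Iic (k + 1)) := by
    by_contra! h
    have : Function.Injective y := by
      intro i j hij
      exact h (max i j) (by simp; omega) (by simp; omega) hij
    exact not_injective_infinite_finite y this
  obtain ⟨hk, hkmin⟩ := And.intro (Nat.find_spec hrep) (fun j => Nat.find_min (m := j) hrep)
  set k := Nat.find hrep with hkdef
  have hinj : Set.InjOn y (Set.Iic k) := by
    rcases Nat.eq_zero_or_pos k with h | h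
    · rw [h]
      intro i hi j hj _
      simp at hi hj
      omega
    · have := hkmin (k - 1) (by omega)
      rwa [not_not, Nat.sub_add_cancel h] at this
  -- by assumption the colors along the fan are used at `x`
  have hcol : ∀ i ≤ k, C s(x, y (i + 1)) = some (m (y i)) ∧ Misses C (y i) (m (y i)) := by
    intro i
    induction i using Nat.strong_induction_on with
    | _ i ih =>
      intro hik
      have hmi : Misses C (y i) (m (y i)) := by
        apply hm
        rcases i with _ | i
        · left; rfl
        · right
          rw [(ih i (by omega) (by omega)).1]
          simp
      refine ⟨?_, hmi⟩
      rw [hys]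
      apply hnxt
      by_contra! hxm
      exact hcon (exists_rotation i C y hC (hinj.mono (Set.Iic_subset_Iic.2 hik)) h0
        (fun j hj => ⟨_, ih j hj (by omega)⟩) hxm hmi)
  -- the repeated vertex is `y (j + 1) = y (k + 1)` with `j < k`
  obtain ⟨j, hjk, hj⟩ : ∃ j < k, m (y j) = m (y k) := by
    have : ∃ i ≤ k, y i = y (k + 1) := by
      by_contra! h
      apply hk
      intro a ha b hb hab
      simp only [Set.mem_Iic] at ha hb
      rcases Nat.lt_or_ge k a with h1 | h1 <;> rcases Nat.lt_or_ge k b with h2 | h2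
      · omega
      · obtain rfl : a = k + 1 := by omega
        exact absurd hab.symm (h b h2)
      · obtain rfl : b = k + 1 := by omega
        exact absurd hab (h a h1)
      · exact hinj h1 h2 hab
    obtain ⟨i, hik, hi⟩ := this
    rcases i with _ | i
    · have := (hcol k le_rfl).1
      rw [← hi, hy0, h0] at this
      simp at this
    · refine ⟨i, hik, ?_⟩
      have h1 := (hcol i (by omega)).1
      rw [hi, (hcol k le_rfl).1] at h1
      simpa using h1.symm
  set α := m (y k) with hα
  have hxα : C s(x, y (k + 1)) = some α := (hcol k le_rfl).1
  have hαβ : α ≠ β := by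
    rintro h
    exact hβ _ (h ▸ hxα)
  have hyx : ∀ i ≤ k, y i ≠ x := by
    intro i hi h
    have := hcol i hi
    rw [h] at this
    exact this.2 _ this.1
  have hyjk : y j ≠ y k := fun h => by
    have := hinj (show j ≤ k by omega) (show k ≤ k from le_rfl) h
    omega
  have hmα : ∀ i ≤ k, i ≠ j → i ≠ k → m (y i) ≠ α := by
    intro i hi hij hik h
    have h1 := (hcol i hi).1
    have h2 := (hcol j hjk.le).1
    rw [h] at h1
    rw [hj] at h2
    have h3 := hC _ _ _ _ h1 h2
    have := hinj (show i + 1 ≤ k by omega) (show j + 1 ≤ k by omega) h3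
    omega
  have hmβ : ∀ i ≤ k, m (y i) ≠ β := by
    intro i hi h
    have h1 := (hcol i hi).1
    rw [h] at h1
    exact hβ _ h1
  obtain ⟨G, hG⟩ : ∃ G : SimpleGraph V,
      ∀ u v, G.Adj u v ↔ u ≠ v ∧ (C s(u, v) = some α ∨ C s(u, v) = some β) :=
    ⟨{ Adj := fun u v => u ≠ v ∧ (C s(u, v) = some α ∨ C s(u, v) = some β)
       symm := ⟨fun u v h => ⟨h.1.symm, by rw [Sym2.eq_swap]; exact h.2⟩⟩
       loopless := ⟨fun u h => h.1 rfl⟩ }, fun _ _ => Iff.rfl⟩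
  have hG2 : ∀ v, G.degree v ≤ 2 := by
    intro v
    rw [← card_neighborFinset_eq_degree, ← Finset.card_pair hαβ]
    refine Finset.card_le_card_of_injOn (fun w => if C s(v, w) = some α then α else β) ?_ ?_
    · intro w _
      dsimp only
      split_ifs <;> simp
    · intro w hw w' hw' h
      simp only [Finset.mem_coe, mem_neighborFinset, hG] at hw hw'
      have hw := hw.2
      have hw' := hw'.2
      dsimp only at h
      split_ifs at h with h1 h2 h2
      · exact hC _ _ _ _ h1 h2
      · exact absurd h hαβ
      · exact absurd h.symm hαβ
      · exact hC _ _ _ _ (hw.resolve_left h1) (hw'.resolve_left h2)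
  have hG1 : ∀ v c, c = α ∨ c = β → Misses C v c → G.degree v ≤ 1 := by
    intro v c hc hmc
    rw [← card_neighborFinset_eq_degree, Finset.card_le_one]
    intro a ha b hb
    simp only [mem_neighborFinset, hG] at ha hb
    have ha := ha.2
    have hb := hb.2
    have h1 := hmc a
    have h2 := hmc b
    rcases hc with rfl | rfl
    · exact hC _ _ _ _ (ha.resolve_left h1) (hb.resolve_left h2)
    · exact hC _ _ _ _ (ha.resolve_right h1) (hb.resolve_right h2)
  have hjα : Misses C (y j) α := hj ▸ (hcol j hjk.le).2
  have hkα : Misses C (y k) α := (hcol k le_rfl).2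
  have hK : ∀ a u v, C s(u, v) = some α ∨ C s(u, v) = some β →
      (u ∈ {w | G.Reachable a w} ↔ v ∈ {w | G.Reachable a w}) := by
    intro a u v huv
    by_cases h : u = v
    · rw [h]
    have hadj : G.Adj u v := (hG u v).2 ⟨h, huv⟩
    exact ⟨fun h => h.trans hadj.reachable, fun h => h.trans hadj.symm.reachable⟩
  -- swap colors on a component and rotate
  have hfin : ∀ l ≤ k, Misses C (y l) α → ¬ G.Reachable x (y l) →
      (j < l → ¬ G.Reachable (y l) (y j)) → (l = j ∨ l = k) → False := by
    intro l hlk hlα hnr hlj hl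
    obtain ⟨C', hC', hs, hout, hin, hoth⟩ := exists_swap hC α β _ (hK (y l))
    have hxK : x ∉ {w | G.Reachable (y l) w} := fun h => hnr h.symm
    obtain ⟨C'', h1, h2⟩ := exists_rotation (x := x) (γ := β) l C' y hC'
      (hinj.mono (Set.Iic_subset_Iic.2 hlk)) (by rw [hout _ _ hxK]; exact h0) (by
        intro i hi
        refine ⟨m (y i), by rw [hout _ _ hxK]; exact (hcol i (by omega)).1, ?_⟩
        apply hoth _ _ _ (hcol i (by omega)).2
        by_cases hij : i = j
        · left
          subst hij
          exact hlj hi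
        · right
          exact ⟨hmα i (by omega) hij (by omega), hmβ i (by omega)⟩)
        (hoth _ _ (Or.inl hxK) hβ) (hin _ (Reachable.refl _) hlα)
    exact hcon ⟨C'', h1, fun e => by rw [h2, hs, hy0]⟩
  by_cases hr : G.Reachable x (y j)
  · by_cases hr' : G.Reachable x (y k)
    · exact not_reachable_three G hG2 (hyx j hjk.le).symm (hyx k le_rfl).symm hyjk
        (hG1 _ β (Or.inr rfl) hβ) (hG1 _ α (Or.inl rfl) hjα) (hG1 _ α (Or.inl rfl) hkα) hr hr'
    · exact hfin k le_rfl hkα hr' (fun _ h => hr' (hr.trans h.symm)) (Or.inr rfl)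
  · exact hfin j hjk.le hjα hr (fun h => absurd h (lt_irrefl _)) (Or.inl rfl)

/-- Fournier's theorem in the form needed here: if the vertices of maximum degree induce a forest,
the graph has an edge coloring with as many colors as the maximum degree. -/
theorem exists_coloring_of_forest_core [Fintype V] [Fintype κ] (H : SimpleGraph V)
    (hdeg : ∀ v, H.degree v ≤ Fintype.card κ)
    (hcore : ∀ S : Finset V, S.Nonempty → (∀ v ∈ S, Fintype.card κ ≤ H.degree v) →
      ∃ x ∈ S, ∀ y ∈ S, ∀ z ∈ S, H.Adj x y → H.Adj x z → y = z) :
    ∃ C : Sym2 V → Option κ, Proper C ∧ ∀ e, (C e).isSome ↔ e ∈ H.edgeSet := by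
  induction hN : H.edgeFinset.card generalizing H with
  | zero =>
    refine ⟨fun _ => none, fun _ _ _ _ h => by simp at h, fun e => ?_⟩
    rw [Finset.card_eq_zero] at hN
    rw [← mem_edgeFinset, hN]
    simp
  | succ N ih =>
    -- choose an edge whose removal allows the fan argument
    obtain ⟨x, y, hxy, hz⟩ : ∃ x y, H.Adj x y ∧
        ∀ z, H.Adj x z → z ≠ y → H.degree z < Fintype.card κ := by
      set S := Finset.univ.filter fun v => Fintype.card κ ≤ H.degree v with hS
      by_cases hne : S.Nonempty
      · obtain ⟨x, hxS, hx⟩ := hcore S hne (by simp [hS])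
        by_cases hy : ∃ y ∈ S, H.Adj x y
        · obtain ⟨y, hyS, hxy⟩ := hy
          refine ⟨x, y, hxy, fun z hz hzy => ?_⟩
          by_contra h
          exact hzy (hx z (by simp [hS]; omega) y hyS hz hxy)
        · push Not at hy
          have hpos : 0 < H.degree x := by
            obtain ⟨e, he⟩ : H.edgeFinset.Nonempty := by rw [← Finset.card_pos]; omega
            induction e using Sym2.ind with
            | _ u v =>
              rw [mem_edgeFinset, mem_edgeSet] at he
              have h1 : 0 < H.degree u := (H.degree_pos_iff_exists_adj u).2 ⟨v, he⟩
              have h2 := hdeg u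
              have h3 : Fintype.card κ ≤ H.degree x := by simpa [hS] using hxS
              omega
          obtain ⟨y, hxy⟩ := (H.degree_pos_iff_exists_adj x).1 hpos
          refine ⟨x, y, hxy, fun z hz _ => ?_⟩
          by_contra h
          exact hy z (by simp [hS]; omega) hz
      · obtain ⟨e, he⟩ : H.edgeFinset.Nonempty := by rw [← Finset.card_pos]; omega
        induction e using Sym2.ind with
        | _ u v =>
          rw [mem_edgeFinset, mem_edgeSet] at he
          refine ⟨u, v, he, fun z _ _ => ?_⟩
          by_contra h
          exact hne ⟨z, by simp [hS]; omega⟩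
    obtain ⟨H', hH'⟩ : ∃ H', H' = H.deleteEdges {s(x, y)} := ⟨_, rfl⟩
    have hle : H' ≤ H := hH' ▸ deleteEdges_le _
    have hle' : ∀ v, H'.degree v ≤ H.degree v := fun v => degree_le_of_le hle
    have hcard : H'.edgeFinset.card = N := by
      have : H'.edgeFinset = H.edgeFinset.erase s(x, y) := by
        ext e
        simp [hH', and_comm]
      rw [this, Finset.card_erase_of_mem (by simpa using hxy), hN]
      rfl
    obtain ⟨C, hC, hCs⟩ := ih H' (fun v => (hle' v).trans (hdeg v)) (by
      intro S hS hSd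
      obtain ⟨a, ha, h⟩ := hcore S hS fun v hv => (hSd v hv).trans (hle' v)
      exact ⟨a, ha, fun b hb c hc hab hac => h b hb c hc (hle hab) (hle hac)⟩) hcard
    have hlt : ∀ u v, H.Adj u v → s(u, v) = s(x, y) → H'.degree u < H.degree u := by
      intro u v huv he
      rw [← card_neighborFinset_eq_degree, ← card_neighborFinset_eq_degree]
      refine Finset.card_lt_card ⟨fun w hw => ?_, fun h => ?_⟩
      · simp only [mem_neighborFinset] at hw ⊢
        exact hle hw
      · have := h (show v ∈ H.neighborFinset u by simpa using huv)
        simp [hH', he] at this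
    have hmiss : ∀ z, H'.degree z < Fintype.card κ → ∃ c, Misses C z c := by
      intro z hz
      by_contra! h
      simp only [Misses] at h
      push Not at h
      choose w hw using h
      have : Fintype.card κ ≤ H'.degree z := by
        rw [← card_neighborFinset_eq_degree, ← Finset.card_univ]
        refine Finset.card_le_card_of_injOn w (fun c _ => ?_) ?_
        · have : s(z, w c) ∈ H'.edgeSet := by rw [← hCs, hw]; rfl
          simpa using this
        · intro c _ d _ hcd
          have h1 := hw c
          rw [hcd, hw d] at h1
          simpa using h1.symm
      omega
    obtain ⟨C', hC', hs⟩ := exists_color_edge hC hxy.ne (by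
        have : ¬ (C s(x, y)).isSome := by rw [hCs]; simp [hH']
        simpa using this)
      (hmiss x ((hlt x y hxy rfl).trans_le (hdeg x)))
      (hmiss y ((hlt y x hxy.symm Sym2.eq_swap).trans_le (hdeg y))) (by
        intro z hzn
        have hz' : H'.Adj x z := by
          rw [← mem_edgeSet, ← hCs]
          exact Option.isSome_iff_ne_none.2 hzn
        refine hmiss z ((hle' z).trans_lt (hz z (hle hz') ?_))
        rintro rfl
        simp [hH'] at hz')
    refine ⟨C', hC', fun e => ?_⟩
    rw [hs, hCs]
    simp only [hH', edgeSet_deleteEdges, Set.mem_sdiff, Set.mem_singleton_iff]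
    constructor
    · rintro (h | rfl)
      · exact h.1
      · exact hxy
    · intro h
      by_cases he : e = s(x, y)
      · exact Or.inr he
      · exact Or.inl ⟨h, he⟩

end

section

open scoped Classical

/-- A matching of `F`, encoded as an involution fixing the uncovered vertices. -/
def IsMat {V : Type*} (F : SimpleGraph V) (μ : V → V) : Prop :=
  ∀ v, μ (μ v) = v ∧ (μ v ≠ v → F.Adj v (μ v))

/-- The number of vertices that a matching leaves uncovered. -/
noncomputable def uncovered {V : Type*} [Fintype V] (μ : V → V) : ℕ :=
  (Finset.univ.filter fun v => μ v = v).card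

/-- A matching covering as many vertices as possible. -/
def IsMaxMat {V : Type*} [Fintype V] (F : SimpleGraph V) (μ : V → V) : Prop :=
  IsMat F μ ∧ ∀ μ', IsMat F μ' → uncovered μ ≤ uncovered μ'

variable {V : Type*} {F : SimpleGraph V}

theorem IsMat.add_edge {μ : V → V} (h : IsMat F μ) {u v : V} (hu : μ u = u) (hv : μ v = v)
    (huv : F.Adj u v) :
    IsMat F (fun z => if z = u then v else if z = v then u else μ z) := by
  have hne := huv.ne
  intro z
  have hz := h z
  by_cases h1 : z = u
  · subst h1; simp [hne.symm, huv]
  by_cases h2 : z = v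
  · subst h2; simp [hne.symm, huv.symm]
  have h3 : μ z ≠ u := fun h' => h1 (by rw [← hz.1, h', hu])
  have h4 : μ z ≠ v := fun h' => h2 (by rw [← hz.1, h', hv])
  simp [h1, h2, h3, h4, hz.1]
  exact hz.2

variable [Fintype V]

theorem exists_isMaxMat (F : SimpleGraph V) : ∃ μ, IsMaxMat F μ := by
  have : ∃ k, ∃ μ, IsMat F μ ∧ uncovered μ = k :=
    ⟨_, id, fun v => ⟨rfl, fun h => absurd rfl h⟩, rfl⟩
  obtain ⟨μ, h1, h2⟩ := Nat.find_spec this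
  exact ⟨μ, h1, fun μ' h => h2 ▸ Nat.find_min' this ⟨μ', h, rfl⟩⟩

theorem IsMaxMat.not_adj {μ : V → V} (h : IsMaxMat F μ) {u v : V} (hu : μ u = u) (hv : μ v = v) :
    ¬ F.Adj u v := by
  intro huv
  have := h.2 _ (h.1.add_edge hu hv huv)
  refine absurd this (not_le.2 (Finset.card_lt_card ⟨fun z hz => ?_, fun hsub => ?_⟩))
  · simp only [Finset.mem_filter, Finset.mem_univ, true_and] at hz ⊢
    split_ifs at hz with h1 h2
    · rw [h1, hu]
    · rw [h2, hv]
    · exact hz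
  · have := hsub (show u ∈ _ by simpa using hu)
    simp [huv.ne'] at this

/-- Replacing an edge of a maximum matching by an edge to an uncovered vertex. -/
theorem IsMaxMat.exchange {μ : V → V} (h : IsMaxMat F μ) {u p : V} (hu : μ u = u)
    (hup : F.Adj u p) :
    ∃ μ', IsMaxMat F μ' ∧ μ' (μ p) = μ p ∧ ∀ v, v ≠ u → μ v = v → μ' v = v := by
  have hp : μ p ≠ p := fun hp => h.not_adj hu hp hup
  have hne := hup.ne
  have hpp := (h.1 p).1
  have hqu : μ p ≠ u := fun h' => hne (by rw [← hu, ← h', hpp])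
  set q := μ p with hq
  have hdel : IsMat F (fun z => if z = p then p else if z = q then q else μ z) := by
    intro z
    have hz := h.1 z
    by_cases h1 : z = p
    · subst h1; simp
    by_cases h2 : z = q
    · simp [h2, hp]
    have h3 : μ z ≠ p := fun h' => h2 (by rw [← hz.1, h'])
    have h4 : μ z ≠ q := fun h' => h1 (by rw [← hz.1, h', hpp])
    simp [h1, h2, h3, h4, hz.1]
    exact hz.2
  have hadd := hdel.add_edge (u := u) (v := p) (by simp [hne, hqu.symm, hu]) (by simp) hup
  refine ⟨_, ⟨hadd, fun μ' hμ' => le_trans ?_ (h.2 μ' hμ')⟩, by simp [hqu, hp], ?_⟩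
  · refine Finset.card_le_card_of_injOn (fun z => if z = q then u else z) ?_ ?_
    · intro z hz
      simp only [Finset.coe_filter, Finset.mem_univ, true_and, Set.mem_ofPred_eq] at hz ⊢
      split_ifs at hz ⊢ with h1 h2 h3 h4 h5
      all_goals first | exact hu | simp_all
    · intro z hz w hw hzw
      have : μ u = u := hu
      simp only [Finset.coe_filter, Finset.mem_univ, true_and, Set.mem_ofPred_eq] at hz hw
      dsimp only at hzw
      split_ifs at hzw with h1 h2 h2
      · rw [h1, h2]
      · subst hzw; simp [hne.symm] at hw
      · subst hzw; simp [hne.symm] at hz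
      · exact hzw
  · intro v hvu hv
    have h1 : v ≠ p := fun h' => hp (by rw [h'] at hv; exact hv)
    have h2 : v ≠ q := fun h' => hp (by rw [h', hpp] at hv; exact hv.symm)
    simp [hvu, h1, h2, hv]

theorem IsMaxMat.degree_add_le {S : Finset V} (hF : ∀ u v, F.Adj u v → u ∈ S) {μ : V → V}
    (h : IsMaxMat F μ) {u v : V} (huS : u ∈ S) (hvS : v ∈ S) (huv : u ≠ v) (hu : μ u = u)
    (hv : μ v = v) : F.degree u + F.degree v + 2 ≤ S.card := by
  have hinj : Function.Injective μ := fun a b hab => by rw [← (h.1 a).1, hab, (h.1 b).1]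
  have hcov : ∀ z p, μ z = z → F.Adj z p → μ p ≠ u ∧ μ p ≠ v ∧ p ≠ u ∧ p ≠ v := by
    intro z p hz hzp
    refine ⟨fun h' => ?_, fun h' => ?_, ?_, ?_⟩
    · have : p = u := hinj (h'.trans hu.symm)
      exact h.not_adj hz hu (this ▸ hzp)
    · have : p = v := hinj (h'.trans hv.symm)
      exact h.not_adj hz hv (this ▸ hzp)
    · rintro rfl
      exact h.not_adj hz hu hzp
    · rintro rfl
      exact h.not_adj hz hv hzp
  have hμS : ∀ p ∈ S, μ p ∈ S := by
    intro p hp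
    by_cases h' : μ p = p
    · rwa [h']
    · exact hF _ _ ((h.1 p).2 h').symm
  have hdisj : Disjoint (F.neighborFinset u) ((F.neighborFinset v).image μ) := by
    rw [Finset.disjoint_left]
    intro p hp hp'
    rw [Finset.mem_image] at hp'
    obtain ⟨q, hq, rfl⟩ := hp'
    rw [mem_neighborFinset] at hp hq
    obtain ⟨μ', h1, h2, h3⟩ := h.exchange hu hp
    rw [(h.1 q).1] at h2
    exact h1.not_adj (h3 v huv.symm hv) h2 hq
  have hsub : F.neighborFinset u ∪ (F.neighborFinset v).image μ ⊆ (S.erase u).erase v := by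
    intro p hp
    rw [Finset.mem_union, Finset.mem_image] at hp
    rw [Finset.mem_erase, Finset.mem_erase]
    rcases hp with hp | ⟨q, hq, rfl⟩
    · rw [mem_neighborFinset] at hp
      obtain ⟨_, _, h1, h2⟩ := hcov u p hu hp
      exact ⟨h2, h1, hF _ _ hp.symm⟩
    · rw [mem_neighborFinset] at hq
      obtain ⟨h1, h2, _, _⟩ := hcov v q hv hq
      exact ⟨h2, h1, hμS _ (hF _ _ hq.symm)⟩
  have := Finset.card_le_card hsub
  rw [Finset.card_union_of_disjoint hdisj, Finset.card_image_of_injective _ hinj,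
    card_neighborFinset_eq_degree, card_neighborFinset_eq_degree,
    Finset.card_erase_of_mem (by simp [huv.symm, hvS]), Finset.card_erase_of_mem huS] at this
  have h2 : 1 < S.card := Finset.one_lt_card.2 ⟨u, huS, v, hvS, huv⟩
  omega

/-- A sufficient condition for a perfect matching that tolerates few pairs of small degree sum. -/
theorem exists_perfect_mat {S : Finset V} (hF : ∀ u v, F.Adj u v → u ∈ S) (hS : Even S.card)
    (d : V → ℕ) (hd : ∀ v ∈ S, d v ≤ F.degree v)
    (h : ∀ u ∈ S, ∀ v ∈ S, u ≠ v → S.card ≤ d u + d v + 1 ∨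
      (S.filter fun q => q ≠ u ∧ q ≠ v ∧ d q + d v + 2 ≤ S.card).card < d u ∨
      (S.filter fun q => q ≠ u ∧ q ≠ v ∧ d q + d u + 2 ≤ S.card).card < d v) :
    ∃ μ, IsMat F μ ∧ ∀ v ∈ S, μ v ≠ v := by
  obtain ⟨μ, hμ⟩ := exists_isMaxMat F
  refine ⟨μ, hμ.1, ?_⟩
  by_contra! hex
  obtain ⟨u, huS, hu⟩ := hex
  have hinj : Function.Injective μ := fun a b hab => by rw [← (hμ.1 a).1, hab, (hμ.1 b).1]
  obtain ⟨v, hvS, hvu, hv⟩ : ∃ v ∈ S, v ≠ u ∧ μ v = v := by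
    by_contra! hne
    let σ : Equiv.Perm V := ⟨μ, μ, fun a => (hμ.1 a).1, fun a => (hμ.1 a).1⟩
    have h1 : 2 ∣ σ.support.card := Equiv.Perm.two_dvd_card_support (by
      ext a
      simp [sq, σ, (hμ.1 a).1])
    have h2 : σ.support = S.erase u := by
      ext a
      rw [Equiv.Perm.mem_support, Finset.mem_erase]
      constructor
      · intro ha
        exact ⟨fun h' => ha (h' ▸ hu), hF _ _ ((hμ.1 a).2 ha)⟩
      · rintro ⟨h1, h2⟩
        exact hne a h2 h1
    rw [h2, Finset.card_erase_of_mem huS] at h1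
    have := Finset.card_pos.2 ⟨u, huS⟩
    obtain ⟨m, hm⟩ := hS
    omega
  have key : ∀ u ∈ S, ∀ v ∈ S, u ≠ v → μ u = u → μ v = v →
      d u ≤ (S.filter fun q => q ≠ u ∧ q ≠ v ∧ d q + d v + 2 ≤ S.card).card := by
    intro u huS v hvS huv hu hv
    refine (hd u huS).trans ?_
    rw [← card_neighborFinset_eq_degree]
    refine Finset.card_le_card_of_injOn μ (fun p hp => ?_) hinj.injOn
    simp only [Finset.mem_coe, mem_neighborFinset] at hp
    obtain ⟨μ', h1, h2, h3⟩ := hμ.exchange hu hp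
    have hpS : μ p ∈ S := by
      by_cases h' : μ p = p
      · rw [h']; exact hF _ _ hp.symm
      · exact hF _ _ ((hμ.1 p).2 h').symm
    have hne : ∀ z, μ z = z → μ p ≠ z := fun z hz h' => by
      have : p = z := hinj (h'.trans hz.symm)
      exact hμ.not_adj hu hz (this ▸ hp)
    have := h1.degree_add_le hF hpS hvS (hne v hv) h2 (h3 v huv.symm hv)
    have h4 := hd _ hpS
    have h5 := hd _ hvS
    simp only [Finset.coe_filter, Set.mem_ofPred_eq]
    exact ⟨hpS, hne u hu, hne v hv, by omega⟩
  rcases h u huS v hvS hvu.symm with h1 | h1 | h1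
  · have h2 := hμ.degree_add_le hF huS hvS hvu.symm hu hv
    have h4 := hd _ huS
    have h5 := hd _ hvS
    omega
  · exact absurd (key u huS v hvS hvu.symm hu hv) (not_le.2 h1)
  · refine absurd (key v hvS u huS hvu hv hu) (not_le.2 ?_)
    simpa only [and_left_comm] using h1

end

section

open scoped Classical

/-- The graph obtained by deleting the edges of a matching. -/
def peel {V : Type*} (R : SimpleGraph V) (μ : V → V) : SimpleGraph V where
  Adj u v := R.Adj u v ∧ μ u ≠ v ∧ μ v ≠ u
  symm := ⟨fun _ _ h => ⟨h.1.symm, h.2.2, h.2.1⟩⟩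
  loopless := ⟨fun u h => R.loopless.irrefl u h.1⟩

/-- The graph `R` has a proper edge coloring with colors from `Γ` that agrees with `φ`. -/
def Ext {V : Type*} (φ : Sym2 V → Option ℕ) (R : SimpleGraph V) (Γ : Finset ℕ) : Prop :=
  ∃ C : Sym2 V → ℕ, (∀ u v w, R.Adj u v → R.Adj u w → C s(u, v) = C s(u, w) → v = w) ∧
    (∀ u v, R.Adj u v → C s(u, v) ∈ Γ) ∧
    ∀ u v c, R.Adj u v → φ s(u, v) = some c → C s(u, v) = c

variable {V : Type*} {R : SimpleGraph V} {φ : Sym2 V → Option ℕ} {Γ : Finset ℕ} {μ : V → V}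

theorem peel_le (R : SimpleGraph V) (μ : V → V) : peel R μ ≤ R := fun _ _ h => h.1

theorem IsMat.peel_adj {F : SimpleGraph V} (hμ : IsMat F μ) {u v : V} :
    (peel R μ).Adj u v ↔ R.Adj u v ∧ μ u ≠ v :=
  ⟨fun h => ⟨h.1, h.2.1⟩, fun h => ⟨h.1, h.2, fun h' => h.2 (by rw [← h', (hμ v).1])⟩⟩

theorem IsMat.mono {F F' : SimpleGraph V} (hμ : IsMat F μ) (h : F ≤ F') : IsMat F' μ :=
  fun v => ⟨(hμ v).1, fun hv => h ((hμ v).2 hv)⟩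

theorem IsMat.degree_peel [Fintype V] (hμ : IsMat R μ) (v : V) :
    (peel R μ).degree v = R.degree v - if μ v = v then 0 else 1 := by
  rw [← card_neighborFinset_eq_degree, ← card_neighborFinset_eq_degree]
  split_ifs with h
  · rw [Nat.sub_zero]
    congr 1
    ext w
    rw [mem_neighborFinset, mem_neighborFinset, hμ.peel_adj, h]
    exact ⟨fun h => h.1, fun h => ⟨h, h.ne⟩⟩
  · rw [← Finset.card_erase_of_mem (show μ v ∈ R.neighborFinset v by simpa using (hμ v).2 h)]
    congr 1
    ext w
    rw [mem_neighborFinset, Finset.mem_erase, mem_neighborFinset, hμ.peel_adj, and_comm, ne_comm]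

/-- Giving a color to a matching that contains all edges precolored with it. -/
theorem Ext.of_peel {c : ℕ} (hc : c ∈ Γ) (hμ : IsMat R μ)
    (h1 : ∀ v d, μ v ≠ v → φ s(v, μ v) = some d → d = c)
    (h : Ext φ (peel R μ) (Γ.erase c)) : Ext φ R Γ := by
  obtain ⟨C, hC1, hC2, hC3⟩ := h
  let D : Sym2 V → ℕ := fun e => if ∃ u, e = s(u, μ u) then c else C e
  have hD : ∀ u v, R.Adj u v → D s(u, v) = if μ u = v then c else C s(u, v) := by
    intro u v huv
    by_cases h : μ u = v
    · have : ∃ w, s(u, v) = s(w, μ w) := ⟨u, by rw [h]⟩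
      simp only [D, if_pos this, if_pos h]
    · have : ¬ ∃ w, s(u, v) = s(w, μ w) := by
        rintro ⟨w, hw⟩
        rcases Sym2.eq_iff.1 hw with ⟨rfl, h'⟩ | ⟨h', rfl⟩
        · exact h h'.symm
        · rw [h', (hμ v).1] at h
          exact h rfl
      simp only [D, if_neg this, if_neg h]
  refine ⟨D, ?_, ?_, ?_⟩
  · intro u v w huv huw he
    rw [hD _ _ huv, hD _ _ huw] at he
    split_ifs at he with h1 h2 h2
    · rw [← h1, h2]
    · have := hC2 u w (hμ.peel_adj.2 ⟨huw, h2⟩)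
      rw [← he] at this
      simp at this
    · have := hC2 u v (hμ.peel_adj.2 ⟨huv, h1⟩)
      rw [he] at this
      simp at this
    · exact hC1 u v w (hμ.peel_adj.2 ⟨huv, h1⟩) (hμ.peel_adj.2 ⟨huw, h2⟩) he
  · intro u v huv
    rw [hD _ _ huv]
    split_ifs with h
    · exact hc
    · exact Finset.mem_of_mem_erase (hC2 u v (hμ.peel_adj.2 ⟨huv, h⟩))
  · intro u v d huv hd
    rw [hD _ _ huv]
    split_ifs with h
    · subst h
      exact (h1 u d huv.ne' hd).symm
    · exact hC3 u v d (hμ.peel_adj.2 ⟨huv, h⟩) hd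

/-- The base case: apart from one color class, the precolored edges form a star. -/
theorem Ext.of_star [Fintype V] (hφ : Proper φ) {r : ℕ} (hreg : ∀ v, R.degree v = r)
    (hΓ : Γ.card = r + 1) (hφΓ : ∀ u v c, R.Adj u v → φ s(u, v) = some c → c ∈ Γ)
    {c₀ : ℕ} (hc₀ : c₀ ∈ Γ) (w : V)
    (hstar : ∀ u v c, R.Adj u v → φ s(u, v) = some c → c ≠ c₀ → u = w ∨ v = w) :
    Ext φ R Γ := by
  -- a maximal matching containing the class of `c₀` and no other precolored edge
  obtain ⟨F, hF⟩ : ∃ F : SimpleGraph V, ∀ u v, F.Adj u v ↔ R.Adj u v ∧ (φ s(u, v) = some c₀ ∨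
      φ s(u, v) = none ∧ (∀ x, R.Adj u x → φ s(u, x) ≠ some c₀) ∧
        ∀ x, R.Adj v x → φ s(v, x) ≠ some c₀) :=
    ⟨{ Adj := fun u v => R.Adj u v ∧ (φ s(u, v) = some c₀ ∨
        φ s(u, v) = none ∧ (∀ x, R.Adj u x → φ s(u, x) ≠ some c₀) ∧
        ∀ x, R.Adj v x → φ s(v, x) ≠ some c₀)
       symm := ⟨fun u v h => ⟨h.1.symm, by
        rw [Sym2.eq_swap]; exact h.2.imp_right fun h => ⟨h.1, h.2.2, h.2.1⟩⟩⟩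
       loopless := ⟨fun u h => R.loopless.irrefl u h.1⟩ }, fun _ _ => Iff.rfl⟩
  obtain ⟨μ, hμ⟩ := exists_isMaxMat F
  have hFR : F ≤ R := fun u v h => ((hF u v).1 h).1
  have hμR : IsMat R μ := hμ.1.mono hFR
  have hE : ∀ u v, R.Adj u v → φ s(u, v) = some c₀ → μ u = v := by
    intro u v huv hc
    have hone : ∀ u v, R.Adj u v → φ s(u, v) = some c₀ → μ u ≠ u → μ u = v := by
      intro u v huv hc h
      rcases ((hF _ _).1 ((hμ.1 u).2 h)).2 with h1 | h1
      · exact hφ _ _ _ _ h1 hc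
      · exact absurd hc (h1.2.1 v huv)
    have hcs : φ s(v, u) = some c₀ := by rw [Sym2.eq_swap]; exact hc
    by_cases hu : μ u = u
    · by_cases hv : μ v = v
      · exact absurd ((hF u v).2 ⟨huv, Or.inl hc⟩) (hμ.not_adj hu hv)
      · rw [← hone v u huv.symm hcs hv, (hμ.1 v).1]
    · exact hone u v huv hc hu
  have hcov : ∀ u d, μ u ≠ u → φ s(u, μ u) = some d → d = c₀ := by
    intro u d hu hd
    rcases ((hF _ _).1 ((hμ.1 u).2 hu)).2 with h | h
    · rw [h] at hd
      simpa using hd.symm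
    · rw [h.1] at hd
      simp at hd
  have hcore : ∀ u v, R.Adj u v → μ u = u → μ v = v → u = w ∨ v = w := by
    intro u v huv hu hv
    have hn := hμ.not_adj hu hv
    rw [hF] at hn
    simp only [huv, true_and, not_or] at hn
    rcases hc : φ s(u, v) with _ | d
    · refine absurd ⟨hc, fun x hx hcx => ?_, fun x hx hcx => ?_⟩ hn.2
      · exact hx.ne (by rw [← hE u x hx hcx, hu])
      · exact hx.ne (by rw [← hE v x hx hcx, hv])
    · refine hstar u v d huv hc ?_
      rintro rfl
      exact hn.1 hc
  have hdeg : ∀ v, (peel R μ).degree v = r - if μ v = v then 0 else 1 := fun v => by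
    rw [hμR.degree_peel, hreg]
  refine Ext.of_peel hc₀ hμR hcov ?_
  rcases Nat.eq_zero_or_pos r with hr | hr
  · refine ⟨fun _ => 0, fun u v _ huv => ?_, fun u v huv => ?_, fun u v _ huv => ?_⟩ <;>
    · have h0 := hdeg u
      have := ((peel R μ).degree_pos_iff_exists_adj u).2 ⟨v, huv⟩
      omega
  obtain ⟨C, hC, hCs⟩ := exists_coloring_of_forest_core (κ := Fin r) (peel R μ)
    (fun v => by rw [hdeg, Fintype.card_fin]; omega) (by
      intro S hS hSd
      have hSμ : ∀ v ∈ S, μ v = v := by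
        intro v hv
        have := hSd v hv
        rw [hdeg, Fintype.card_fin] at this
        by_contra h
        rw [if_neg h] at this
        omega
      by_cases hx : ∃ x ∈ S, x ≠ w
      · obtain ⟨x, hxS, hxw⟩ := hx
        refine ⟨x, hxS, fun y hy z hz hxy hxz => ?_⟩
        rw [(hcore x y hxy.1 (hSμ x hxS) (hSμ y hy)).resolve_left hxw,
          (hcore x z hxz.1 (hSμ x hxS) (hSμ z hz)).resolve_left hxw]
      · push Not at hx
        obtain ⟨x, hxS⟩ := hS
        refine ⟨x, hxS, fun y hy z hz hxy hxz => ?_⟩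
        rw [hx y hy, hx z hz])
  -- permute the colors so that they agree on the star
  set s : Finset (Fin r) := Finset.univ.filter fun k =>
    ∃ a d, (peel R μ).Adj w a ∧ C s(w, a) = some k ∧ φ s(w, a) = some d with hs
  have hsk : ∀ k, ∃ d, k ∈ s → ∃ a, (peel R μ).Adj w a ∧ C s(w, a) = some k ∧
      φ s(w, a) = some d := by
    intro k
    by_cases h : k ∈ s
    · simp only [hs, Finset.mem_filter, Finset.mem_univ, true_and] at h
      obtain ⟨a, d, h⟩ := h
      exact ⟨d, fun _ => ⟨a, h⟩⟩
    · exact ⟨0, fun h' => absurd h' h⟩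
  choose f hf using hsk
  have hne : ∀ u v d, (peel R μ).Adj u v → φ s(u, v) = some d → d ≠ c₀ := by
    rintro u v d huv hd rfl
    exact huv.2.1 (hE u v huv.1 hd)
  obtain ⟨g, hg⟩ := Finset.exists_equiv_extend_of_card_eq (α := Fin r) (t := Γ.erase c₀)
    (by rw [Fintype.card_fin, Finset.card_erase_of_mem hc₀, hΓ]; rfl) (s := s) (f := f) (by
      intro d hd
      rw [Finset.mem_image] at hd
      obtain ⟨k, hk, rfl⟩ := hd
      obtain ⟨a, h1, h2, h3⟩ := hf k hk
      exact Finset.mem_erase.2 ⟨hne _ _ _ h1 h3, hφΓ _ _ _ h1.1 h3⟩) (by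
      intro k hk l hl hkl
      obtain ⟨a, h1, h2, h3⟩ := hf k hk
      obtain ⟨b, h4, h5, h6⟩ := hf l hl
      rw [hkl] at h3
      rw [hφ _ _ _ _ h3 h6, h5] at h2
      simpa using h2.symm)
  have hCsome : ∀ u v, (peel R μ).Adj u v → ∃ k, C s(u, v) = some k := fun u v huv =>
    Option.isSome_iff_exists.1 ((hCs _).2 huv)
  let D : Sym2 V → ℕ := fun e => (C e).elim 0 fun k => g k
  have hD : ∀ e k, C e = some k → D e = g k := fun e k h => by simp [D, h]
  have hDw : ∀ a d, (peel R μ).Adj w a → φ s(w, a) = some d → D s(w, a) = d := by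
    intro a d ha hd
    obtain ⟨k, hk⟩ := hCsome w a ha
    have hks : k ∈ s := by
      simp only [hs, Finset.mem_filter, Finset.mem_univ, true_and]
      exact ⟨a, d, ha, hk, hd⟩
    obtain ⟨b, h1, h2, h3⟩ := hf k hks
    rw [hC _ _ _ _ h2 hk, hd] at h3
    rw [hD _ _ hk, hg k hks]
    simpa using h3.symm
  refine ⟨D, ?_, ?_, ?_⟩
  · intro u v x huv hux he
    obtain ⟨k, hk⟩ := hCsome u v huv
    obtain ⟨l, hl⟩ := hCsome u x hux
    rw [hD _ _ hk, hD _ _ hl] at he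
    have := g.injective (Subtype.ext he)
    subst this
    exact hC _ _ _ _ hk hl
  · intro u v huv
    obtain ⟨k, hk⟩ := hCsome u v huv
    rw [hD _ _ hk]
    exact (g k).2
  · intro u v d huv hd
    rcases hstar u v d huv.1 hd (hne _ _ _ huv hd) with rfl | rfl
    · exact hDw v d huv hd
    · rw [Sym2.eq_swap] at hd ⊢
      exact hDw u d huv.symm hd

end

section

open scoped Classical

/-- The vertex `v` lies on an edge of `R` precolored with `c`. -/
def Cov {V : Type*} (φ : Sym2 V → Option ℕ) (R : SimpleGraph V) (c : ℕ) (v : V) : Prop :=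
  ∃ w, R.Adj v w ∧ φ s(v, w) = some c

/-- The uncolored edges of `R` that avoid the class of the color `c`. -/
def avail {V : Type*} (φ : Sym2 V → Option ℕ) (R : SimpleGraph V) (c : ℕ) : SimpleGraph V where
  Adj u v := R.Adj u v ∧ φ s(u, v) = none ∧ ¬ Cov φ R c u ∧ ¬ Cov φ R c v
  symm := ⟨fun u v h => ⟨h.1.symm, by rw [Sym2.eq_swap]; exact h.2.1, h.2.2.2, h.2.2.1⟩⟩
  loopless := ⟨fun u h => R.loopless.irrefl u h.1⟩

/-- The edges of `R` precolored with a color other than `c`. -/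
def others {V : Type*} (φ : Sym2 V → Option ℕ) (R : SimpleGraph V) (c : ℕ) : SimpleGraph V where
  Adj u v := R.Adj u v ∧ φ s(u, v) ≠ none ∧ φ s(u, v) ≠ some c
  symm := ⟨fun u v h => ⟨h.1.symm, by rw [Sym2.eq_swap]; exact h.2⟩⟩
  loopless := ⟨fun u h => R.loopless.irrefl u h.1⟩

/-- One side of a graph on `ι × Fin 2`, with an additional vertex `none` to which `i` is joined
when the rung at `i` is present. -/
def side {ι : Type*} (F : SimpleGraph (ι × Fin 2)) (a : Fin 2) : SimpleGraph (Option ι) where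
  Adj u v := (∃ i j, u = some i ∧ v = some j ∧ F.Adj (i, a) (j, a)) ∨
    (∃ i, u = some i ∧ v = none ∧ F.Adj (i, 0) (i, 1)) ∨
    ∃ i, u = none ∧ v = some i ∧ F.Adj (i, 0) (i, 1)
  symm := ⟨by
    rintro u v (⟨i, j, h1, h2, h3⟩ | ⟨i, h1, h2, h3⟩ | ⟨i, h1, h2, h3⟩)
    · exact Or.inl ⟨j, i, h2, h1, h3.symm⟩
    · exact Or.inr (Or.inr ⟨i, h2, h1, h3⟩)
    · exact Or.inr (Or.inl ⟨i, h2, h1, h3⟩)⟩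
  loopless := ⟨by
    rintro u (⟨i, j, h1, h2, h3⟩ | ⟨i, h1, h2, h3⟩ | ⟨i, h1, h2, h3⟩)
    · rw [h1, Option.some.injEq] at h2
      exact h3.ne (by rw [h2])
    · simp [h1] at h2
    · simp [h1] at h2⟩

/-- The subgraph on the same vertices keeping only the edges inside `S`. -/
def inside {W : Type*} (F : SimpleGraph W) (S : Finset W) : SimpleGraph W where
  Adj u v := F.Adj u v ∧ u ∈ S ∧ v ∈ S
  symm := ⟨fun _ _ h => ⟨h.1.symm, h.2.2, h.2.1⟩⟩
  loopless := ⟨fun u h => F.loopless.irrefl u h.1⟩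

section Side

variable {ι : Type*} {F : SimpleGraph (ι × Fin 2)} {a : Fin 2}

theorem side_some_some {i j : ι} : (side F a).Adj (some i) (some j) ↔ F.Adj (i, a) (j, a) := by
  simp [side]

theorem side_some_none {i : ι} : (side F a).Adj (some i) none ↔ F.Adj (i, 0) (i, 1) := by
  simp [side]

theorem side_none_some {i : ι} : (side F a).Adj none (some i) ↔ F.Adj (i, 0) (i, 1) := by
  simp [side]

end Side

variable {ι : Type*} {R : SimpleGraph (ι × Fin 2)} {φ : Sym2 (ι × Fin 2) → Option ℕ} {c : ℕ}

/-- A perfect matching of `R` containing the class of `c` and no other precolored edge. -/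
structure IsClassMat {V : Type*} (φ : Sym2 V → Option ℕ) (R : SimpleGraph V) (c : ℕ)
    (μ : V → V) : Prop where
  isMat : IsMat R μ
  ne : ∀ v, μ v ≠ v
  eq_of_mem : ∀ u v, R.Adj u v → φ s(u, v) = some c → μ u = v
  color : ∀ v d, φ s(v, μ v) = some d → d = c

theorem fin_two_flip (k : Fin 2) : 1 - (1 - k) = k := by fin_cases k <;> rfl

theorem adj_flip {F : SimpleGraph (ι × Fin 2)} {i : ι} (h : F.Adj (i, 0) (i, 1)) (k : Fin 2) :
    F.Adj (i, k) (i, 1 - k) := by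
  fin_cases k
  · exact h
  · exact h.symm

/-- Perfect matchings of the two sides, together with at most one rung `x`, combine to a
matching. -/
theorem exists_classMat (hφ : Proper φ) (x : Option ι) (f : Fin 2 → ι → ι)
    (hx : ∀ i, x = some i → (avail φ R c).Adj (i, 0) (i, 1))
    (hf : ∀ k i, ¬ Cov φ R c (i, k) → x ≠ some i →
      (avail φ R c).Adj (i, k) (f k i, k) ∧ f k (f k i) = i ∧ x ≠ some (f k i)) :
    ∃ μ, IsClassMat φ R c μ ∧
      ∀ i, μ (i, 0) = (i, 1) → φ s((i, 0), (i, 1)) = some c ∨ x = some i := by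
  have hy : ∀ v, ∃ w, Cov φ R c v → R.Adj v w ∧ φ s(v, w) = some c := by
    intro v
    by_cases h : Cov φ R c v
    · exact h.imp fun w hw _ => hw
    · exact ⟨v, fun h' => absurd h' h⟩
  choose y hy using hy
  have hyy : ∀ v, Cov φ R c v → Cov φ R c (y v) ∧ y (y v) = v := by
    intro v h
    obtain ⟨h1, h2⟩ := hy v h
    rw [Sym2.eq_swap] at h2
    have h3 : Cov φ R c (y v) := ⟨v, h1.symm, h2⟩
    exact ⟨h3, hφ _ _ _ _ (hy _ h3).2 h2⟩
  let μ : ι × Fin 2 → ι × Fin 2 := fun v =>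
    if Cov φ R c v then y v else if x = some v.1 then (v.1, 1 - v.2) else (f v.2 v.1, v.2)
  have h1 : ∀ v, Cov φ R c v → μ v = y v := fun v h => by simp only [μ, if_pos h]
  have h2 : ∀ i k, ¬ Cov φ R c (i, k) → x = some i → μ (i, k) = (i, 1 - k) := fun i k h h' => by
    simp only [μ, if_neg h, if_pos h']
  have h3 : ∀ i k, ¬ Cov φ R c (i, k) → x ≠ some i → μ (i, k) = (f k i, k) := fun i k h h' => by
    simp only [μ, if_neg h, if_neg h']
  have hmat : IsMat R μ ∧ (∀ v, μ v ≠ v) ∧ ∀ v d, φ s(v, μ v) = some d → d = c := by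
    have : ∀ v, μ (μ v) = v ∧ R.Adj v (μ v) ∧ ∀ d, φ s(v, μ v) = some d → d = c := by
      rintro ⟨i, k⟩
      by_cases hc : Cov φ R c (i, k)
      · rw [h1 _ hc, h1 _ (hyy _ hc).1]
        refine ⟨(hyy _ hc).2, (hy _ hc).1, fun d hd => ?_⟩
        rw [(hy _ hc).2] at hd
        simpa using hd.symm
      by_cases hxi : x = some i
      · rw [h2 _ _ hc hxi]
        have hadj := adj_flip (hx i hxi) k
        rw [h2 _ _ hadj.2.2.2 hxi, fin_two_flip]
        refine ⟨rfl, hadj.1, fun d hd => ?_⟩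
        rw [hadj.2.1] at hd
        simp at hd
      · rw [h3 _ _ hc hxi]
        obtain ⟨hadj, hff, hxf⟩ := hf k i hc hxi
        rw [h3 _ _ hadj.2.2.2 hxf, hff]
        refine ⟨rfl, hadj.1, fun d hd => ?_⟩
        rw [hadj.2.1] at hd
        simp at hd
    exact ⟨fun v => ⟨(this v).1, fun _ => (this v).2.1⟩, fun v => (this v).2.1.ne',
      fun v => (this v).2.2⟩
  refine ⟨μ, ⟨hmat.1, hmat.2.1, fun u v huv hc => ?_, hmat.2.2⟩, fun i hi => ?_⟩
  · have hu : Cov φ R c u := ⟨v, huv, hc⟩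
    rw [h1 u hu]
    exact hφ _ _ _ _ (hy u hu).2 hc
  · by_cases hc : Cov φ R c (i, 0)
    · left
      rw [h1 _ hc] at hi
      rw [← hi]
      exact (hy _ hc).2
    by_cases hxi : x = some i
    · exact Or.inr hxi
    · rw [h3 _ _ hc hxi] at hi
      simp at hi

/-- Extracting a partial involution of `ι` from a matching of one side. -/
theorem exists_side_fun {F : SimpleGraph (ι × Fin 2)} {a : Fin 2} {S : Finset (Option ι)}
    {μ : Option ι → Option ι} (hμ : IsMat (inside (side F a) S) μ) (hS : ∀ v ∈ S, μ v ≠ v) :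
    ∃ f : ι → ι, ∀ i, some i ∈ S → some i ≠ μ none ∨ none ∉ S →
      F.Adj (i, a) (f i, a) ∧ f (f i) = i ∧ (none ∈ S → some (f i) ≠ μ none) ∧ some (f i) ∈ S := by
  have key : ∀ i, some i ∈ S → some i ≠ μ none ∨ none ∉ S → ∃ j, μ (some i) = some j := by
    intro i hi h
    rcases hj : μ (some i) with _ | j
    · exfalso
      have h1 := (hμ (some i)).1
      rw [hj] at h1
      have h2 := (hμ (some i)).2 (hS _ hi)
      rw [hj] at h2
      rcases h with h | h
      · exact h h1.symm
      · exact h h2.2.2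
    · exact ⟨j, rfl⟩
  refine ⟨fun i => (μ (some i)).getD i, fun i hi h => ?_⟩
  obtain ⟨j, hj⟩ := key i hi h
  have h2 := (hμ (some i)).2 (hS _ hi)
  have h1 := (hμ (some i)).1
  rw [hj] at h1 h2
  simp only [hj, Option.getD_some, h1]
  refine ⟨side_some_some.1 h2.1, trivial, fun hn h' => ?_, h2.2.2⟩
  rw [h', (hμ none).1] at h1
  simp at h1

theorem fin_two_cases {a b : Fin 2} (hab : a ≠ b) (k : Fin 2) : k = a ∨ k = b := by
  omega

variable [Fintype ι]

/-- The vertices of side `a` outside the class of `c`. -/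
noncomputable def freeSide (φ : Sym2 (ι × Fin 2) → Option ℕ) (R : SimpleGraph (ι × Fin 2)) (c : ℕ)
    (a : Fin 2) : Finset (Option ι) :=
  Finset.univ.filter fun w => ∃ i, w = some i ∧ ¬ Cov φ R c (i, a)

theorem some_mem_freeSide {a : Fin 2} {i : ι} :
    some i ∈ freeSide φ R c a ↔ ¬ Cov φ R c (i, a) := by
  simp [freeSide]

theorem none_notMem_freeSide {a : Fin 2} : none ∉ freeSide φ R c a := by
  simp [freeSide]

theorem exists_classMat_odd (hφ : Proper φ)
    (h : ∀ k, ∃ μ, IsMat (inside (side (avail φ R c) k) (freeSide φ R c k)) μ ∧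
      ∀ v ∈ freeSide φ R c k, μ v ≠ v) :
    ∃ μ, IsClassMat φ R c μ ∧ ∀ i, μ (i, 0) = (i, 1) → φ s((i, 0), (i, 1)) = some c := by
  have : ∀ k, ∃ f : ι → ι, ∀ i, ¬ Cov φ R c (i, k) →
      (avail φ R c).Adj (i, k) (f i, k) ∧ f (f i) = i := by
    intro k
    obtain ⟨μ, h1, h2⟩ := h k
    obtain ⟨f, hf⟩ := exists_side_fun h1 h2
    refine ⟨f, fun i hi => ?_⟩
    obtain ⟨h3, h4, _⟩ := hf i (some_mem_freeSide.2 hi) (Or.inr none_notMem_freeSide)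
    exact ⟨h3, h4⟩
  choose f hf using this
  obtain ⟨μ, h1, h2⟩ := exists_classMat hφ none f (by simp) fun k i hi _ =>
    ⟨(hf k i hi).1, (hf k i hi).2, by simp⟩
  exact ⟨μ, h1, fun i hi => (h2 i hi).resolve_right (by simp)⟩

theorem exists_classMat_even (hφ : Proper φ) {a b : Fin 2} (hab : a ≠ b)
    (ha : ∃ μ, IsMat (inside (side (avail φ R c) a) (insert none (freeSide φ R c a))) μ ∧
      ∀ v ∈ insert none (freeSide φ R c a), μ v ≠ v)
    (hb : ∀ x, (avail φ R c).Adj (x, 0) (x, 1) →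
      ∃ μ, IsMat (inside (side (avail φ R c) b) ((freeSide φ R c b).erase (some x))) μ ∧
        ∀ v ∈ (freeSide φ R c b).erase (some x), μ v ≠ v) :
    ∃ μ, IsClassMat φ R c μ ∧ ∃ x, (avail φ R c).Adj (x, 0) (x, 1) ∧
      ∀ i, μ (i, 0) = (i, 1) → φ s((i, 0), (i, 1)) = some c ∨ i = x := by
  obtain ⟨μa, h1, h2⟩ := ha
  obtain ⟨x, hx⟩ : ∃ x, μa none = some x := by
    rcases h : μa none with _ | x
    · exact absurd h (h2 none (by simp))
    · exact ⟨x, rfl⟩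
  have hxF : (avail φ R c).Adj (x, 0) (x, 1) := by
    have := ((h1 none).2 (by simp [hx])).1
    rwa [hx, side_none_some] at this
  obtain ⟨fa, hfa⟩ := exists_side_fun h1 h2
  obtain ⟨μb, h3, h4⟩ := hb x hxF
  obtain ⟨fb, hfb⟩ := exists_side_fun h3 h4
  obtain ⟨μ, h5, h6⟩ := exists_classMat hφ (some x) (fun k => if k = a then fa else fb)
    (fun i hi => by
      obtain rfl : x = i := by simpa using hi
      exact hxF) (by
      intro k i hi hxi
      rcases fin_two_cases hab k with rfl | rfl
      · simp only [if_true]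
        obtain ⟨h7, h8, h9, _⟩ := hfa i (by simp [some_mem_freeSide, hi])
          (Or.inl (by rw [hx]; exact hxi.symm))
        rw [hx] at h9
        exact ⟨h7, h8, (h9 (by simp)).symm⟩
      · simp only [hab.symm, if_false]
        obtain ⟨h7, h8, _, h9⟩ := hfb i
          (Finset.mem_erase.2 ⟨hxi.symm, some_mem_freeSide.2 hi⟩)
          (Or.inr fun h => none_notMem_freeSide (Finset.mem_of_mem_erase h))
        exact ⟨h7, h8, (Finset.ne_of_mem_erase h9).symm⟩)
  refine ⟨μ, h5, x, hxF, fun i hi => (h6 i hi).imp_right fun h => ?_⟩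
  simpa using h.symm

end

section

open scoped Classical

section Counting

variable {W : Type*} [Fintype W]

theorem degree_le_card_edges (Q : SimpleGraph W) (u : W) : Q.degree u ≤ Q.edgeFinset.card := by
  rw [← card_incidenceFinset_eq_degree]
  exact Finset.card_le_card (Q.incidenceFinset_subset u)

theorem degree_add_le_card_edges (Q : SimpleGraph W) {u v : W} (huv : u ≠ v) :
    Q.degree u + Q.degree v ≤ Q.edgeFinset.card + 1 := by
  rw [← card_incidenceFinset_eq_degree, ← card_incidenceFinset_eq_degree,
    ← Finset.card_union_add_card_inter]
  refine Nat.add_le_add (Finset.card_le_card (Finset.union_subset (Q.incidenceFinset_subset u)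
    (Q.incidenceFinset_subset v))) ?_
  rw [Finset.card_le_one]
  intro e he f hf
  simp only [Finset.mem_inter, mem_incidenceFinset, incidenceSet,
    Set.mem_ofPred_eq] at he hf
  rw [(Sym2.mem_and_mem_iff huv).1 ⟨he.1.2, he.2.2⟩, (Sym2.mem_and_mem_iff huv).1 ⟨hf.1.2, hf.2.2⟩]

theorem sum_degree_le (Q : SimpleGraph W) {u v : W} (huv : u ≠ v) (S : Finset W)
    (hS : ∀ q ∈ S, q ≠ u ∧ q ≠ v) :
    Q.degree u + Q.degree v + ∑ q ∈ S, Q.degree q ≤ 2 * Q.edgeFinset.card := by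
  rw [← sum_degrees_eq_twice_card_edges, ← Finset.sum_pair (f := fun q => Q.degree q) huv,
    ← Finset.sum_union]
  · exact Finset.sum_le_sum_of_subset (Finset.subset_univ _)
  · rw [Finset.disjoint_left]
    intro q hq hq'
    have := hS q hq'
    simp only [Finset.mem_insert, Finset.mem_singleton] at hq
    tauto

/-- Perfect matchings in dense graphs from which few edges have been removed. -/
theorem exists_perfect_mat_of_few {T Q : SimpleGraph W} {S : Finset W}
    (hT : ∀ u v, T.Adj u v → u ∈ S) {N σ ρ : ℕ} (hS : S.card = 2 * N)
    (hQ : Q.edgeFinset.card ≤ ρ) (hd : ∀ v ∈ S, N + σ ≤ T.degree v + Q.degree v)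
    (hρ : ρ ≤ σ + 1 ∧ 2 ≤ N ∨ ρ ≤ σ + 2 ∧ 1 ≤ σ ∧ 3 ≤ N) :
    ∃ μ, IsMat T μ ∧ ∀ v ∈ S, μ v ≠ v := by
  refine exists_perfect_mat hT ⟨N, by omega⟩ (fun v => N + σ - Q.degree v)
    (fun v hv => by have := hd v hv; omega) fun u hu v hv huv => ?_
  have h1 := degree_add_le_card_edges Q huv
  have h2 := degree_le_card_edges Q u
  have h3 := degree_le_card_edges Q v
  by_cases hbad : S.card ≤ (N + σ - Q.degree u) + (N + σ - Q.degree v) + 1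
  · exact Or.inl hbad
  right
  have key : ∀ u v, u ≠ v → Q.degree v ≤ 2 → Q.degree u + Q.degree v ≥ 2 * σ + 2 →
      Q.degree u + Q.degree v ≤ ρ + 1 → Q.degree u ≤ ρ →
      (S.filter fun q => q ≠ u ∧ q ≠ v ∧
        (N + σ - Q.degree q) + (N + σ - Q.degree v) + 2 ≤ S.card).card < N + σ - Q.degree u := by
    intro u v huv hv2 hge hle hur
    set B := S.filter fun q => q ≠ u ∧ q ≠ v ∧
        (N + σ - Q.degree q) + (N + σ - Q.degree v) + 2 ≤ S.card with hB
    have hsum := sum_degree_le Q huv B (by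
      intro q hq
      rw [hB, Finset.mem_filter] at hq
      exact ⟨hq.2.1, hq.2.2.1⟩)
    have hBd : ∀ q ∈ B, 2 * σ + 2 - Q.degree v ≤ Q.degree q := by
      intro q hq
      rw [hB, Finset.mem_filter] at hq
      have := hq.2.2.2
      omega
    have hcard := Finset.card_nsmul_le_sum B (fun q => Q.degree q) _ hBd
    rw [smul_eq_mul] at hcard
    have hB1 : B.card * 1 ≤ B.card * (2 * σ + 2 - Q.degree v) ∨ 2 * σ + 2 ≤ Q.degree v := by
      by_cases h : 2 * σ + 2 ≤ Q.degree v
      · exact Or.inr h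
      · left
        exact Nat.mul_le_mul_left _ (by omega)
    rcases hρ with ⟨h4, h5⟩ | ⟨h4, h5, h6⟩
    · have hσ : σ = 0 := by omega
      subst hσ
      have := degree_le_card_edges Q v
      interval_cases hdv : Q.degree v <;> omega
    · have hσ : σ = 1 := by omega
      subst hσ
      interval_cases hdv : Q.degree v <;> omega
  by_cases h4 : Q.degree v ≤ 2
  · left
    exact key u v huv h4 (by omega) (by omega) (by omega)
  · right
    have := key v u huv.symm (by omega) (by omega) (by omega) (by omega)
    simpa only [and_left_comm] using this

/-- Ore's condition, where one vertex only needs a neighbor. -/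
theorem exists_perfect_mat_of_ore {T : SimpleGraph W} {S : Finset W}
    (hT : ∀ u v, T.Adj u v → u ∈ S) (hS : Even S.card) (z : W)
    (hz : z ∈ S → 0 < T.degree z) (d : W → ℕ) (hd : ∀ v ∈ S, v ≠ z → d v ≤ T.degree v)
    (h : ∀ u ∈ S, ∀ v ∈ S, u ≠ v → u ≠ z → v ≠ z → S.card ≤ d u + d v + 1) :
    ∃ μ, IsMat T μ ∧ ∀ v ∈ S, μ v ≠ v := by
  have hzero : ∀ v ∈ S, v ≠ z → (S.filter fun q => q ≠ z ∧ q ≠ v ∧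
      (if q = z then 1 else d q) + (if v = z then 1 else d v) + 2 ≤ S.card).card = 0 := by
    intro v hv hvz
    rw [Finset.card_eq_zero, Finset.filter_eq_empty_iff]
    rintro q hq ⟨h1, h2, h3⟩
    rw [if_neg h1, if_neg hvz] at h3
    have := h q hq v hv h2 h1 hvz
    omega
  refine exists_perfect_mat hT hS (fun v => if v = z then 1 else d v) (fun v hv => ?_)
    fun u hu v hv huv => ?_
  · split_ifs with h1
    · exact h1 ▸ hz (h1 ▸ hv)
    · exact hd v hv h1
  · by_cases h1 : u = z
    · subst h1
      right; left
      rw [hzero v hv huv.symm]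
      simp
    · by_cases h2 : v = z
      · subst h2
        right; right
        have := hzero u hu h1
        simp only [and_left_comm] at this ⊢
        rw [this]
        simp
      · left
        simp only [if_neg h1, if_neg h2]
        exact h u hu v hv huv h1 h2

end Counting

variable {ι : Type*} [Fintype ι] {R : SimpleGraph (ι × Fin 2)}
  {φ : Sym2 (ι × Fin 2) → Option ℕ} {c : ℕ}

/-- The number of rungs in a graph on `ι × Fin 2`. -/
noncomputable def rungs (R : SimpleGraph (ι × Fin 2)) : ℕ :=
  (Finset.univ.filter fun i => R.Adj (i, 0) (i, 1)).card

theorem rungs_le_degree_side (R : SimpleGraph (ι × Fin 2)) (a : Fin 2) :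
    rungs R ≤ (side R a).degree none := by
  rw [← card_neighborFinset_eq_degree]
  refine Finset.card_le_card_of_injOn some (fun i hi => ?_) (Option.some_injective _).injOn
  simpa [side_none_some] using hi

theorem degree_le_degree_side (hR : R ≤ (⊤ : SimpleGraph ι) □ (⊤ : SimpleGraph (Fin 2)))
    (a : Fin 2) (i : ι) : R.degree (i, a) ≤ (side R a).degree (some i) := by
  rw [← card_neighborFinset_eq_degree, ← card_neighborFinset_eq_degree]
  have hR' : ∀ j k, R.Adj (i, a) (j, k) → k = a ∨ j = i := by
    intro j k h
    have := hR h
    simp only [boxProd_adj] at this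
    tauto
  refine Finset.card_le_card_of_injOn (fun w => if w.2 = a then some w.1 else none) ?_ ?_
  · rintro ⟨j, k⟩ h
    simp only [Finset.mem_coe, mem_neighborFinset] at h ⊢
    split_ifs with hk
    · subst hk
      exact side_some_some.2 h
    · obtain rfl := (hR' j k h).resolve_left hk
      rw [side_some_none]
      have : a = 0 ∧ k = 1 ∨ a = 1 ∧ k = 0 := by
        have : k ≠ a := hk
        omega
      rcases this with ⟨rfl, rfl⟩ | ⟨rfl, rfl⟩
      · exact h
      · exact h.symm
  · rintro ⟨j, k⟩ h ⟨j', k'⟩ h' he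
    simp only [Finset.mem_coe, mem_neighborFinset] at h h'
    dsimp only at he
    split_ifs at he with h1 h2 h2
    · rw [Option.some.injEq] at he
      rw [he, show k = a from h1, show k' = a from h2]
    · rw [(hR' j k h).resolve_left h1, (hR' j' k' h').resolve_left h2]
      have h1 : k ≠ a := h1
      have h2 : k' ≠ a := h2
      congr 1
      omega

theorem degree_side_le {a b : Fin 2} (hab : a ≠ b) {S : Finset (Option ι)}
    (hS : ∀ i, some i ∈ S → ¬ Cov φ R c (i, a)) {i : ι} (hi : some i ∈ S) :
    (side R a).degree (some i) ≤ (inside (side (avail φ R c) a) S).degree (some i) +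
      (inside (side (others φ R c) a) S).degree (some i) + Sᶜ.card +
      if none ∈ S ∧ Cov φ R c (i, b) then 1 else 0 := by
  have hsub : (side R a).neighborFinset (some i) ⊆
      ((inside (side (avail φ R c) a) S).neighborFinset (some i) ∪
        (inside (side (others φ R c) a) S).neighborFinset (some i) ∪ Sᶜ) ∪
      if none ∈ S ∧ Cov φ R c (i, b) then {none} else ∅ := by
    intro w hw
    rw [mem_neighborFinset] at hw
    simp only [Finset.mem_union, mem_neighborFinset, Finset.mem_compl]
    by_cases hwS : w ∈ S
    swap
    · exact Or.inl (Or.inr hwS)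
    rcases w with _ | j
    · rw [side_some_none] at hw
      by_cases hcov : Cov φ R c (i, b)
      · right
        simp [hwS, hcov]
      left; left
      have h01 : ∀ k, ¬ Cov φ R c (i, k) := fun k => by
        rcases fin_two_cases hab k with rfl | rfl
        · exact hS i hi
        · exact hcov
      rcases hd : φ s((i, 0), (i, 1)) with _ | d
      · left
        exact ⟨side_some_none.2 ⟨hw, hd, h01 0, h01 1⟩, hi, hwS⟩
      · right
        refine ⟨side_some_none.2 ⟨hw, by simp [hd], fun h => ?_⟩, hi, hwS⟩
        exact h01 0 ⟨_, hw, h⟩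
    · left; left
      rw [side_some_some] at hw
      rcases hd : φ s((i, a), (j, a)) with _ | d
      · left
        exact ⟨side_some_some.2 ⟨hw, hd, hS i hi, hS j hwS⟩, hi, hwS⟩
      · right
        refine ⟨side_some_some.2 ⟨hw, by simp [hd], fun h => ?_⟩, hi, hwS⟩
        exact hS i hi ⟨_, hw, h⟩
  rw [← card_neighborFinset_eq_degree, ← card_neighborFinset_eq_degree,
    ← card_neighborFinset_eq_degree]
  refine (Finset.card_le_card hsub).trans ((Finset.card_union_le _ _).trans ?_)
  refine Nat.add_le_add ((Finset.card_union_le _ _).trans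
    (Nat.add_le_add_right (Finset.card_union_le _ _) _)) ?_
  split_ifs <;> simp

theorem rungs_le {a b : Fin 2} (hab : a ≠ b) {S : Finset (Option ι)} (hn : none ∈ S)
    (hcov : ∀ i, Cov φ R c (i, b) → Cov φ R c (i, a))
    (hS : ∀ i, some i ∈ S → ¬ Cov φ R c (i, a)) :
    rungs R ≤ (inside (side (avail φ R c) a) S).degree none +
      (inside (side (others φ R c) a) S).degree none + Sᶜ.card := by
  refine (rungs_le_degree_side R a).trans ?_
  have hsub : (side R a).neighborFinset none ⊆
      (inside (side (avail φ R c) a) S).neighborFinset none ∪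
        (inside (side (others φ R c) a) S).neighborFinset none ∪ Sᶜ := by
    intro w hw
    rw [mem_neighborFinset] at hw
    simp only [Finset.mem_union, mem_neighborFinset, Finset.mem_compl]
    by_cases hwS : w ∈ S
    swap
    · exact Or.inr hwS
    left
    rcases w with _ | i
    · exact absurd rfl hw.ne
    rw [side_none_some] at hw
    have h01 : ∀ k, ¬ Cov φ R c (i, k) := fun k => by
      rcases fin_two_cases hab k with rfl | rfl
      · exact hS i hwS
      · exact fun h => hS i hwS (hcov i h)
    rcases hd : φ s((i, 0), (i, 1)) with _ | d
    · left
      exact ⟨side_none_some.2 ⟨hw, hd, h01 0, h01 1⟩, hn, hwS⟩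
    · right
      refine ⟨side_none_some.2 ⟨hw, by simp [hd], fun h => ?_⟩, hn, hwS⟩
      exact h01 0 ⟨_, hw, h⟩
  rw [← card_neighborFinset_eq_degree, ← card_neighborFinset_eq_degree,
    ← card_neighborFinset_eq_degree]
  exact (Finset.card_le_card hsub).trans ((Finset.card_union_le _ _).trans
    (Nat.add_le_add_right (Finset.card_union_le _ _) _))

/-- The edge of `F` corresponding to an edge of `side F k`. -/
def sideEdge (k : Fin 2) : Sym2 (Option ι) → Sym2 (ι × Fin 2) ⊕ Unit :=
  Sym2.lift ⟨fun u v => match u, v with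
    | some i, some j => Sum.inl s((i, k), (j, k))
    | some i, none => Sum.inl s((i, 0), (i, 1))
    | none, some i => Sum.inl s((i, 0), (i, 1))
    | none, none => Sum.inr (), by
      rintro (_ | i) (_ | j) <;> simp [Sym2.eq_swap]⟩

theorem sideEdge_inj {ι : Type*} {k : Fin 2} {p p' : Sym2 (Option ι)} (hp : ¬ p.IsDiag)
    (hp' : ¬ p'.IsDiag) (h : sideEdge k p = sideEdge k p') : p = p' := by
  induction p using Sym2.ind with
  | _ u v =>
  induction p' using Sym2.ind with
  | _ u' v' =>
  rcases u with _ | i <;> rcases v with _ | j <;> rcases u' with _ | i' <;>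
    rcases v' with _ | j' <;> simp [sideEdge] at h hp hp' ⊢ <;> grind

theorem card_edges_side_le (P : SimpleGraph (ι × Fin 2)) (k : Fin 2) (S : Finset (Option ι)) :
    (inside (side P k) S).edgeFinset.card ≤ P.edgeFinset.card := by
  rw [← Finset.card_map (Function.Embedding.inl : _ ↪ Sym2 (ι × Fin 2) ⊕ Unit)
    (s := P.edgeFinset)]
  refine Finset.card_le_card_of_injOn (sideEdge k) ?_ ?_
  · intro e he
    induction e using Sym2.ind with
    | _ u v =>
      simp only [Finset.mem_coe, mem_edgeFinset, mem_edgeSet] at he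
      rcases u with _ | i <;> rcases v with _ | j
      · exact absurd rfl he.1.ne
      · simpa [sideEdge] using side_none_some.1 he.1
      · simpa [sideEdge] using side_some_none.1 he.1
      · simpa [sideEdge] using side_some_some.1 he.1
  · intro e he e' he' h
    exact sideEdge_inj (not_isDiag_of_mem_edgeFinset he) (not_isDiag_of_mem_edgeFinset he') h

end

section

open scoped Classical

theorem inside_le {W : Type*} (F : SimpleGraph W) (S : Finset W) : inside F S ≤ F :=
  fun _ _ h => h.1

theorem not_adj_inside {W : Type*} {F : SimpleGraph W} {S : Finset W} (u v : W)
    (h : (inside F S).Adj u v) : u ∈ S := h.2.1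

variable {ι : Type*} {R : SimpleGraph (ι × Fin 2)}
  {φ : Sym2 (ι × Fin 2) → Option ℕ} {c : ℕ}

theorem cov_of_single {u v : ι × Fin 2} (huv : R.Adj u v) (hc : φ s(u, v) = some c)
    (h : ∀ x y, R.Adj x y → φ s(x, y) = some c → s(x, y) = s(u, v)) (w : ι × Fin 2) :
    Cov φ R c w ↔ w = u ∨ w = v := by
  constructor
  · rintro ⟨y, h1, h2⟩
    rcases Sym2.eq_iff.1 (h w y h1 h2) with ⟨h3, _⟩ | ⟨h3, _⟩
    · exact Or.inl h3
    · exact Or.inr h3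
  · rintro (rfl | rfl)
    · exact ⟨v, huv, hc⟩
    · exact ⟨u, huv.symm, by rw [Sym2.eq_swap]; exact hc⟩

variable [Fintype ι]

/-- The vertices of side `a` covered by the class of `c`. -/
noncomputable def coverSide (φ : Sym2 (ι × Fin 2) → Option ℕ) (R : SimpleGraph (ι × Fin 2))
    (c : ℕ) (a : Fin 2) : Finset ι :=
  Finset.univ.filter fun i => Cov φ R c (i, a)

theorem mem_coverSide {a : Fin 2} {i : ι} : i ∈ coverSide φ R c a ↔ Cov φ R c (i, a) := by
  simp [coverSide]

theorem card_freeSide (a : Fin 2) :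
    (freeSide φ R c a).card + (coverSide φ R c a).card = Fintype.card ι := by
  have : freeSide φ R c a = (coverSide φ R c a)ᶜ.map Function.Embedding.some := by
    ext w
    simp [freeSide, coverSide, and_comm, eq_comm]
  rw [this, Finset.card_map, add_comm]
  exact Finset.card_add_card_compl _

theorem card_insert_freeSide (a : Fin 2) :
    (insert none (freeSide φ R c a)).card = (freeSide φ R c a).card + 1 :=
  Finset.card_insert_of_notMem none_notMem_freeSide

theorem card_compl_option (S : Finset (Option ι)) : Sᶜ.card + S.card = Fintype.card ι + 1 := by
  rw [add_comm, Finset.card_add_card_compl, Fintype.card_option]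

theorem card_erase_freeSide {x : ι} (hx : (avail φ R c).Adj (x, 0) (x, 1)) (b : Fin 2) :
    ((freeSide φ R c b).erase (some x)).card + 1 = (freeSide φ R c b).card := by
  refine Finset.card_erase_add_one (some_mem_freeSide.2 ?_)
  rcases fin_two_cases zero_ne_one b with rfl | rfl
  · exact hx.2.2.1
  · exact hx.2.2.2

theorem rungs_le_rungs_peel {F : SimpleGraph (ι × Fin 2)} {μ : ι × Fin 2 → ι × Fin 2}
    (hμ : IsMat F μ) (x : ι) (hx : ∀ i, μ (i, 0) = (i, 1) → i = x) :
    rungs R ≤ rungs (peel R μ) + 1 := by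
  refine le_trans (Finset.card_le_card fun i hi => ?_) (Finset.card_insert_le x _)
  simp only [Finset.mem_filter, Finset.mem_univ, true_and, Finset.mem_insert,
    hμ.peel_adj] at hi ⊢
  by_cases h : μ (i, 0) = (i, 1)
  · exact Or.inl (hx i h)
  · exact Or.inr ⟨hi, h⟩

/-- A perfect matching containing a single precolored edge and avoiding few others. -/
theorem exists_classMat_single (hφ : Proper φ) {n r σ ρ : ℕ} (hι : Fintype.card ι + 1 = 2 * n)
    (hR : R ≤ (⊤ : SimpleGraph ι) □ (⊤ : SimpleGraph (Fin 2))) (hreg : ∀ v, R.degree v = r)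
    (hr : r = n + 1 + σ) (hrungs : r ≤ rungs R) {u v : ι × Fin 2} (huv : R.Adj u v)
    (hc : φ s(u, v) = some c)
    (hone : ∀ x y, R.Adj x y → φ s(x, y) = some c → s(x, y) = s(u, v))
    (hQ : ∀ k S, (none ∈ S → u.1 ≠ v.1) →
      (inside (side (others φ R c) k) S).edgeFinset.card ≤ ρ)
    (hρ : ρ ≤ σ + 1 ∧ 3 ≤ n ∨ ρ ≤ σ + 2 ∧ 1 ≤ σ ∧ 4 ≤ n) :
    ∃ μ, IsClassMat φ R c μ ∧ rungs R ≤ rungs (peel R μ) + 1 := by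
  have hρ' : ρ ≤ σ + 1 ∧ 2 ≤ n - 1 ∨ ρ ≤ σ + 2 ∧ 1 ≤ σ ∧ 3 ≤ n - 1 := by omega
  have hcov := cov_of_single huv hc hone
  have hside : ∀ k i, r ≤ (side R k).degree (some i) := fun k i =>
    (hreg (i, k)).symm.le.trans (degree_le_degree_side hR k i)
  obtain ⟨i, a⟩ := u
  obtain ⟨j, k⟩ := v
  by_cases hij : i = j
  · subst hij
    have hak : a ≠ k := fun h => huv.ne (by rw [h])
    have hcov' : ∀ l x, Cov φ R c (x, l) ↔ x = i := by
      intro l x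
      rw [hcov]
      rcases fin_two_cases hak l with rfl | rfl <;> simp [hak, hak.symm]
    have hcard : ∀ l, (coverSide φ R c l).card = 1 := fun l => by
      rw [Finset.card_eq_one]
      exact ⟨i, by ext x; rw [mem_coverSide, hcov', Finset.mem_singleton]⟩
    obtain ⟨μ, h1, h2⟩ := exists_classMat_odd (c := c) (R := R) hφ (by
      intro l
      have h1 := card_freeSide (φ := φ) (R := R) (c := c) l
      have h2 := card_compl_option (freeSide φ R c l)
      have h3 := hcard l
      refine exists_perfect_mat_of_few not_adj_inside (N := n - 1) (σ := σ) (ρ := ρ) (by omega)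
        (hQ l (freeSide φ R c l) fun h => absurd h none_notMem_freeSide) (fun v hv => ?_) hρ'
      rcases v with _ | x
      · exact absurd hv none_notMem_freeSide
      have h4 := degree_side_le (R := R) (φ := φ) (c := c) (b := 1 - l) (by omega)
        (S := freeSide φ R c l) (fun i hi => some_mem_freeSide.1 hi) hv
      rw [if_neg fun h => none_notMem_freeSide h.1] at h4
      have := hside l x
      omega)
    refine ⟨μ, h1, rungs_le_rungs_peel h1.isMat i fun x hx => ?_⟩
    by_cases hxR : R.Adj (x, 0) (x, 1)
    · exact (hcov' 0 x).1 ⟨_, hxR, h2 x hx⟩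
    · exact absurd (hx ▸ (h1.isMat _).2 (h1.ne _)) hxR
  · have hak : a = k := by
      have := hR huv
      simp only [boxProd_adj, hij] at this
      tauto
    subst hak
    have hb : a ≠ 1 - a := by omega
    have hnb : ∀ x, ¬ Cov φ R c (x, 1 - a) := fun x => by
      rw [hcov]
      simp [hb.symm]
    have hca : (coverSide φ R c a).card = 2 := by
      rw [Finset.card_eq_two]
      exact ⟨i, j, hij, by ext x; rw [mem_coverSide, hcov]; simp⟩
    have hcb : (coverSide φ R c (1 - a)).card = 0 := by
      rw [Finset.card_eq_zero, Finset.eq_empty_iff_forall_notMem]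
      intro x
      rw [mem_coverSide]
      exact hnb x
    have hSa : ∀ i, some i ∈ insert none (freeSide φ R c a) → ¬ Cov φ R c (i, a) := by
      intro i hi
      simpa [some_mem_freeSide] using hi
    obtain ⟨μ, h1, x, hx, h2⟩ := exists_classMat_even (c := c) (R := R) hφ hb (by
        have h1 := card_freeSide (φ := φ) (R := R) (c := c) a
        have h2 := card_compl_option (insert none (freeSide φ R c a))
        rw [card_insert_freeSide] at h2
        refine exists_perfect_mat_of_few not_adj_inside (N := n - 1) (σ := σ) (ρ := ρ)
          (by rw [card_insert_freeSide]; omega) (hQ a (insert none (freeSide φ R c a)) fun _ => hij)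
          (fun v hv => ?_) hρ'
        rcases v with _ | x
        · have h4 := rungs_le (R := R) (φ := φ) (c := c) hb hv (fun i h => absurd h (hnb i)) hSa
          omega
        · have h4 := degree_side_le (R := R) (φ := φ) (c := c) hb hSa hv
          rw [if_neg fun h => hnb x h.2] at h4
          have := hside a x
          omega) (by
        intro x hx
        have h1 := card_freeSide (φ := φ) (R := R) (c := c) (1 - a)
        have h2 := card_compl_option ((freeSide φ R c (1 - a)).erase (some x))
        have h3 := card_erase_freeSide hx (1 - a)
        have hnn : none ∉ (freeSide φ R c (1 - a)).erase (some x) := fun h =>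
          none_notMem_freeSide (Finset.mem_of_mem_erase h)
        refine exists_perfect_mat_of_few not_adj_inside (N := n - 1) (σ := σ) (ρ := ρ)
          (by omega) (hQ (1 - a) ((freeSide φ R c (1 - a)).erase (some x)) fun h => absurd h hnn)
          (fun v hv => ?_) hρ'
        rcases v with _ | y
        · exact absurd hv hnn
        have h4 := degree_side_le (R := R) (φ := φ) (c := c) hb.symm
          (S := (freeSide φ R c (1 - a)).erase (some x)) (fun i _ => hnb i) hv
        rw [if_neg fun h => hnn h.1] at h4
        have := hside (1 - a) y
        omega)
    refine ⟨μ, h1, rungs_le_rungs_peel h1.isMat x fun y hy => (h2 y hy).resolve_left fun h => ?_⟩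
    have hyR : R.Adj (y, 0) (y, 1) := hy ▸ (h1.isMat _).2 (h1.ne _)
    rcases fin_two_cases hb 0 with h0 | h0
    · exact hnb y (by rw [show 1 - a = 1 by omega]; exact ⟨_, hyR.symm, by rw [Sym2.eq_swap, h]⟩)
    · exact hnb y (by rw [← h0]; exact ⟨_, hyR, h⟩)

/-- A perfect matching containing a class with an odd number of rungs. -/
theorem exists_classMat_of_odd (hφ : Proper φ) {n r : ℕ} (hι : Fintype.card ι + 1 = 2 * n)
    (hR : R ≤ (⊤ : SimpleGraph ι) □ (⊤ : SimpleGraph (Fin 2))) (hreg : ∀ v, R.degree v = r)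
    (hodd : ∀ k, Odd (coverSide φ R c k).card)
    (hrem : ∀ k, ∀ i j, i ≠ j → ¬ Cov φ R c (i, k) → ¬ Cov φ R c (j, k) →
      (side (others φ R c) k).degree (some i) + (side (others φ R c) k).degree (some j) +
        (coverSide φ R c k).card + 2 * n ≤ 2 * r) :
    ∃ μ, IsClassMat φ R c μ ∧ ∀ i, μ (i, 0) = (i, 1) → φ s((i, 0), (i, 1)) = some c := by
  refine exists_classMat_odd hφ fun k => ?_
  have h1 := card_freeSide (φ := φ) (R := R) (c := c) k
  have h2 := card_compl_option (freeSide φ R c k)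
  have h3 := hodd k
  refine exists_perfect_mat_of_ore not_adj_inside (by grind) none
    (fun h => absurd h none_notMem_freeSide)
    (fun v => r - (side (others φ R c) k).degree v - (freeSide φ R c k)ᶜ.card) ?_ ?_
  · rintro (_ | i) hi hne
    · exact absurd rfl hne
    have h4 := degree_side_le (R := R) (φ := φ) (c := c) (b := 1 - k) (by omega)
      (S := freeSide φ R c k) (fun i hi => some_mem_freeSide.1 hi) hi
    rw [if_neg fun h => none_notMem_freeSide h.1] at h4
    have h5 := degree_le_degree_side hR k i
    have h6 := degree_le_of_le (inside_le (side (others φ R c) k) (freeSide φ R c k)) (v := some i)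
    rw [hreg] at h5
    omega
  · rintro (_ | i) hi (_ | j) hj hij hin hjn
    · exact absurd rfl hin
    · exact absurd rfl hin
    · exact absurd rfl hjn
    have := hrem k i j (by simpa using hij) (some_mem_freeSide.1 hi) (some_mem_freeSide.1 hj)
    omega

/-- A perfect matching containing a class with an even number of rungs. -/
theorem exists_classMat_of_even (hφ : Proper φ) {n r δ : ℕ} (hι : Fintype.card ι + 1 = 2 * n)
    (hR : R ≤ (⊤ : SimpleGraph ι) □ (⊤ : SimpleGraph (Fin 2))) (hreg : ∀ v, R.degree v = r)
    {a b : Fin 2} (hab : a ≠ b) (heven : ∀ k, Even (coverSide φ R c k).card)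
    (hav : ∃ x, (avail φ R c).Adj (x, 0) (x, 1))
    (hδ : ∀ i, Cov φ R c (i, b) → ¬ Cov φ R c (i, a) → 1 ≤ δ)
    (hrema : ∀ i j, i ≠ j → ¬ Cov φ R c (i, a) → ¬ Cov φ R c (j, a) →
      (side (others φ R c) a).degree (some i) + (side (others φ R c) a).degree (some j) +
        (coverSide φ R c a).card + 2 * δ + 2 * n ≤ 2 * r + 1)
    (hremb : ∀ i j, i ≠ j → ¬ Cov φ R c (i, b) → ¬ Cov φ R c (j, b) →
      (side (others φ R c) b).degree (some i) + (side (others φ R c) b).degree (some j) +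
        (coverSide φ R c b).card + 1 + 2 * n ≤ 2 * r) :
    ∃ μ, IsClassMat φ R c μ ∧ ∃ x, (avail φ R c).Adj (x, 0) (x, 1) ∧
      ∀ i, μ (i, 0) = (i, 1) → φ s((i, 0), (i, 1)) = some c ∨ i = x := by
  refine exists_classMat_even hφ hab ?_ fun x hx => ?_
  · have h1 := card_freeSide (φ := φ) (R := R) (c := c) a
    have h2 := card_compl_option (insert none (freeSide φ R c a))
    have h3 := heven a
    rw [card_insert_freeSide] at h2
    have hS : ∀ i, some i ∈ insert none (freeSide φ R c a) → ¬ Cov φ R c (i, a) := by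
      intro i hi
      simpa [some_mem_freeSide] using hi
    refine exists_perfect_mat_of_ore not_adj_inside (by rw [card_insert_freeSide]; grind) none
      (fun _ => ?_) (fun v => r - (side (others φ R c) a).degree v -
        (insert none (freeSide φ R c a))ᶜ.card - δ) ?_ ?_
    · obtain ⟨x, hx⟩ := hav
      rw [degree_pos_iff_exists_adj]
      refine ⟨some x, side_none_some.2 hx, by simp, ?_⟩
      rw [Finset.mem_insert, some_mem_freeSide]
      right
      rcases fin_two_cases zero_ne_one a with rfl | rfl
      · exact hx.2.2.1
      · exact hx.2.2.2
    · rintro (_ | i) hi hne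
      · exact absurd rfl hne
      have h4 := degree_side_le (R := R) (φ := φ) (c := c) hab hS hi
      have h5 := degree_le_degree_side hR a i
      have h6 := degree_le_of_le (inside_le (side (others φ R c) a)
        (insert none (freeSide φ R c a))) (v := some i)
      rw [hreg] at h5
      split_ifs at h4 with h7
      · have := hδ i h7.2 (hS i hi)
        omega
      · omega
    · rintro (_ | i) hi (_ | j) hj hij hin hjn
      · exact absurd rfl hin
      · exact absurd rfl hin
      · exact absurd rfl hjn
      have := hrema i j (by simpa using hij) (hS i hi) (hS j hj)
      rw [card_insert_freeSide]
      omega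
  · have h1 := card_freeSide (φ := φ) (R := R) (c := c) b
    have h2 := card_compl_option ((freeSide φ R c b).erase (some x))
    have h3 := heven b
    have h4 := card_erase_freeSide hx b
    have hnn : none ∉ (freeSide φ R c b).erase (some x) := fun h =>
      none_notMem_freeSide (Finset.mem_of_mem_erase h)
    have hS : ∀ i, some i ∈ (freeSide φ R c b).erase (some x) → ¬ Cov φ R c (i, b) :=
      fun i hi => some_mem_freeSide.1 (Finset.mem_of_mem_erase hi)
    refine exists_perfect_mat_of_ore not_adj_inside (by grind) none
      (fun h => absurd h hnn)
          (fun v => r - (side (others φ R c) b).degree v -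
        ((freeSide φ R c b).erase (some x))ᶜ.card) ?_ ?_
    · rintro (_ | i) hi hne
      · exact absurd rfl hne
      have h4 := degree_side_le (R := R) (φ := φ) (c := c) hab.symm hS hi
      rw [if_neg fun h => hnn h.1] at h4
      have h5 := degree_le_degree_side hR b i
      have h6 := degree_le_of_le (inside_le (side (others φ R c) b)
        ((freeSide φ R c b).erase (some x))) (v := some i)
      rw [hreg] at h5
      omega
    · rintro (_ | i) hi (_ | j) hj hij hin hjn
      · exact absurd rfl hin
      · exact absurd rfl hin
      · exact absurd rfl hjn
      have := hremb i j (by simpa using hij) (hS i hi) (hS j hj)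
      omega

end

section

open scoped Classical

/-- In a graph whose edges are independent, the number of non-isolated vertices is twice the
number of edges. -/
theorem card_covered_eq {W : Type*} [Fintype W] (P : SimpleGraph W)
    (hP : ∀ u v w, P.Adj u v → P.Adj u w → v = w) :
    (Finset.univ.filter fun v => ∃ w, P.Adj v w).card = 2 * P.edgeFinset.card := by
  rw [← sum_degrees_eq_twice_card_edges, Finset.card_filter]
  refine Finset.sum_congr rfl fun v _ => ?_
  split_ifs with h
  · obtain ⟨w, hw⟩ := h
    rw [← card_neighborFinset_eq_degree, eq_comm, Finset.card_eq_one]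
    refine ⟨w, ?_⟩
    ext x
    rw [mem_neighborFinset, Finset.mem_singleton]
    exact ⟨fun hx => hP v x w hx hw, fun hx => hx ▸ hw⟩
  · rw [eq_comm, ← not_ne_iff, ← Nat.pos_iff_ne_zero, degree_pos_iff_exists_adj]
    exact h

theorem IsClassMat.ext {V : Type*} {φ : Sym2 V → Option ℕ} {R : SimpleGraph V}
    {c : ℕ} {Γ : Finset ℕ} {μ : V → V} (hμ : IsClassMat φ R c μ) (hc : c ∈ Γ)
    (h : Ext φ (PartialEdgeColoring.peel R μ) (Γ.erase c)) :
    Ext φ R Γ :=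
  Ext.of_peel hc hμ.isMat (fun v d _ => hμ.color v d) h

variable {ι : Type*} [Fintype ι] {R : SimpleGraph (ι × Fin 2)}
  {φ : Sym2 (ι × Fin 2) → Option ℕ} {c : ℕ} {n r : ℕ} {Γ : Finset ℕ}

/-- The number of edges precolored with `c`. -/
noncomputable def size (φ : Sym2 (ι × Fin 2) → Option ℕ) (c : ℕ) : ℕ :=
  (Finset.univ.filter fun e => φ e = some c).card

/-- The number of rungs precolored with `c`. -/
noncomputable def rungSize (φ : Sym2 (ι × Fin 2) → Option ℕ) (c : ℕ) : ℕ :=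
  (Finset.univ.filter fun i => φ s((i, 0), (i, 1)) = some c).card

/-- The number of rungs of `R` that are not precolored. -/
noncomputable def freeRungs (φ : Sym2 (ι × Fin 2) → Option ℕ) (R : SimpleGraph (ι × Fin 2)) : ℕ :=
  (Finset.univ.filter fun i => R.Adj (i, 0) (i, 1) ∧ φ s((i, 0), (i, 1)) = none).card

/-- The graph `R` remains after the colors outside `Γ` have been given to perfect matchings. -/
structure IsState (φ : Sym2 (ι × Fin 2) → Option ℕ) (R : SimpleGraph (ι × Fin 2)) (Γ : Finset ℕ)
    (n r : ℕ) : Prop where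
  proper : Proper φ
  card_side : Fintype.card ι + 1 = 2 * n
  le : R ≤ (⊤ : SimpleGraph ι) □ (⊤ : SimpleGraph (Fin 2))
  reg : ∀ v, R.degree v = r
  card : Γ.card = r + 1
  mem : ∀ u v c, φ s(u, v) = some c → (c ∈ Γ ↔ R.Adj u v)

theorem IsState.peel (h : IsState φ R Γ n r) (hc : c ∈ Γ) {μ : ι × Fin 2 → ι × Fin 2}
    (hμ : IsClassMat φ R c μ) : IsState φ (peel R μ) (Γ.erase c) n (r - 1) := by
  have hr : 0 < r := by
    have hι := h.card_side
    obtain ⟨i⟩ : Nonempty ι := Fintype.card_pos_iff.1 (by omega)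
    rw [← h.reg (i, 0), degree_pos_iff_exists_adj]
    exact ⟨_, (hμ.isMat _).2 (hμ.ne _)⟩
  refine ⟨h.proper, h.card_side, (peel_le _ _).trans h.le, fun v => ?_, ?_, fun u v d hd => ?_⟩
  · rw [hμ.isMat.degree_peel, if_neg (hμ.ne v), h.reg]
  · rw [Finset.card_erase_of_mem hc, h.card]
    omega
  · rw [Finset.mem_erase, h.mem u v d hd, hμ.isMat.peel_adj]
    constructor
    · rintro ⟨h1, h2⟩
      refine ⟨h2, fun h3 => h1 (hμ.color u d (by rw [h3]; exact hd))⟩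
    · rintro ⟨h1, h2⟩
      refine ⟨fun h3 => h2 (hμ.eq_of_mem u v h1 (h3 ▸ hd)), h1⟩

theorem IsState.cov_iff (h : IsState φ R Γ n r) (hc : c ∈ Γ) (u : ι × Fin 2) :
    Cov φ R c u ↔ ∃ v, φ s(u, v) = some c :=
  ⟨fun ⟨v, h1⟩ => ⟨v, h1.2⟩, fun ⟨v, hv⟩ => ⟨v, (h.mem u v c hv).1 hc, hv⟩⟩

/-- The numbers of vertices covered by a class, in terms of its horizontal edges. -/
theorem IsState.exists_card_coverSide (h : IsState φ R Γ n r) (hc : c ∈ Γ) :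
    ∃ m : Fin 2 → ℕ, (∀ k, (coverSide φ R c k).card = rungSize φ c + 2 * m k ∧
      (m k = 0 → ∀ i, Cov φ R c (i, k) → φ s((i, 0), (i, 1)) = some c)) ∧
      size φ c = rungSize φ c + m 0 + m 1 := by
  have hadj : ∀ u v, φ s(u, v) = some c → R.Adj u v := fun u v h1 => (h.mem u v c h1).1 hc
  obtain ⟨Y, hY⟩ : ∃ Y : Fin 2 → SimpleGraph ι, ∀ k i j,
      (Y k).Adj i j ↔ φ s((i, k), (j, k)) = some c :=
    ⟨fun k => { Adj := fun i j => φ s((i, k), (j, k)) = some c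
                symm := ⟨fun i j h => by rw [Sym2.eq_swap]; exact h⟩
                loopless := ⟨fun i h => (hadj _ _ h).ne rfl⟩ }, fun _ _ _ => Iff.rfl⟩
  have hcov : ∀ k i, Cov φ R c (i, k) ↔ φ s((i, 0), (i, 1)) = some c ∨ ∃ j, (Y k).Adj i j := by
    intro k i
    rw [h.cov_iff hc]
    constructor
    · rintro ⟨⟨j, l⟩, hj⟩
      have h1 := h.le (hadj _ _ hj)
      simp only [boxProd_adj, top_adj] at h1
      rcases h1 with ⟨_, rfl⟩ | ⟨h1, rfl⟩
      · exact Or.inr ⟨j, (hY _ _ _).2 hj⟩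
      · left
        rcases fin_two_cases h1 0 with rfl | rfl
        · rwa [show l = 1 by omega] at hj
        · rw [show k = 1 by omega, Sym2.eq_swap] at hj
          exact hj
    · rintro (h1 | ⟨j, hj⟩)
      · rcases fin_two_cases zero_ne_one k with rfl | rfl
        · exact ⟨_, h1⟩
        · exact ⟨_, by rw [Sym2.eq_swap]; exact h1⟩
      · exact ⟨_, (hY _ _ _).1 hj⟩
  have hside : ∀ k, (coverSide φ R c k).card = rungSize φ c + 2 * (Y k).edgeFinset.card := by
    intro k
    rw [← card_covered_eq (Y k) fun u v w h1 h2 =>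
      (Prod.ext_iff.1 (h.proper _ _ _ _ ((hY _ _ _).1 h1) ((hY _ _ _).1 h2))).1,
      rungSize, ← Finset.card_union_of_disjoint]
    · congr 1
      ext i
      simp [mem_coverSide, hcov]
    · rw [Finset.disjoint_left]
      intro i h1 h2
      simp only [Finset.mem_filter, Finset.mem_univ, true_and] at h1 h2
      obtain ⟨j, h2⟩ := h2
      rw [hY] at h2
      rcases fin_two_cases zero_ne_one k with rfl | rfl
      · have := h.proper _ _ _ _ h1 h2
        simp at this
      · rw [Sym2.eq_swap] at h1
        have := h.proper _ _ _ _ h1 h2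
        simp at this
  refine ⟨fun k => (Y k).edgeFinset.card, fun k => ⟨hside k, fun h0 i hi => ?_⟩, ?_⟩
  · refine ((hcov k i).1 hi).resolve_right ?_
    rintro ⟨j, hj⟩
    rw [Finset.card_eq_zero] at h0
    have : s(i, j) ∈ (Y k).edgeFinset := by rwa [mem_edgeFinset, mem_edgeSet]
    rw [h0] at this
    simp at this
  · obtain ⟨P, hP⟩ : ∃ P : SimpleGraph (ι × Fin 2), ∀ u v, P.Adj u v ↔ φ s(u, v) = some c :=
      ⟨{ Adj := fun u v => φ s(u, v) = some c
         symm := ⟨fun i j h => by rw [Sym2.eq_swap]; exact h⟩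
         loopless := ⟨fun i h => (hadj _ _ h).ne rfl⟩ }, fun _ _ => Iff.rfl⟩
    have h1 := card_covered_eq P fun u v w h1 h2 =>
      h.proper _ _ _ _ ((hP _ _).1 h1) ((hP _ _).1 h2)
    have h2 : P.edgeFinset = Finset.univ.filter fun e => φ e = some c := by
      ext e
      induction e using Sym2.ind with
      | _ u v => simp [hP]
    have h3 : (Finset.univ.filter fun v => ∃ w, P.Adj v w).card =
        (coverSide φ R c 0).card + (coverSide φ R c 1).card := by
      rw [← Finset.card_map (Function.Embedding.sectL ι (0 : Fin 2)),
        ← Finset.card_map (s := coverSide φ R c 1) (Function.Embedding.sectL ι (1 : Fin 2)),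
        ← Finset.card_union_of_disjoint]
      · congr 1
        ext ⟨i, k⟩
        have : (∃ w, P.Adj (i, k) w) ↔ Cov φ R c (i, k) := by
          simp only [hP, h.cov_iff hc]
        rw [Finset.mem_filter, this]
        rcases fin_two_cases zero_ne_one k with rfl | rfl <;> simp [mem_coverSide]
      · simp [Finset.disjoint_left]
    rw [h2, h3, hside, hside] at h1
    change _ = 2 * size φ c at h1
    dsimp only
    omega

theorem IsState.exists_avail (h : IsState φ R Γ n r) (hc : c ∈ Γ)
    (hfree : 2 * size φ c < freeRungs φ R + 2 * rungSize φ c) :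
    ∃ x, (avail φ R c).Adj (x, 0) (x, 1) := by
  obtain ⟨m, hm, hs⟩ := h.exists_card_coverSide hc
  by_contra hno
  push Not at hno
  have hsub : ((Finset.univ.filter fun i => R.Adj (i, 0) (i, 1) ∧ φ s((i, 0), (i, 1)) = none) ∪
      (Finset.univ.filter fun i => φ s((i, 0), (i, 1)) = some c)) ⊆
      coverSide φ R c 0 ∪ coverSide φ R c 1 := by
    intro i hi
    simp only [Finset.mem_union, Finset.mem_filter, Finset.mem_univ, true_and,
      mem_coverSide] at hi ⊢
    rcases hi with hi | hi
    · by_contra hcov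
      push Not at hcov
      exact hno i ⟨hi.1, hi.2, hcov⟩
    · exact Or.inl ((h.cov_iff hc _).2 ⟨_, hi⟩)
  have h1 := Finset.card_le_card hsub
  rw [Finset.card_union_of_disjoint] at h1
  · have hinter : rungSize φ c ≤ (coverSide φ R c 0 ∩ coverSide φ R c 1).card := by
      refine Finset.card_le_card fun i hi => ?_
      simp only [Finset.mem_filter, Finset.mem_univ, true_and] at hi
      rw [Finset.mem_inter, mem_coverSide, mem_coverSide, h.cov_iff hc, h.cov_iff hc]
      exact ⟨⟨_, hi⟩, ⟨_, by rw [Sym2.eq_swap]; exact hi⟩⟩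
    have h2 := Finset.card_union_add_card_inter (coverSide φ R c 0) (coverSide φ R c 1)
    have h3 := (hm 0).1
    have h4 := (hm 1).1
    change freeRungs φ R + rungSize φ c ≤ _ at h1
    omega
  · rw [Finset.disjoint_left]
    intro i h1 h2
    simp only [Finset.mem_filter, Finset.mem_univ, true_and] at h1 h2
    rw [h2] at h1
    simp at h1

theorem freeRungs_le_peel {F : SimpleGraph (ι × Fin 2)} {μ : ι × Fin 2 → ι × Fin 2}
    (hμ : IsMat F μ) (x : Option ι)
    (hx : ∀ i, μ (i, 0) = (i, 1) → φ s((i, 0), (i, 1)) = some c ∨ x = some i) :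
    freeRungs φ R ≤ freeRungs φ (peel R μ) + 1 := by
  have : ∀ i, R.Adj (i, 0) (i, 1) → φ s((i, 0), (i, 1)) = none →
      (peel R μ).Adj (i, 0) (i, 1) ∨ x = some i := by
    intro i h1 h2
    rw [hμ.peel_adj]
    by_cases h : μ (i, 0) = (i, 1)
    · refine Or.inr ((hx i h).resolve_left ?_)
      simp [h2]
    · exact Or.inl ⟨h1, h⟩
  unfold freeRungs
  rcases x with _ | x
  · refine (Finset.card_le_card fun i hi => ?_).trans (Nat.le_succ _)
    simp only [Finset.mem_filter, Finset.mem_univ, true_and] at hi ⊢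
    exact ⟨(this i hi.1 hi.2).resolve_right (by simp), hi.2⟩
  · refine le_trans (Finset.card_le_card fun i hi => ?_) (Finset.card_insert_le x _)
    simp only [Finset.mem_filter, Finset.mem_univ, true_and, Finset.mem_insert] at hi ⊢
    rcases this i hi.1 hi.2 with h | h
    · exact Or.inr ⟨h, hi.2⟩
    · exact Or.inl (by simpa using h.symm)

/-- The class of `c` extends to a perfect matching if few other precolored edges surround any two
vertices of the same side. -/
theorem IsState.exists_classMat_of_degree (h : IsState φ R Γ n r) (hc : c ∈ Γ)
    (hpos : 1 ≤ size φ c) {D : ℕ}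
    (hD : ∀ k i j, i ≠ j → ¬ Cov φ R c (i, k) → ¬ Cov φ R c (j, k) →
      (side (others φ R c) k).degree (some i) + (side (others φ R c) k).degree (some j) ≤ D)
    (hr : D + 2 * size φ c + 2 * n ≤ 2 * r + 1)
    (hav : Odd (rungSize φ c) ∨ 2 * size φ c < freeRungs φ R + 2 * rungSize φ c) :
    ∃ μ, IsClassMat φ R c μ ∧ freeRungs φ R ≤ freeRungs φ (PartialEdgeColoring.peel R μ) + 1 := by
  obtain ⟨m, hm, hs⟩ := h.exists_card_coverSide hc
  have hm0 := (hm 0).1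
  have hm1 := (hm 1).1
  rcases Nat.even_or_odd (rungSize φ c) with he | ho
  · have hav := h.exists_avail hc (hav.resolve_left (by simpa using he))
    have key : ∀ a b : Fin 2, a ≠ b → 2 ≤ (coverSide φ R c a).card →
        size φ c = rungSize φ c + m a + m b →
        ∃ μ, IsClassMat φ R c μ ∧
          freeRungs φ R ≤ freeRungs φ (PartialEdgeColoring.peel R μ) + 1 := by
      intro a b hab ha hsab
      have hma := (hm a).1
      have hmb := (hm b).1
      obtain ⟨μ, h1, x, -, h2⟩ := exists_classMat_of_even (δ := if m b = 0 then 0 else 1)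
        h.proper h.card_side h.le h.reg hab (fun k => by rw [(hm k).1]; grind) hav
        (fun i h1 h2 => by
          split_ifs with h0
          · exact absurd ((h.cov_iff hc _).2 (by
              have := (hm b).2 h0 i h1
              rcases fin_two_cases zero_ne_one a with rfl | rfl
              · exact ⟨_, this⟩
              · exact ⟨_, by rw [Sym2.eq_swap]; exact this⟩)) h2
          · exact le_rfl)
        (fun i j hij h1 h2 => by
          have := hD a i j hij h1 h2
          split_ifs <;> omega)
        (fun i j hij h1 h2 => by
          have := hD b i j hij h1 h2
          omega)
      exact ⟨μ, h1, freeRungs_le_peel h1.isMat (some x) fun i hi =>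
        (h2 i hi).imp_right fun h => by rw [h]⟩
    by_cases h2 : 2 ≤ (coverSide φ R c 0).card
    · exact key 0 1 (by simp) h2 hs
    · exact key 1 0 (by simp) (by grind) (by omega)
  · obtain ⟨μ, h1, h2⟩ := exists_classMat_of_odd h.proper h.card_side h.le h.reg
      (fun k => by rw [(hm k).1]; grind) (fun k i j hij h1 h2 => by
        have := hD k i j hij h1 h2
        have hmk := (hm k).1
        have : 1 ≤ rungSize φ c := ho.pos
        rcases fin_two_cases zero_ne_one k with rfl | rfl <;> omega)
    exact ⟨μ, h1, freeRungs_le_peel h1.isMat none fun i hi => Or.inl (h2 i hi)⟩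

theorem IsState.card_others_le (h : IsState φ R Γ n r) :
    (others φ R c).edgeFinset.card ≤ ∑ d ∈ Γ.erase c, size φ d := by
  refine le_trans (Finset.card_le_card (t := (Γ.erase c).biUnion fun d =>
    Finset.univ.filter fun e => φ e = some d) fun e he => ?_) Finset.card_biUnion_le
  induction e using Sym2.ind with
  | _ u v =>
    rw [mem_edgeFinset, mem_edgeSet] at he
    obtain ⟨d, hd⟩ := Option.ne_none_iff_exists'.1 he.2.1
    simp only [Finset.mem_biUnion, Finset.mem_filter, Finset.mem_univ, true_and, Finset.mem_erase]
    refine ⟨d, ⟨?_, (h.mem u v d hd).2 he.1⟩, hd⟩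
    rintro rfl
    exact he.2.2 hd

theorem inside_univ {W : Type*} [Fintype W] (F : SimpleGraph W) : inside F Finset.univ = F := by
  ext u v
  simp [inside]

theorem IsState.exists_classMat_of_size (h : IsState φ R Γ n r) (hc : c ∈ Γ)
    (hpos : 1 ≤ size φ c)
    (hr : ∑ d ∈ Γ, size φ d + size φ c + 2 * n ≤ 2 * r)
    (hav : Odd (rungSize φ c) ∨ 2 * size φ c < freeRungs φ R + 2 * rungSize φ c) :
    ∃ μ, IsClassMat φ R c μ ∧ freeRungs φ R ≤ freeRungs φ (PartialEdgeColoring.peel R μ) + 1 := by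
  have h0 := Finset.sum_erase_add Γ (size φ) hc
  refine h.exists_classMat_of_degree hc hpos (D := ∑ d ∈ Γ.erase c, size φ d + 1)
    (fun k i j hij _ _ => ?_) (by omega) hav
  have h1 := degree_add_le_card_edges (side (others φ R c) k) (u := some i) (v := some j)
    (by simpa using hij)
  have h2 := card_edges_side_le (others φ R c) k Finset.univ
  rw [inside_univ] at h2
  have h3 := h.card_others_le (c := c)
  omega

end

section

open scoped Classical

variable {ι : Type*} [Fintype ι] {R : SimpleGraph (ι × Fin 2)}
  {φ : Sym2 (ι × Fin 2) → Option ℕ} {c : ℕ} {n r : ℕ} {Γ : Finset ℕ}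

theorem degree_side_le_degree (F : SimpleGraph (ι × Fin 2)) (k : Fin 2) (i : ι) :
    (side F k).degree (some i) ≤ F.degree (i, k) := by
  rw [← card_neighborFinset_eq_degree, ← card_neighborFinset_eq_degree]
  refine le_trans (Finset.card_le_card (t := (F.neighborFinset (i, k)).image fun w =>
    if w.2 = k then some w.1 else none) fun w hw => ?_) Finset.card_image_le
  rw [mem_neighborFinset] at hw
  simp only [Finset.mem_image, mem_neighborFinset]
  rcases w with _ | j
  · exact ⟨_, adj_flip (side_some_none.1 hw) k, if_neg (by dsimp only; omega)⟩
  · exact ⟨_, side_some_some.1 hw, if_pos rfl⟩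

theorem IsState.ext_of_star (h : IsState φ R Γ n r) (hc : c ∈ Γ) (w : ι × Fin 2)
    (hstar : ∀ u v d, R.Adj u v → φ s(u, v) = some d → d ≠ c → u = w ∨ v = w) : Ext φ R Γ :=
  Ext.of_star h.proper h.reg h.card (fun u v d h1 h2 => (h.mem u v d h2).2 h1) hc w hstar

theorem size_pos {u v : ι × Fin 2} {d : ℕ}
    (hd : φ s(u, v) = some d) : 1 ≤ size φ d :=
  Finset.card_pos.2 ⟨s(u, v), by simpa using hd⟩

theorem IsState.nonempty (h : IsState φ R Γ n r) : Nonempty ι :=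
  Fintype.card_pos_iff.1 (by have := h.card_side; omega)

theorem IsState.ext_of_le_one (h : IsState φ R Γ n r) (hc : c ∈ Γ)
    (hs : ∑ d ∈ Γ.erase c, size φ d ≤ 1) : Ext φ R Γ := by
  have h1 : (others φ R c).edgeFinset.card ≤ 1 := h.card_others_le.trans hs
  rw [Finset.card_le_one] at h1
  by_cases hex : ∃ u v, (others φ R c).Adj u v
  · obtain ⟨u, v, huv⟩ := hex
    refine h.ext_of_star hc u fun x y d hxy hd hdc => ?_
    have h2 := h1 s(x, y) (by
      rw [mem_edgeFinset, mem_edgeSet]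
      exact ⟨hxy, by simp [hd], by simpa [hd] using hdc⟩) s(u, v) (by
      rwa [mem_edgeFinset, mem_edgeSet])
    rcases Sym2.eq_iff.1 h2 with h3 | h3
    · exact Or.inl h3.1
    · exact Or.inr h3.2
  · push Not at hex
    obtain ⟨i⟩ := h.nonempty
    exact h.ext_of_star hc (i, 0) fun x y d hxy hd hdc =>
      absurd ⟨hxy, by simp [hd], by simpa [hd] using hdc⟩ (hex x y)

theorem IsState.degree_others_le (h : IsState φ R Γ n r) (S : Finset ℕ) (u : ι × Fin 2)
    (hS : ∀ v d, R.Adj u v → φ s(u, v) = some d → d ≠ c → d ∈ S) :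
    (others φ R c).degree u ≤ S.card := by
  rw [← card_neighborFinset_eq_degree, ← Finset.card_map Function.Embedding.some (s := S)]
  refine Finset.card_le_card_of_injOn (fun v => φ s(u, v)) (fun v hv => ?_) fun v hv w hw hvw => ?_
  · rw [Finset.mem_coe, mem_neighborFinset] at hv
    obtain ⟨d, hd⟩ := Option.ne_none_iff_exists'.1 hv.2.1
    have := hv.2.2
    simp only [hd, Finset.mem_coe]
    exact Finset.mem_map_of_mem _ (hS v d hv.1 hd fun h => this (by rw [hd, h]))
  · rw [Finset.mem_coe, mem_neighborFinset] at hv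
    obtain ⟨d, hd⟩ := Option.ne_none_iff_exists'.1 hv.2.1
    dsimp only at hvw
    exact h.proper _ _ _ _ hd (hvw ▸ hd)

theorem IsState.exists_classMat_of_two (h : IsState φ R Γ n r) (hc : c ∈ Γ)
    (hpos : 1 ≤ size φ c) {e : ℕ} (he : ∀ d ∈ Γ, d ≠ c → d ≠ e → size φ d = 0)
    (hr : 2 * size φ c + 2 * n + 1 ≤ 2 * r)
    (hav : Odd (rungSize φ c) ∨ 2 * size φ c < freeRungs φ R + 2 * rungSize φ c) :
    ∃ μ, IsClassMat φ R c μ ∧ freeRungs φ R ≤ freeRungs φ (PartialEdgeColoring.peel R μ) + 1 := by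
  refine h.exists_classMat_of_degree hc hpos (D := 2) (fun k i j _ _ _ => ?_) (by omega) hav
  have : ∀ i, (side (others φ R c) k).degree (some i) ≤ 1 := fun i =>
    (degree_side_le_degree _ k i).trans (h.degree_others_le {e} (i, k) fun v d h1 h2 h3 => by
      rw [Finset.mem_singleton]
      by_contra h4
      have := he d ((h.mem _ _ _ h2).2 h1) h3 h4
      have := size_pos h2
      omega)
  have h1 := this i
  have h2 := this j
  omega

theorem IsState.rungSize_le (h : IsState φ R Γ n r) (hc : c ∈ Γ) : rungSize φ c ≤ size φ c := by
  obtain ⟨m, -, h1⟩ := h.exists_card_coverSide hc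
  omega

/-- The case where some other class also has at least two edges, for large `n`. -/
theorem IsState.ext_of_large (hn : 5 ≤ n) {E T : ℕ} (hE2 : 2 ≤ size φ E) {i : ℕ} :
    ∀ {R : SimpleGraph (ι × Fin 2)} {Γ : Finset ℕ} {r : ℕ}, IsState φ R Γ n r → E ∈ Γ →
    (∀ Y ∈ Γ, Y ≠ E →
      size φ Y < size φ E ∨ size φ Y = size φ E ∧ rungSize φ E ≤ rungSize φ Y) →
    (∀ Y ∈ Γ, Y ≠ E → T + size φ Y + size φ E ≤ n + 1 + rungSize φ Y + rungSize φ E) →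
    r ≤ freeRungs φ R + T → r + 1 + i = 2 * n →
    ((∃ Y ∈ Γ, Y ≠ E ∧ 2 ≤ size φ Y) → ∑ d ∈ Γ, size φ d + 2 * i ≤ n + 1) →
    ((∀ Y ∈ Γ, Y ≠ E → size φ Y ≤ 1) → ∑ d ∈ Γ, size φ d + i ≤ n) → Ext φ R Γ := by
  induction hk : 2 * n - i using Nat.strong_induction_on generalizing i with
  | _ k ih =>
  intro R Γ r h hE hmax hT hfr hi hA hB
  have hsumE := Finset.sum_erase_add Γ (size φ) hE
  by_cases hbase : ∑ d ∈ Γ.erase E, size φ d ≤ 1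
  · exact h.ext_of_le_one hE hbase
  suffices ∃ Y ∈ Γ, Y ≠ E ∧ (∃ μ, IsClassMat φ R Y μ ∧
      freeRungs φ R ≤ freeRungs φ (PartialEdgeColoring.peel R μ) + 1) ∧ 1 ≤ size φ Y ∧
      ((∃ Y ∈ Γ, Y ≠ E ∧ 2 ≤ size φ Y) → 2 ≤ size φ Y) by
    obtain ⟨Y, hY, hYE, ⟨μ, hμ, hfr'⟩, hY1, hY2⟩ := this
    have hst := h.peel hY hμ
    have hsumY := Finset.sum_erase_add Γ (size φ) hY
    have hle : i + 1 ≤ 2 * n := by omega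
    refine hμ.ext hY (ih (2 * n - (i + 1)) (by omega) (i := i + 1) rfl hst
      (Finset.mem_erase.2 ⟨hYE.symm, hE⟩)
      (fun Z hZ => hmax Z (Finset.mem_of_mem_erase hZ))
      (fun Z hZ => hT Z (Finset.mem_of_mem_erase hZ)) (by omega) ?_ ?_ ?_)
    · have : 0 < r := by
        by_contra h0
        have := hμ.isMat
        obtain ⟨x⟩ := h.nonempty
        have h1 := h.reg (x, 0)
        have h2 : 0 < R.degree (x, 0) := (R.degree_pos_iff_exists_adj _).2
          ⟨_, (hμ.isMat _).2 (hμ.ne _)⟩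
        omega
      omega
    · rintro ⟨Z, hZ, hZE, hZ2⟩
      have hex : ∃ Y ∈ Γ, Y ≠ E ∧ 2 ≤ size φ Y := ⟨Z, Finset.mem_of_mem_erase hZ, hZE, hZ2⟩
      have := hA hex
      have := hY2 hex
      omega
    · intro _
      by_cases hex : ∃ Y ∈ Γ, Y ≠ E ∧ 2 ≤ size φ Y
      · have := hA hex
        have := hY2 hex
        omega
      · push Not at hex
        have := hB fun Z hZ hZE => by have := hex Z hZ hZE; omega
        omega
  by_cases hex : ∃ Y ∈ Γ, Y ≠ E ∧ 2 ≤ size φ Y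
  · have hs := hA hex
    obtain ⟨Y, hY, hYE, hY2⟩ := hex
    have h1 := hmax Y hY hYE
    have h2 := hT Y hY hYE
    have h3 := h.rungSize_le hY
    have h4 := h.rungSize_le hE
    have hsumYE := Finset.sum_erase_add (Γ.erase E) (size φ) (Finset.mem_erase.2 ⟨hYE, hY⟩)
    refine ⟨Y, hY, hYE, ?_, by omega, fun _ => hY2⟩
    by_cases hcase : ∑ d ∈ Γ, size φ d + size φ Y + 2 * n ≤ 2 * r
    · exact h.exists_classMat_of_size hY (by omega) hcase (Or.inr (by omega))
    · refine h.exists_classMat_of_two hY (by omega) (e := E) (fun d hd hdY hdE => ?_) (by omega)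
        (Or.inr (by omega))
      have := Finset.sum_eq_zero_iff.1 (show ∑ d ∈ (Γ.erase E).erase Y, size φ d = 0 by omega) d
        (by simp [hd, hdY, hdE])
      exact this
  · push Not at hex
    have hs := hB fun Z hZ hZE => by have := hex Z hZ hZE; omega
    obtain ⟨Y, hY, hY1⟩ : ∃ Y ∈ Γ.erase E, size φ Y ≠ 0 := by
      by_contra hno
      push Not at hno
      rw [Finset.sum_eq_zero hno] at hbase
      omega
    rw [Finset.mem_erase] at hY
    have h2 := hT Y hY.2 hY.1
    have h3 := h.rungSize_le hY.2
    have h4 := h.rungSize_le hE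
    have h5 := hex Y hY.2 hY.1
    refine ⟨Y, hY.2, hY.1, ?_, by omega, fun ⟨Z, hZ, hZE, hZ2⟩ => ?_⟩
    · exact h.exists_classMat_of_size hY.2 (by omega) (by omega) (Or.inr (by omega))
    · have := hex Z hZ hZE
      omega

theorem eq_of_size_le_one (hc : size φ c ≤ 1) {e f : Sym2 (ι × Fin 2)} (he : φ e = some c)
    (hf : φ f = some c) : e = f :=
  Finset.card_le_one.1 hc e (by simpa using he) f (by simpa using hf)

theorem IsState.exists_edge (h : IsState φ R Γ n r) (hc : c ∈ Γ) (hpos : 1 ≤ size φ c) :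
    ∃ u v, R.Adj u v ∧ φ s(u, v) = some c := by
  obtain ⟨e, he⟩ := Finset.card_pos.1 hpos
  induction e using Sym2.ind with
  | _ u v =>
    rw [Finset.mem_filter] at he
    exact ⟨u, v, (h.mem u v c he.2).1 hc, he.2⟩

/-- Classes of size one outside `K` can be extended to perfect matchings one after the other. -/
theorem IsState.ext_of_reduction (hn : 3 ≤ n) (K : Finset ℕ)
    (hbase : ∀ (R : SimpleGraph (ι × Fin 2)) (Γ : Finset ℕ) (r : ℕ), IsState φ R Γ n r → K ⊆ Γ →
      (∀ d ∈ Γ, d ∉ K → size φ d = 0) → ∑ d ∈ K, size φ d + n ≤ r + 2 → r ≤ rungs R →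
      Ext φ R Γ) : ∀ {R : SimpleGraph (ι × Fin 2)} {Γ : Finset ℕ} {r : ℕ}, IsState φ R Γ n r →
    K ⊆ Γ → (∀ d ∈ Γ, d ∉ K → size φ d ≤ 1) → r ≤ rungs R →
    (∑ d ∈ Γ, size φ d + n ≤ r + 2 ∧ 4 ≤ n ∧ 3 ≤ ∑ d ∈ K, size φ d ∨
      ∑ d ∈ Γ, size φ d + n ≤ r + 1 ∧ 2 ≤ ∑ d ∈ K, size φ d) → Ext φ R Γ := by
  intro R Γ r
  induction hk : r generalizing R Γ r with
  | zero =>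
    intro h hK _ _ hs
    have := Finset.sum_le_sum_of_subset (f := size φ) hK
    omega
  | succ r' ih =>
    subst hk
    intro h hK hone hrungs hs
    have hsumK := Finset.sum_sdiff (f := size φ) hK
    by_cases hex : ∀ d ∈ Γ, d ∉ K → size φ d = 0
    · exact hbase R Γ _ h hK hex (by omega) hrungs
    push Not at hex
    obtain ⟨d, hd, hdK, hd0⟩ := hex
    have hd1 := hone d hd hdK
    have hle := Finset.single_le_sum (f := size φ) (fun _ _ => Nat.zero_le _)
      (Finset.mem_sdiff.2 ⟨hd, hdK⟩)
    obtain ⟨u, v, huv, hduv⟩ := h.exists_edge hd (by omega)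
    have hsum := Finset.sum_erase_add Γ (size φ) hd
    obtain ⟨μ, hμ, hμr⟩ := exists_classMat_single h.proper (σ := r' - n)
      (ρ := ∑ d ∈ Γ, size φ d - 1) h.card_side h.le h.reg (by omega) hrungs huv hduv
      (fun x y _ hxy => eq_of_size_le_one hd1 hxy hduv) (fun k S _ =>
        (card_edges_side_le _ k S).trans (h.card_others_le.trans (by omega))) (by omega)
    exact hμ.ext hd (ih rfl (h.peel hd hμ)
      (fun x hx => Finset.mem_erase.2 ⟨fun hxd => hdK (hxd ▸ hx), hK hx⟩)
      (fun x hx => hone x (Finset.mem_of_mem_erase hx)) (by omega) (by omega))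

/-- Two rows of the sides of `F`: a bound for the edges inside a set. -/
theorem card_edges_side_le_one (F : SimpleGraph (ι × Fin 2)) (k : Fin 2) (S : Finset (Option ι))
    (hn : none ∈ S → ∀ i, ¬ F.Adj (i, 0) (i, 1))
    (h : ∀ i j i' j', F.Adj (i, k) (j, k) → F.Adj (i', k) (j', k) →
      s((i, k), (j, k)) = s((i', k), (j', k))) :
    (inside (side F k) S).edgeFinset.card ≤ 1 := by
  have key : ∀ e ∈ (inside (side F k) S).edgeFinset, ∃ i j, e = s(some i, some j) ∧
      F.Adj (i, k) (j, k) := by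
    intro e he
    induction e using Sym2.ind with
    | _ u v =>
      rw [mem_edgeFinset, mem_edgeSet] at he
      rcases u with _ | i <;> rcases v with _ | j
      · exact absurd rfl he.1.ne
      · exact absurd (side_none_some.1 he.1) (hn he.2.1 j)
      · exact absurd (side_some_none.1 he.1) (hn he.2.2 i)
      · exact ⟨i, j, rfl, side_some_some.1 he.1⟩
  rw [Finset.card_le_one]
  intro e he f hf
  obtain ⟨i, j, rfl, hij⟩ := key e he
  obtain ⟨i', j', rfl, hij'⟩ := key f hf
  have := h i j i' j' hij hij'
  simpa [Sym2.eq_iff] using this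

/-- Three single edges, one of which avoids a perfect matching containing another. -/
theorem IsState.ext_of_triple (h : IsState φ R Γ n r) (hn : 3 ≤ n) (hr : n + 1 ≤ r)
    (hrungs : r ≤ rungs R) {e f g : ℕ} (he : e ∈ Γ) (hf : f ∈ Γ) (hef : e ≠ f)
    (he1 : size φ e = 1) (hf1 : size φ f ≤ 1) (hg1 : size φ g ≤ 1)
    (hzero : ∀ d ∈ Γ, d ≠ e → d ≠ f → d ≠ g → size φ d = 0)
    (hhor : ∀ k, (∀ i j, φ s((i, k), (j, k)) ≠ some f) ∨ ∀ i j, φ s((i, k), (j, k)) ≠ some g)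
    (hver : (∃ i, φ s((i, 0), (i, 1)) = some e) ∨
      ∀ i, φ s((i, 0), (i, 1)) ≠ some f ∧ φ s((i, 0), (i, 1)) ≠ some g) : Ext φ R Γ := by
  obtain ⟨u, v, huv, hc⟩ := h.exists_edge he he1.ge
  have hfg : ∀ x y, (others φ R e).Adj x y → φ s(x, y) = some f ∨ φ s(x, y) = some g := by
    intro x y hxy
    obtain ⟨d, hd⟩ := Option.ne_none_iff_exists'.1 hxy.2.1
    by_contra hno
    push Not at hno
    have h1 := hzero d ((h.mem x y d hd).2 hxy.1) (fun h => hxy.2.2 (by rw [hd, h]))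
      (fun h => hno.1 (by rw [hd, h])) (fun h => hno.2 (by rw [hd, h]))
    have := size_pos hd
    omega
  obtain ⟨μ, hμ, -⟩ := exists_classMat_single h.proper (σ := r - n - 1)
      (ρ := 1) h.card_side h.le h.reg (by omega) hrungs huv hc
      (fun x y _ hxy => eq_of_size_le_one he1.le hxy hc) (fun k S hS => by
        refine card_edges_side_le_one _ k S (fun hnS i hi => ?_) fun i j i' j' hij hij' => ?_
        · rcases hver with ⟨j, hj⟩ | hver
          · have := eq_of_size_le_one he1.le hj hc
            refine hS hnS ?_
            rcases Sym2.eq_iff.1 this with ⟨h1, h2⟩ | ⟨h1, h2⟩ <;> rw [← h1, ← h2]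
          · rcases hfg _ _ hi with h1 | h1
            · exact (hver i).1 h1
            · exact (hver i).2 h1
        · rcases hhor k with h1 | h1
          · exact eq_of_size_le_one hg1 ((hfg _ _ hij).resolve_left (h1 _ _))
              ((hfg _ _ hij').resolve_left (h1 _ _))
          · exact eq_of_size_le_one hf1 ((hfg _ _ hij).resolve_right (h1 _ _))
              ((hfg _ _ hij').resolve_right (h1 _ _))) (by omega)
  refine hμ.ext he ((h.peel he hμ).ext_of_le_one (Finset.mem_erase.2 ⟨hef.symm, hf⟩) ?_)
  refine le_trans (Finset.sum_le_sum_of_ne_zero (t := {g}) fun d hd hd0 => ?_) (by simpa)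
  simp only [Finset.mem_erase, Finset.mem_singleton] at hd ⊢
  by_contra hdg
  exact hd0 (hzero d hd.2.2 hd.2.1 hd.1 hdg)

theorem exists_pos_of_sum {α : Type*} {S : Finset α} {f : α → ℕ} (h : 0 < ∑ d ∈ S, f d) :
    ∃ d ∈ S, 1 ≤ f d := by
  by_contra hno
  push Not at hno
  rw [Finset.sum_eq_zero fun d hd => by have := hno d hd; omega] at h
  omega

theorem rung_ne_of_hor (hc : size φ c ≤ 1) {k : Fin 2} {i j : ι}
    (h : φ s((i, k), (j, k)) = some c) (x : ι) : φ s((x, 0), (x, 1)) ≠ some c := by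
  intro h'
  rcases Sym2.eq_iff.1 (eq_of_size_le_one hc h h') with h1 | h1 <;> simp at h1 <;> omega

theorem hor_ne_of_rung (hc : size φ c ≤ 1) {i : ι}
    (h : φ s((i, 0), (i, 1)) = some c) (k : Fin 2) (x y : ι) : φ s((x, k), (y, k)) ≠ some c :=
  fun h' => rung_ne_of_hor hc h' i h

theorem hor_ne_of_hor (hc : size φ c ≤ 1) {k l : Fin 2} (hkl : k ≠ l) {i j : ι}
    (h : φ s((i, k), (j, k)) = some c) (x y : ι) : φ s((x, l), (y, l)) ≠ some c := by
  intro h'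
  rcases Sym2.eq_iff.1 (eq_of_size_le_one hc h h') with h1 | h1 <;> simp at h1 <;> omega

/-- A matching of `n + 1` edges with distinct colors has an edge on each side or three rungs. -/
theorem IsState.cases_of_disjoint (h : IsState φ R Γ n r)
    (hs : ∑ d ∈ Γ, size φ d = n + 1) (hone : ∀ d ∈ Γ, size φ d ≤ 1)
    (hdis : ∀ u v w f g, f ∈ Γ → g ∈ Γ → φ s(u, v) = some f → φ s(u, w) = some g → f = g) :
    (∃ f ∈ Γ, ∃ g ∈ Γ, f ≠ g ∧ (∃ i j, φ s((i, 0), (j, 0)) = some f) ∧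
      ∃ i j, φ s((i, 1), (j, 1)) = some g) ∨
    ∃ e ∈ Γ, ∃ f ∈ Γ, ∃ g ∈ Γ, e ≠ f ∧ e ≠ g ∧ f ≠ g ∧ (∃ i, φ s((i, 0), (i, 1)) = some e) ∧
      (∃ i, φ s((i, 0), (i, 1)) = some f) ∧ ∃ i, φ s((i, 0), (i, 1)) = some g := by
  have hm : ∀ d, ∃ m : Fin 2 → ℕ, d ∈ Γ → (∀ k, (coverSide φ R d k).card =
      rungSize φ d + 2 * m k ∧
      (m k = 0 → ∀ i, Cov φ R d (i, k) → φ s((i, 0), (i, 1)) = some d)) ∧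
      size φ d = rungSize φ d + m 0 + m 1 := by
    intro d
    by_cases hd : d ∈ Γ
    · obtain ⟨m, hm⟩ := h.exists_card_coverSide hd
      exact ⟨m, fun _ => hm⟩
    · exact ⟨0, fun h => absurd h hd⟩
  choose m hm using hm
  have hrung : ∀ d, rungSize φ d = 0 → ∀ i, φ s((i, 0), (i, 1)) ≠ some d := by
    intro d hd i hi
    rw [rungSize, Finset.card_eq_zero, Finset.filter_eq_empty_iff] at hd
    exact hd (Finset.mem_univ i) hi
  have hrung' : ∀ d, 1 ≤ rungSize φ d → ∃ i, φ s((i, 0), (i, 1)) = some d := by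
    intro d hd
    obtain ⟨i, hi⟩ := Finset.card_pos.1 hd
    exact ⟨i, by simpa using hi⟩
  have hhor : ∀ d ∈ Γ, ∀ k, m d k ≠ 0 → ∃ i j, φ s((i, k), (j, k)) = some d := by
    intro d hd k hk
    have h1 := ((hm d hd).1 k).1
    have h2 := (hm d hd).2
    have h3 := hone d hd
    obtain ⟨i, hi⟩ := Finset.card_pos.1 (show 0 < (coverSide φ R d k).card by omega)
    rw [mem_coverSide] at hi
    obtain ⟨⟨j, l⟩, hadj, hj⟩ := hi
    have h4 := h.le hadj
    simp only [boxProd_adj, top_adj] at h4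
    rcases h4 with ⟨_, rfl⟩ | ⟨h4, rfl⟩
    · exact ⟨i, j, hj⟩
    · refine absurd ?_ (hrung d (by rcases fin_two_cases zero_ne_one k with rfl | rfl <;> omega) i)
      rcases fin_two_cases zero_ne_one k with rfl | rfl
      · rwa [show l = 1 by omega] at hj
      · rwa [show l = 0 by omega, Sym2.eq_swap] at hj
  by_cases hboth : (∃ f ∈ Γ, m f 0 ≠ 0) ∧ ∃ g ∈ Γ, m g 1 ≠ 0
  · obtain ⟨⟨f, hf, hf0⟩, g, hg, hg1⟩ := hboth
    have h1 := (hm f hf).2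
    have h3 := hone f hf
    refine Or.inl ⟨f, hf, g, hg, ?_, hhor f hf 0 hf0, hhor g hg 1 hg1⟩
    rintro rfl
    omega
  · right
    have key : ∀ k l : Fin 2, k ≠ l → (∀ d ∈ Γ, m d l = 0) → 3 ≤ ∑ d ∈ Γ, rungSize φ d := by
      intro k l hkl hl
      have h1 : ∑ d ∈ Γ, (coverSide φ R d k).card ≤ Fintype.card ι := by
        rw [← Finset.card_biUnion]
        · exact Finset.card_le_univ _
        · intro x hx y hy hxy
          rw [Function.onFun, Finset.disjoint_left]
          intro i hi hi'
          rw [mem_coverSide] at hi hi'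
          obtain ⟨v, -, hv⟩ := hi
          obtain ⟨w, -, hw⟩ := hi'
          exact hxy (hdis _ _ _ _ _ hx hy hv hw)
      have h2 : ∑ d ∈ Γ, (coverSide φ R d k).card + ∑ d ∈ Γ, rungSize φ d =
          ∑ d ∈ Γ, 2 * size φ d := by
        rw [← Finset.sum_add_distrib]
        refine Finset.sum_congr rfl fun d hd => ?_
        have h3 := ((hm d hd).1 k).1
        have h4 := (hm d hd).2
        have h5 := hl d hd
        rcases fin_two_cases hkl 0 with h0 | h0
        · obtain rfl : l = 1 := by omega
          subst h0
          omega
        · obtain rfl : k = 1 := by omega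
          subst h0
          omega
      rw [← Finset.mul_sum] at h2
      have := h.card_side
      omega
    have hT : 3 ≤ ∑ d ∈ Γ, rungSize φ d := by
      by_cases h0 : ∃ f ∈ Γ, m f 0 ≠ 0
      · exact key 0 1 (by simp) fun d hd => by
          by_contra h1
          exact hboth ⟨h0, d, hd, h1⟩
      · push Not at h0
        exact key 1 0 (by simp) h0
    have hle : ∀ d ∈ Γ, rungSize φ d ≤ 1 := fun d hd => by
      have h1 := (hm d hd).2
      have h2 := hone d hd
      omega
    obtain ⟨e, he, he1⟩ := exists_pos_of_sum (S := Γ) (f := rungSize φ) (by omega)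
    have h1 := Finset.sum_erase_add Γ (rungSize φ) he
    have h2 := hle e he
    obtain ⟨f, hf, hf1⟩ := exists_pos_of_sum (S := Γ.erase e) (f := rungSize φ) (by omega)
    have h3 := Finset.sum_erase_add (Γ.erase e) (rungSize φ) hf
    rw [Finset.mem_erase] at hf
    have h4 := hle f hf.2
    obtain ⟨g, hg, hg1⟩ := exists_pos_of_sum (S := (Γ.erase e).erase f) (f := rungSize φ)
      (by omega)
    simp only [Finset.mem_erase] at hg
    exact ⟨e, he, f, hf.2, g, hg.2.2, hf.1.symm, hg.2.1.symm, hg.1.symm, hrung' e he1,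
      hrung' f hf1, hrung' g hg1⟩

/-- The case where all classes have size at most one and two of the edges are adjacent. -/
theorem IsState.ext_of_adjacent (h : IsState φ R Γ n r) (hone : ∀ d ∈ Γ, size φ d ≤ 1)
    {u v w : ι × Fin 2} {e f g : ℕ} (he : e ∈ Γ) (hf : φ s(u, v) = some f)
    (hg : φ s(u, w) = some g) (hzero : ∀ d ∈ Γ, d ≠ e → d ≠ f → d ≠ g → size φ d = 0) :
    Ext φ R Γ := by
  refine h.ext_of_star he u fun x y d hxy hd hde => ?_
  have hdΓ := (h.mem x y d hd).2 hxy
  have key : ∀ z, φ s(u, z) = some d → u = x ∨ u = y := by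
    intro z hz
    have := eq_of_size_le_one (hone d hdΓ) hz hd
    rcases Sym2.eq_iff.1 this with h1 | h1
    · exact Or.inl h1.1
    · exact Or.inr h1.1
  by_cases hdf : d = f
  · exact (key v (hdf ▸ hf)).imp Eq.symm Eq.symm
  by_cases hdg : d = g
  · exact (key w (hdg ▸ hg)).imp Eq.symm Eq.symm
  have := hzero d hdΓ hde hdf hdg
  have := size_pos hd
  omega

/-- The case of a matching with distinct colors, for large `n`. -/
theorem IsState.ext_of_disjoint (h : IsState φ R Γ n r) (hn : 4 ≤ n) (hr : r + 1 = 2 * n)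
    (hrungs : r ≤ rungs R) (hs : ∑ d ∈ Γ, size φ d = n + 1) (hone : ∀ d ∈ Γ, size φ d ≤ 1)
    (hdis : ∀ u v w f g, f ∈ Γ → g ∈ Γ → φ s(u, v) = some f → φ s(u, w) = some g → f = g) :
    Ext φ R Γ := by
  suffices ∃ e ∈ Γ, ∃ f ∈ Γ, ∃ g ∈ Γ, e ≠ f ∧ e ≠ g ∧ f ≠ g ∧ size φ e = 1 ∧ size φ f = 1 ∧
      size φ g = 1 ∧ (∀ k, (∀ i j, φ s((i, k), (j, k)) ≠ some f) ∨
        ∀ i j, φ s((i, k), (j, k)) ≠ some g) ∧ ((∃ i, φ s((i, 0), (i, 1)) = some e) ∨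
      ∀ i, φ s((i, 0), (i, 1)) ≠ some f ∧ φ s((i, 0), (i, 1)) ≠ some g) by
    obtain ⟨e, he, f, hf, g, hg, hef, heg, hfg, he1, hf1, hg1, hhor, hver⟩ := this
    have hK : ∑ d ∈ ({e, f, g} : Finset ℕ), size φ d = 3 := by
      rw [Finset.sum_insert (by simp [hef, heg]), Finset.sum_pair hfg]
      omega
    refine ext_of_reduction (by omega) {e, f, g} (fun R' Γ' r' h' hK' hzero hr' hrungs' => ?_) h
      (by simp [Finset.insert_subset_iff, he, hf, hg]) (fun d hd _ => hone d hd) hrungs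
      (Or.inl (by omega))
    refine h'.ext_of_triple (by omega) (by omega) hrungs' (hK' (by simp)) (hK' (by simp)) hef he1
      hf1.le hg1.le (fun d hd h1 h2 h3 => hzero d hd (by simp [h1, h2, h3])) hhor hver
  have hthird : ∀ a ∈ Γ, ∀ b ∈ Γ, a ≠ b → ∃ d ∈ Γ, d ≠ a ∧ d ≠ b ∧ size φ d = 1 := by
    intro a ha b hb hab
    have h1 := Finset.sum_erase_add Γ (size φ) ha
    have h2 := Finset.sum_erase_add (Γ.erase a) (size φ) (Finset.mem_erase.2 ⟨hab.symm, hb⟩)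
    have h3 := hone a ha
    have h4 := hone b hb
    obtain ⟨d, hd, hd1⟩ := exists_pos_of_sum (S := (Γ.erase a).erase b) (f := size φ) (by omega)
    simp only [Finset.mem_erase] at hd
    exact ⟨d, hd.2.2, hd.2.1, hd.1, le_antisymm (hone d hd.2.2) hd1⟩
  rcases h.cases_of_disjoint hs hone hdis with
    ⟨f, hf, g, hg, hfg, ⟨_, _, hf1⟩, _, _, hg1⟩ | ⟨e, he, f, hf, g, hg, hef, heg, hfg, ⟨i, he1⟩,
      ⟨_, hf1⟩, _, hg1⟩
  · obtain ⟨e, he, hef, heg, he1⟩ := hthird f hf g hg hfg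
    refine ⟨e, he, f, hf, g, hg, hef, heg, hfg, he1, le_antisymm (hone f hf) (size_pos hf1),
      le_antisymm (hone g hg) (size_pos hg1), fun k => ?_, Or.inr fun i =>
        ⟨rung_ne_of_hor (hone f hf) hf1 i, rung_ne_of_hor (hone g hg) hg1 i⟩⟩
    rcases fin_two_cases zero_ne_one k with rfl | rfl
    · exact Or.inr (hor_ne_of_hor (hone g hg) one_ne_zero hg1)
    · exact Or.inl (hor_ne_of_hor (hone f hf) zero_ne_one hf1)
  · exact ⟨e, he, f, hf, g, hg, hef, heg, hfg, le_antisymm (hone e he) (size_pos he1),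
      le_antisymm (hone f hf) (size_pos hf1), le_antisymm (hone g hg) (size_pos hg1),
      fun k => Or.inr (hor_ne_of_rung (hone g hg) hg1 k), Or.inl ⟨i, he1⟩⟩

/-- The case where at most one class has more than one edge. -/
theorem IsState.ext_of_singles (h : IsState φ R Γ n r) (hr : r + 1 = 2 * n)
    (hrungs : r ≤ rungs R) (hn : 4 ≤ n ∧ ∑ d ∈ Γ, size φ d ≤ n + 1 ∨
      3 ≤ n ∧ ∑ d ∈ Γ, size φ d ≤ n) {E : ℕ} (hE : E ∈ Γ)
    (hone : ∀ d ∈ Γ, d ≠ E → size φ d ≤ 1) : Ext φ R Γ := by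
  have hsumE := Finset.sum_erase_add Γ (size φ) hE
  by_cases hbase : ∑ d ∈ Γ.erase E, size φ d ≤ 1
  · exact h.ext_of_le_one hE hbase
  obtain ⟨f, hf, hf1⟩ := exists_pos_of_sum (S := Γ.erase E) (f := size φ) (by omega)
  have hf' := hf
  rw [Finset.mem_erase] at hf
  have hf1' := hone f hf.2 hf.1
  -- reduction to two classes
  have two : ∀ a ∈ Γ, ∀ b ∈ Γ, a ≠ b → size φ b = 1 → (∀ d ∈ Γ, d ≠ a → size φ d ≤ 1) →
      (4 ≤ n ∧ 2 ≤ size φ a ∨ ∑ d ∈ Γ, size φ d ≤ n ∧ 1 ≤ size φ a) → Ext φ R Γ := by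
    intro a ha b hb hab hb1 hone hcase
    have hK : ∑ d ∈ ({a, b} : Finset ℕ), size φ d = size φ a + 1 := by
      rw [Finset.sum_pair hab, hb1]
    refine ext_of_reduction (by omega) {a, b} (fun R' Γ' r' h' hK' hzero _ _ => ?_) h
      (by simp [Finset.insert_subset_iff, ha, hb])
      (fun d hd hdK => hone d hd fun h => hdK (by simp [h])) hrungs (by omega)
    refine h'.ext_of_le_one (hK' (by simp) : a ∈ Γ') ?_
    refine le_trans (Finset.sum_le_sum_of_ne_zero (t := {b}) fun d hd hd0 => ?_) (by simp [hb1])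
    simp only [Finset.mem_erase, Finset.mem_singleton] at hd ⊢
    by_contra hdg
    exact hd0 (hzero d hd.2 (by simp [hd.1, hdg]))
  by_cases hE2 : 2 ≤ size φ E
  · exact two E hE f hf.2 hf.1.symm (by omega) hone (by omega)
  have hone' : ∀ d ∈ Γ, size φ d ≤ 1 := fun d hd => by
    by_cases hdE : d = E
    · subst hdE
      omega
    · exact hone d hd hdE
  obtain ⟨g, hg, hg1⟩ : ∃ g ∈ (Γ.erase E).erase f, 1 ≤ size φ g := by
    have := Finset.sum_erase_add _ (size φ) hf'
    exact exists_pos_of_sum (by omega)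
  simp only [Finset.mem_erase] at hg
  by_cases hslack : ∑ d ∈ Γ, size φ d ≤ n
  · exact two g hg.2.2 f hf.2 hg.1 (by omega) (fun d hd _ => hone' d hd) (by omega)
  by_cases hadj : ∀ u v w f g, f ∈ Γ → g ∈ Γ → φ s(u, v) = some f → φ s(u, w) = some g → f = g
  · exact h.ext_of_disjoint (by omega) hr hrungs (by omega) hone' hadj
  push Not at hadj
  obtain ⟨u, v, w, a, b, ha, hb, hav, hbw, hab⟩ := hadj
  have h1 := Finset.sum_erase_add Γ (size φ) ha
  have h2 := Finset.sum_erase_add (Γ.erase a) (size φ) (Finset.mem_erase.2 ⟨hab.symm, hb⟩)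
  have h3 := hone' a ha
  have h4 := hone' b hb
  have h5 := size_pos hav
  have h6 := size_pos hbw
  obtain ⟨e, he, he1⟩ := exists_pos_of_sum (S := (Γ.erase a).erase b) (f := size φ) (by omega)
  simp only [Finset.mem_erase] at he
  have hK : ∑ d ∈ ({e, a, b} : Finset ℕ), size φ d = size φ e + (size φ a + size φ b) := by
    rw [Finset.sum_insert (by simp [he.1, he.2.1]), Finset.sum_pair hab]
  refine ext_of_reduction (by omega) {e, a, b} (fun R' Γ' r' h' hK' hzero hr' hrungs' => ?_) h
      (by simp [Finset.insert_subset_iff, he.2.2, ha, hb]) (fun d hd _ => hone' d hd) hrungs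
      (Or.inl (by omega))
  refine h'.ext_of_adjacent (fun d hd => ?_) (hK' (by simp) : e ∈ Γ') hav hbw
    fun d hd h1 h2 h3 => hzero d hd (by simp [h1, h2, h3])
  by_cases hdK : d ∈ ({e, a, b} : Finset ℕ)
  · simp only [Finset.mem_insert, Finset.mem_singleton] at hdK
    rcases hdK with rfl | rfl | rfl
    · exact hone' _ he.2.2
    · exact h3
    · exact h4
  · rw [hzero d hd hdK]
    exact Nat.zero_le _

theorem IsState.rungs_le (h : IsState φ R Γ n r) :
    rungs R ≤ freeRungs φ R + ∑ d ∈ Γ, rungSize φ d := by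
  refine le_trans (Finset.card_le_card (t := (Finset.univ.filter fun i =>
    R.Adj (i, 0) (i, 1) ∧ φ s((i, 0), (i, 1)) = none) ∪
    Γ.biUnion fun d => Finset.univ.filter fun i => φ s((i, 0), (i, 1)) = some d) fun i hi => ?_)
    ((Finset.card_union_le _ _).trans (Nat.add_le_add_left Finset.card_biUnion_le _))
  simp only [Finset.mem_filter, Finset.mem_univ, true_and, Finset.mem_union,
    Finset.mem_biUnion] at hi ⊢
  rcases hd : φ s((i, 0), (i, 1)) with _ | d
  · exact Or.inl ⟨hi, rfl⟩
  · exact Or.inr ⟨d, (h.mem _ _ _ hd).2 hi, rfl⟩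

theorem IsState.sum_rungSize_le (h : IsState φ R Γ n r) {a b : ℕ} (ha : a ∈ Γ) (hb : b ∈ Γ)
    (hab : a ≠ b) : ∑ d ∈ Γ, rungSize φ d + size φ a + size φ b ≤
      ∑ d ∈ Γ, size φ d + rungSize φ a + rungSize φ b := by
  have hb' := Finset.mem_erase.2 ⟨hab.symm, hb⟩
  have h1 := Finset.sum_erase_add Γ (size φ) ha
  have h2 := Finset.sum_erase_add (Γ.erase a) (size φ) hb'
  have h3 := Finset.sum_erase_add Γ (rungSize φ) ha
  have h4 := Finset.sum_erase_add (Γ.erase a) (rungSize φ) hb'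
  have h5 := Finset.sum_le_sum (s := (Γ.erase a).erase b) (f := rungSize φ) (g := size φ)
    fun d hd => h.rungSize_le (Finset.mem_of_mem_erase (Finset.mem_of_mem_erase hd))
  omega

/-- Extending the class of `a` to a perfect matching when the remaining colors other than `b`
have at most one edge. -/
theorem IsState.ext_of_two (h : IsState φ R Γ n r) {a b : ℕ} (ha : a ∈ Γ) (hb : b ∈ Γ)
    (hab : a ≠ b) (hs : ∑ d ∈ Γ, size φ d ≤ size φ a + size φ b + 1)
    (hmat : ∃ μ, IsClassMat φ R a μ) : Ext φ R Γ := by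
  obtain ⟨μ, hμ⟩ := hmat
  have hb' := Finset.mem_erase.2 ⟨hab.symm, hb⟩
  have h1 := Finset.sum_erase_add Γ (size φ) ha
  have h2 := Finset.sum_erase_add (Γ.erase a) (size φ) hb'
  exact hμ.ext ha ((h.peel ha hμ).ext_of_le_one hb' (by omega))

theorem IsState.ext_of_four (h : IsState φ R Γ 4 7) (hrungs : 7 ≤ rungs R)
    (hs : ∑ d ∈ Γ, size φ d ≤ 5) {X Y : ℕ} (hX : X ∈ Γ) (hY : Y ∈ Γ) (hXY : Y ≠ X)
    (hX2 : 2 ≤ size φ X) (hY2 : 2 ≤ size φ Y)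
    (hmax : size φ Y < size φ X ∨ size φ Y = size φ X ∧ rungSize φ X ≤ rungSize φ Y) :
    Ext φ R Γ := by
  have hT := h.sum_rungSize_le hX hY hXY.symm
  have hfree := h.rungs_le
  have hX' := Finset.mem_erase.2 ⟨hXY.symm, hX⟩
  have h1 := Finset.sum_erase_add Γ (size φ) hY
  have h2 := Finset.sum_erase_add (Γ.erase Y) (size φ) hX'
  have h3 := h.rungSize_le hX
  have h4 := h.rungSize_le hY
  by_cases hrest : ∑ d ∈ (Γ.erase Y).erase X, size φ d = 0
  · have hzero : ∀ d ∈ Γ, d ≠ Y → d ≠ X → size φ d = 0 := fun d hd h1 h2 =>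
      Finset.sum_eq_zero_iff.1 hrest d (by simp [hd, h1, h2])
    by_cases hbad : rungSize φ X = 3
    · refine h.ext_of_two hX hY hXY.symm (by omega) ?_
      obtain ⟨m, hm, hsm⟩ := h.exists_card_coverSide hX
      have hcov : ∀ k, (coverSide φ R X k).card = 3 := fun k => by
        rw [(hm k).1]
        rcases fin_two_cases zero_ne_one k with rfl | rfl <;> omega
      have hdeg : ∀ k i, (side (others φ R X) k).degree (some i) ≤ 1 := fun k i =>
        (degree_side_le_degree _ k i).trans (h.degree_others_le {Y} (i, k) fun v d h1 h2 h3 => by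
          rw [Finset.mem_singleton]
          by_contra h4
          have := hzero d ((h.mem _ _ _ h2).2 h1) h4 h3
          have := size_pos h2
          omega)
      obtain ⟨μ, hμ, -⟩ := exists_classMat_of_odd h.proper h.card_side h.le h.reg
        (fun k => by rw [hcov k]; decide) (fun k i j _ _ _ => by
          have := hdeg k i
          have := hdeg k j
          have := hcov k
          omega)
      exact ⟨μ, hμ⟩
    · refine h.ext_of_two hY hX hXY (by omega) ?_
      obtain ⟨μ, hμ, -⟩ := h.exists_classMat_of_two hY (by omega) (e := X) hzero (by omega) (by
        by_cases hodd : rungSize φ Y = 1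
        · exact Or.inl (by rw [hodd]; decide)
        · right
          omega)
      exact ⟨μ, hμ⟩
  obtain ⟨f, hf, hf1⟩ := exists_pos_of_sum (Nat.pos_of_ne_zero hrest)
  have h5 := Finset.sum_erase_add _ (size φ) hf
  simp only [Finset.mem_erase] at hf
  have hzero : ∀ d ∈ Γ, d ≠ Y → d ≠ X → d ≠ f → size φ d = 0 := fun d hd h1 h2 h3 =>
    Finset.sum_eq_zero_iff.1 (show ∑ d ∈ ((Γ.erase Y).erase X).erase f, size φ d = 0 by omega)
      d (by simp [hd, h1, h2, h3])
  have hmem : ∀ u v d, R.Adj u v → φ s(u, v) = some d → d = X ∨ d = Y ∨ d = f := by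
    intro u v d huv hd
    by_contra hno
    push Not at hno
    have := hzero d ((h.mem _ _ _ hd).2 huv) hno.2.1 hno.1 hno.2.2
    have := size_pos hd
    omega
  by_cases hbad : ∃ k i j, i ≠ j ∧ (∃ v, φ s((i, k), v) = some f) ∧
      (∃ v, φ s((j, k), v) = some f) ∧ (∃ v, φ s((i, k), v) = some X) ∧
      ∃ v, φ s((j, k), v) = some X
  · obtain ⟨k, i, j, hij, ⟨v, hv⟩, ⟨w, hw⟩, hXi, hXj⟩ := hbad
    have hfij : φ s((i, k), (j, k)) = some f := by
      have := eq_of_size_le_one (by omega) hv hw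
      rcases Sym2.eq_iff.1 this with ⟨h6, _⟩ | ⟨_, rfl⟩
      · exact absurd (Prod.ext_iff.1 h6).1 hij
      · exact hv
    have hTf := h.sum_rungSize_le hX hf.2.2 hf.1.symm
    have hrf : rungSize φ f = 0 := by
      rw [rungSize, Finset.card_eq_zero, Finset.filter_eq_empty_iff]
      intro x _ hx
      have := eq_of_size_le_one (by omega) hx hfij
      rcases Sym2.eq_iff.1 this with ⟨h6, h7⟩ | ⟨h6, h7⟩ <;>
      · simp only [Prod.mk.injEq] at h6 h7
        exact absurd (h6.2.trans h7.2.symm) (by simp)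
    have hdeg : ∀ l x, ¬ Cov φ R X (x, l) → (side (others φ R X) l).degree (some x) ≤ 1 :=
      fun l x hx => (degree_side_le_degree _ l x).trans
        (h.degree_others_le {Y} (x, l) fun v d h1 h2 h3 => by
          rw [Finset.mem_singleton]
          refine ((hmem _ _ _ h1 h2).resolve_left h3).resolve_right ?_
          rintro rfl
          have := eq_of_size_le_one (by omega) h2 hfij
          rw [h.cov_iff hX] at hx
          rcases Sym2.eq_iff.1 this with ⟨h6, _⟩ | ⟨h6, _⟩
          · exact hx (h6 ▸ hXi)
          · exact hx (h6 ▸ hXj))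
    refine h.ext_of_two hX hY hXY.symm (by omega) ?_
    obtain ⟨μ, hμ, -⟩ := h.exists_classMat_of_degree hX (by omega) (D := 2)
      (fun l x y _ hx hy => by
        have := hdeg l x hx
        have := hdeg l y hy
        omega) (by omega) (by
      by_cases hodd : rungSize φ X = 1
      · exact Or.inl (by rw [hodd]; decide)
      · right
        omega)
    exact ⟨μ, hμ⟩
  · push Not at hbad
    refine h.ext_of_two hY hX hXY (by omega) ?_
    have hdeg2 : ∀ l x, (side (others φ R Y) l).degree (some x) ≤ 2 := fun l x =>
      ((degree_side_le_degree _ l x).trans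
        (h.degree_others_le {X, f} (x, l) fun v d h1 h2 h3 => by
          have := hmem _ _ _ h1 h2
          simp only [Finset.mem_insert, Finset.mem_singleton]
          tauto)).trans Finset.card_le_two
    have hdeg1 : ∀ l x, (¬ ∃ v, φ s((x, l), v) = some f) ∨ (¬ ∃ v, φ s((x, l), v) = some X) →
        (side (others φ R Y) l).degree (some x) ≤ 1 := fun l x hx => by
      rcases hx with hx | hx
      · refine (degree_side_le_degree _ l x).trans
          (h.degree_others_le {X} (x, l) fun v d g1 g2 g3 => ?_)
        rcases hmem _ _ _ g1 g2 with rfl | rfl | rfl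
        · simp
        · exact absurd rfl g3
        · exact absurd ⟨v, g2⟩ hx
      · refine (degree_side_le_degree _ l x).trans
          (h.degree_others_le {f} (x, l) fun v d g1 g2 g3 => ?_)
        rcases hmem _ _ _ g1 g2 with rfl | rfl | rfl
        · exact absurd ⟨v, g2⟩ hx
        · exact absurd rfl g3
        · simp
    obtain ⟨μ, hμ, -⟩ := h.exists_classMat_of_degree hY (by omega) (D := 3)
      (fun l x y hxy _ _ => by
        have h6 := hdeg2 l x
        have h7 := hdeg2 l y
        by_contra hno
        have h8 : ∀ z, (z = x ∨ z = y) →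
            (∃ v, φ s((z, l), v) = some f) ∧ ∃ v, φ s((z, l), v) = some X := by
          intro z hz
          by_contra hz'
          have := hdeg1 l z (by tauto)
          rcases hz with rfl | rfl <;> omega
        obtain ⟨h9, v, hv⟩ := h8 y (Or.inr rfl)
        exact hbad l x y hxy (h8 x (Or.inl rfl)).1 h9 (h8 x (Or.inl rfl)).2 v hv) (by omega) (by
      by_cases hodd : rungSize φ Y = 1
      · exact Or.inl (by rw [hodd]; decide)
      · right
        omega)
    exact ⟨μ, hμ⟩

theorem IsState.ext_of_four_le (h : IsState φ R Γ n r) (hr : r + 1 = 2 * n) (hn : 4 ≤ n)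
    (hrungs : r ≤ rungs R) (hs : ∑ d ∈ Γ, size φ d ≤ n + 1) : Ext φ R Γ := by
  obtain ⟨E, hE, hmax⟩ := Finset.exists_max_image Γ
    (fun d => toLex (size φ d, size φ d - rungSize φ d))
    (Finset.card_pos.1 (by rw [h.card]; omega))
  have hmax : ∀ Y ∈ Γ, Y ≠ E →
      size φ Y < size φ E ∨ size φ Y = size φ E ∧ rungSize φ E ≤ rungSize φ Y := by
    intro Y hY _
    have h1 := hmax Y hY
    rw [Prod.Lex.toLex_le_toLex] at h1
    have h2 := h.rungSize_le hY
    have h3 := h.rungSize_le hE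
    dsimp only at h1
    omega
  by_cases hex : ∃ Y ∈ Γ, Y ≠ E ∧ 2 ≤ size φ Y
  swap
  · push Not at hex
    exact h.ext_of_singles hr hrungs (Or.inl ⟨hn, hs⟩) hE
      fun d hd hdE => Nat.lt_succ_iff.1 (hex d hd hdE)
  obtain ⟨Y, hY, hYE, hY2⟩ := hex
  have h1 := hmax Y hY hYE
  rcases hn.eq_or_lt with rfl | hn5
  · obtain rfl : r = 7 := by omega
    exact h.ext_of_four hrungs hs hE hY hYE (by omega) hY2 h1
  · refine ext_of_large (i := 0) (T := ∑ d ∈ Γ, rungSize φ d) hn5 (by omega) h hE hmax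
      (fun Z hZ hZE => ?_) (hrungs.trans h.rungs_le) (by omega) (fun _ => by omega)
      (fun hall => ?_)
    · have := h.sum_rungSize_le hZ hE hZE
      omega
    · have := hall Y hY hYE
      omega

/-- Transport of an extending coloring along a bijection of the vertices and a renaming of the
colors. -/
theorem Ext.of_equiv {V W : Type*} {R : SimpleGraph V} {φ : Sym2 V → Option ℕ} {Γ : Finset ℕ}
    (e : W ≃ V) (C : W → W → ℕ) (hsymm : ∀ u v, C u v = C v u) {k : ℕ} (κ : Fin k → ℕ)
    (hκ : Function.Injective κ) (hκΓ : ∀ t, κ t ∈ Γ)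
    (hC : ∀ u v, R.Adj (e u) (e v) → C u v < k ∧
      ∀ w, R.Adj (e u) (e w) → v ≠ w → C u v ≠ C u w)
    (hφ : ∀ u v d, R.Adj (e u) (e v) → φ s(e u, e v) = some d →
      ∃ h : C u v < k, κ ⟨C u v, h⟩ = d) : Ext φ R Γ := by
  let D : V → V → ℕ := fun x y =>
    if h : C (e.symm x) (e.symm y) < k then κ ⟨_, h⟩ else 0
  have hD : ∀ u v (h : C u v < k), D (e u) (e v) = κ ⟨C u v, h⟩ := by
    intro u v h
    simp [D, h]
  have hsD : ∀ x y, D x y = D y x := by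
    intro x y
    simp only [D, hsymm (e.symm y)]
  have hS : ∀ x y, Sym2.lift ⟨D, hsD⟩ s(x, y) = D x y := fun _ _ => rfl
  refine ⟨Sym2.lift ⟨D, hsD⟩, ?_, ?_, ?_⟩
  · intro x y z
    obtain ⟨u, rfl⟩ := e.surjective x
    obtain ⟨v, rfl⟩ := e.surjective y
    obtain ⟨w, rfl⟩ := e.surjective z
    intro h1 h2 h3
    rw [hS, hS, hD _ _ (hC u v h1).1, hD _ _ (hC u w h2).1] at h3
    have h4 := Fin.ext_iff.1 (hκ h3)
    by_contra hne
    exact (hC u v h1).2 w h2 (fun h => hne (by rw [h])) h4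
  · intro x y
    obtain ⟨u, rfl⟩ := e.surjective x
    obtain ⟨v, rfl⟩ := e.surjective y
    intro h1
    rw [hS, hD _ _ (hC u v h1).1]
    exact hκΓ _
  · intro x y d
    obtain ⟨u, rfl⟩ := e.surjective x
    obtain ⟨v, rfl⟩ := e.surjective y
    intro h1 h2
    obtain ⟨h3, h4⟩ := hφ u v d h1 h2
    rw [hS, hD _ _ h3, h4]

/-- A prescribed injective family of elements extends to a numbering of a finite set. -/
theorem exists_numbering {α : Type*} {Γ : Finset α} {k m : ℕ} (hΓ : Γ.card = k)
    (s : Fin m → Fin k) (g : Fin m → α)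
    (hs : Function.Injective s) (hg : Function.Injective g) (hgΓ : ∀ t, g t ∈ Γ) :
    ∃ κ : Fin k → α, Function.Injective κ ∧ (∀ t, κ t ∈ Γ) ∧ ∀ t, κ (s t) = g t := by
  by_cases hm : m = 0
  · subst hm
    obtain ⟨e⟩ : Nonempty (Fin k ≃ Γ) := Fintype.card_eq.1 (by simp [hΓ])
    exact ⟨fun t => e t, fun a b h => e.injective (Subtype.ext h), fun t => (e t).2,
      fun t => t.elim0⟩
  have : Nonempty (Fin m) := ⟨⟨0, by omega⟩⟩
  have hf : ∀ t, g (Function.invFun s (s t)) = g t := fun t => by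
    rw [Function.leftInverse_invFun hs]
  obtain ⟨e, he⟩ := Finset.exists_equiv_extend_of_card_eq (t := Γ) (s := Finset.univ.image s)
    (f := fun t => g (Function.invFun s t)) (by simp [hΓ]) (by
      intro x hx
      simp only [Finset.mem_image, Finset.mem_univ, true_and] at hx
      obtain ⟨a, ⟨b, rfl⟩, rfl⟩ := hx
      exact hgΓ _) (by
      intro a ha b hb hab
      simp only [Finset.coe_image, Finset.coe_univ, Set.image_univ, Set.mem_range] at ha hb
      obtain ⟨a, rfl⟩ := ha
      obtain ⟨b, rfl⟩ := hb
      simp only [hf] at hab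
      rw [hg hab])
  exact ⟨fun t => e t, fun a b h => e.injective (Subtype.ext h), fun t => (e t).2,
    fun t => (he (s t) (by simp)).trans (hf t)⟩

end

section

/-- A numbering of the edges of `K₅ □ K₂`. -/
def edgeIndex (u v : Fin 5 × Fin 2) : ℕ :=
  if u.2 = v.2 then 10 * u.2 + max u.1.val v.1 * (max u.1.val v.1 - 1) / 2 + min u.1.val v.1
  else 20 + max u.1.val v.1

/-- The edge coloring of `K₅ □ K₂` given by the decimal digits of `N`. -/
def digitColor (N : ℕ) (u v : Fin 5 × Fin 2) : ℕ := N / 10 ^ edgeIndex u v % 10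

/-- Adjacency in `K₅ □ K₂`. -/
def prismAdj (u v : Fin 5 × Fin 2) : Bool :=
  u.2 == v.2 && u.1 != v.1 || u.2 != v.2 && u.1 == v.1

/-- The digits of `N` give a proper coloring of `K₅ □ K₂` with six colors. -/
def IsTable (N : ℕ) : Prop :=
  ∀ u v, prismAdj u v → digitColor N u v < 6 ∧
    ∀ w, prismAdj u w → v ≠ w → digitColor N u v ≠ digitColor N u w

instance (N : ℕ) : Decidable (IsTable N) := Fintype.decidableForallFintype

/-- `s(u, v)` is an edge with ordered ends, different from `s(a, b)` and `s(c, d)`. -/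
def isFresh (a b c d u v : Fin 5 × Fin 2) : Bool :=
  prismAdj u v && u.1.val + 5 * u.2.val < v.1.val + 5 * v.2.val &&
    edgeIndex u v != edgeIndex a b && edgeIndex u v != edgeIndex c d

/-- The pairs `u, v` and `u', v'` are disjoint. -/
def areApart (u v u' v' : Fin 5 × Fin 2) : Bool := u != u' && u != v' && v != u' && v != v'

/-- Some table of `L` has a nonzero color on both `s(u, v)` and `s(u', v')`. -/
def Shared (L : List ℕ) (u v u' v' : Fin 5 × Fin 2) : Prop :=
  ∃ N ∈ L, digitColor N u v ≠ 0 ∧ digitColor N u' v' = digitColor N u v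

instance (L : List ℕ) (u v u' v' : Fin 5 × Fin 2) : Decidable (Shared L u v u' v') :=
  List.decidableBEx _ _

/-- The tables of `L` give the color `0` to `s(a, b)` and `s(c, d)`, and every pair of further
disjoint edges has a common color in one of them. -/
def Covers (L : List ℕ) (a b c d : Fin 5 × Fin 2) : Prop :=
  (∀ N ∈ L, IsTable N ∧ digitColor N a b = 0 ∧ digitColor N c d = 0) ∧
    ∀ u v, isFresh a b c d u v → ∀ u' v', isFresh a b c d u' v' → areApart u v u' v' →
      Shared L u v u' v'

instance (L : List ℕ) (a b c d : Fin 5 × Fin 2) : Decidable (Covers L a b c d) :=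
  instDecidableAnd

theorem covers_rung_rung : ∃ L, Covers L (0, 0) (0, 1) (1, 0) (1, 1) :=
  ⟨[1340042355211342543154321, 1540023451345210354241153, 1500035244123153524412315,
    30054231345213214152453, 1150052430243154025253341, 24353511244125312543,
    5550002311244353214042315, 250043251534211453035214], by decide +kernel⟩

theorem covers_rung_side : ∃ L, Covers L (0, 0) (0, 1) (1, 0) (2, 0) :=
  ⟨[2451014353522145143231045, 3125040215321345124432051, 4333015234051242513451024,
    5451031420213450421235034, 3023021044155325142321045, 5024023044155122431314052,
    2544015030243150513134025, 1154003254520133425254031], by decide +kernel⟩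

theorem covers_side_side : ∃ L, Covers L (0, 0) (1, 0) (2, 0) (3, 0) :=
  ⟨[2415354313122545314032450, 4351252311200352135051230, 5141131402543522143054350,
    4443453212031053152015230, 1433332040524513542025140, 3553520543104124251012430,
    252331524013045342031140, 255554210133205341013240], by decide +kernel⟩

theorem covers_parallel : ∃ L, Covers L (0, 0) (1, 0) (0, 1) (1, 1) :=
  ⟨[1314145232153402453514320, 5512334122413503014241350, 1404454232311500435521130,
    54154121342304215123340, 5235540235311203012541240, 444121545133201524235130,
    1405105422351300345132240, 1213545432101345423510], by decide +kernel⟩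

theorem covers_path : ∃ L, Covers L (0, 0) (1, 0) (0, 1) (2, 1) :=
  ⟨[4121331524253043125542340, 5355142131253040143415320, 425121455133021342523140,
    2554203144312054053231140, 2054534512143025134412230, 3015454022433011542435230,
    2212203515144034351013450, 4543415033422050125241530], by decide +kernel⟩

theorem covers_opposite : ∃ L, Covers L (0, 0) (1, 0) (2, 1) (3, 1) :=
  ⟨[3543141250135241254342150, 2451331450513421354235410, 2514145130322450514432230,
    3111124050345325024432530, 4421535210524303152521430, 522414530423511453342150,
    2423213540234510354513410, 313152130425401324045520], by decide +kernel⟩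

theorem edgeIndex_comm (u v : Fin 5 × Fin 2) : edgeIndex u v = edgeIndex v u := by
  rw [edgeIndex, edgeIndex, max_comm, min_comm]
  by_cases h : u.2 = v.2
  · rw [if_pos h, if_pos h.symm, h]
  · rw [if_neg h, if_neg (Ne.symm h)]

set_option synthInstance.maxHeartbeats 400000 in
set_option synthInstance.maxSize 1000 in
theorem edgeIndex_inj : ∀ u v, prismAdj u v → ∀ u' v', prismAdj u' v' →
    edgeIndex u v = edgeIndex u' v' → s(u, v) = s(u', v') := by
  decide +kernel

end

section

open scoped Classical

variable {ι : Type*} [Fintype ι] {R : SimpleGraph (ι × Fin 2)}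
  {φ : Sym2 (ι × Fin 2) → Option ℕ} {c : ℕ} {n r : ℕ} {Γ : Finset ℕ}

theorem digitColor_congr (N : ℕ) {u v u' v' : Fin 5 × Fin 2} (h : s(u, v) = s(u', v')) :
    digitColor N u v = digitColor N u' v' := by
  rcases Sym2.eq_iff.1 h with ⟨rfl, rfl⟩ | ⟨rfl, rfl⟩
  · rfl
  · rw [digitColor, digitColor, edgeIndex_comm]

theorem prismAdj_comm (u v : Fin 5 × Fin 2) : prismAdj u v = prismAdj v u := by
  simp only [prismAdj, Bool.beq_comm (a := u.2), Bool.beq_comm (a := u.1), bne]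

/-- A numbering of the vertices that may exchange the two sides. -/
def vertexEquiv (f : Fin 5 ≃ ι) (l : Fin 2) : Fin 5 × Fin 2 ≃ ι × Fin 2 :=
  f.prodCongr (Equiv.addRight l)

theorem IsState.prismAdj (h : IsState φ R Γ n r) (f : Fin 5 ≃ ι) (l : Fin 2)
    {u v : Fin 5 × Fin 2} (huv : R.Adj (vertexEquiv f l u) (vertexEquiv f l v)) :
    prismAdj u v := by
  have h1 := h.le huv
  simp [vertexEquiv] at h1
  rcases h1 with ⟨h1, h2⟩ | ⟨h1, h2⟩
  · simp [PartialEdgeColoring.prismAdj, h1, h2]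
  · simp [PartialEdgeColoring.prismAdj, h1, h2]

theorem mem_of_size_two (hc : size φ c = 2) {e f g : Sym2 (ι × Fin 2)} (he : φ e = some c)
    (hf : φ f = some c) (hef : e ≠ f) (hg : φ g = some c) : g = e ∨ g = f := by
  have h1 : ({e, f} : Finset _) = Finset.univ.filter fun e => φ e = some c :=
    Finset.eq_of_subset_of_card_le (by
      intro x hx
      rw [Finset.mem_insert, Finset.mem_singleton] at hx
      rcases hx with rfl | rfl <;> simpa) (by
      rw [Finset.card_pair hef]
      exact hc.le)
  have h2 : g ∈ ({e, f} : Finset _) := by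
    rw [h1]
    simpa
  rwa [Finset.mem_insert, Finset.mem_singleton] at h2

/-- Two classes of two edges, when a list of tables covers the first one. -/
theorem IsState.ext_of_covers (h : IsState φ R Γ 3 5) (f : Fin 5 ≃ ι) (l : Fin 2)
    {L : List ℕ} {a b c d : Fin 5 × Fin 2} (hL : Covers L a b c d)
    (hne : s(a, b) ≠ s(c, d)) {X Y : ℕ} (hX : X ∈ Γ) (hY : Y ∈ Γ) (hXY : X ≠ Y)
    (hab : φ s(vertexEquiv f l a, vertexEquiv f l b) = some X)
    (hcd : φ s(vertexEquiv f l c, vertexEquiv f l d) = some X)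
    (hX2 : size φ X = 2) (hY2 : size φ Y = 2)
    (hzero : ∀ d ∈ Γ, d ≠ X → d ≠ Y → size φ d = 0) : Ext φ R Γ := by
  set e := vertexEquiv f l with he
  have hinj : ∀ u v u' v', s(e u, e v) = s(e u', e v') → s(u, v) = s(u', v') := by
    intro u v u' v' h1
    exact Sym2.map.injective e.injective (by simpa using h1)
  have hadj : ∀ u v, φ s(e u, e v) = some X → PartialEdgeColoring.prismAdj u v := fun u v h1 =>
    h.prismAdj f l ((h.mem _ _ _ h1).1 hX)
  have hedge : ∀ g, φ g = some Y → ∃ u v, isFresh a b c d u v ∧ φ s(e u, e v) = some Y ∧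
      g = s(e u, e v) := by
    intro g hg
    induction g using Sym2.ind with
    | _ x y =>
    obtain ⟨u, rfl⟩ := e.surjective x
    obtain ⟨v, rfl⟩ := e.surjective y
    have h1 := h.prismAdj f l ((h.mem _ _ _ hg).1 hY)
    have key : ∀ a b, φ s(e a, e b) = some X → edgeIndex u v ≠ edgeIndex a b := by
      intro a b h2 h3
      have h4 := edgeIndex_inj _ _ h1 _ _ (hadj _ _ h2) h3
      have h5 := congrArg (Sym2.map e) h4
      simp only [Sym2.map_mk] at h5
      rw [h5] at hg
      exact hXY (Option.some.inj (h2.symm.trans hg))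
    rcases lt_trichotomy (u.1.val + 5 * u.2.val) (v.1.val + 5 * v.2.val) with h2 | h2 | h2
    · refine ⟨u, v, ?_, hg, rfl⟩
      simp [isFresh, h1, h2, key _ _ hab, key _ _ hcd]
    · have h3 : u = v := Prod.ext (by omega) (by omega)
      subst h3
      exact absurd rfl ((h.mem _ _ _ hg).1 hY).ne
    · refine ⟨v, u, ?_, by rwa [Sym2.eq_swap], Sym2.eq_swap⟩
      rw [prismAdj_comm] at h1
      have k1 := key _ _ hab
      have k2 := key _ _ hcd
      rw [edgeIndex_comm] at k1 k2
      simp [isFresh, h1, h2, k1, k2]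
  obtain ⟨g1, g2, hg, hgY⟩ := Finset.card_eq_two.1 hY2
  have hmem : ∀ g, φ g = some Y ↔ g = g1 ∨ g = g2 := by
    intro g
    have : g ∈ (Finset.univ.filter fun e => φ e = some Y) ↔ g ∈ ({g1, g2} : Finset _) := by
      rw [hgY]
    simpa using this
  obtain ⟨u, v, hf1, hφ1, rfl⟩ := hedge g1 ((hmem _).2 (Or.inl rfl))
  obtain ⟨u', v', hf2, hφ2, rfl⟩ := hedge g2 ((hmem _).2 (Or.inr rfl))
  have hap : areApart u v u' v' := by
    simp only [areApart, Bool.and_eq_true, bne_iff_ne]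
    have hφ1' := hφ1
    have hφ2' := hφ2
    rw [Sym2.eq_swap] at hφ1' hφ2'
    refine ⟨⟨⟨?_, ?_⟩, ?_⟩, ?_⟩ <;> rintro rfl
    · exact hg (by rw [h.proper _ _ _ _ hφ1 hφ2])
    · exact hg (by rw [h.proper _ _ _ _ hφ1 hφ2', Sym2.eq_swap])
    · exact hg (by rw [h.proper _ _ _ _ hφ1' hφ2, Sym2.eq_swap])
    · exact hg (by rw [h.proper _ _ _ _ hφ1' hφ2'])
  obtain ⟨N, hN, ht0, ht⟩ := hL.2 u v hf1 u' v' hf2 hap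
  obtain ⟨htab, h0, h0'⟩ := hL.1 N hN
  have ht6 : digitColor N u v < 6 := (htab u v (by
    simp only [isFresh, Bool.and_eq_true] at hf1
    exact hf1.1.1.1)).1
  obtain ⟨κ, hκ, hκΓ, hκg⟩ := exists_numbering (m := 2) (k := 6) h.card
    ![0, ⟨digitColor N u v, ht6⟩] ![X, Y] (by
      intro i j
      fin_cases i <;> fin_cases j <;> simp [Fin.ext_iff, ht0, Ne.symm ht0]) (by
      intro i j
      fin_cases i <;> fin_cases j <;> simp [hXY, hXY.symm]) (by
      intro i
      fin_cases i <;> simp [hX, hY])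
  refine Ext.of_equiv e (digitColor N) (fun u v => digitColor_congr N Sym2.eq_swap) κ hκ hκΓ
    (fun u v huv => ⟨(htab u v (h.prismAdj f l huv)).1, fun w huw hvw =>
      (htab u v (h.prismAdj f l huv)).2 w (h.prismAdj f l huw) hvw⟩) fun x y D hxy hD => ?_
  have hDΓ := (h.mem _ _ _ hD).2 hxy
  have hpos := size_pos hD
  by_cases hDX : D = X
  · subst hDX
    have h3 : digitColor N x y = 0 := by
      rcases mem_of_size_two hX2 hab hcd (fun h1 => hne (hinj _ _ _ _ h1)) hD with h1 | h1
      · rw [digitColor_congr N (hinj _ _ _ _ h1), h0]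
      · rw [digitColor_congr N (hinj _ _ _ _ h1), h0']
    exact ⟨by omega, (congrArg κ (Fin.ext h3)).trans (hκg 0)⟩
  · by_cases hDY : D = Y
    · subst hDY
      have h3 : digitColor N x y = digitColor N u v := by
        rcases (hmem _).1 hD with h1 | h1
        · exact digitColor_congr N (hinj _ _ _ _ h1)
        · rw [digitColor_congr N (hinj _ _ _ _ h1), ht]
      exact ⟨by omega, (congrArg κ (Fin.ext h3)).trans (hκg 1)⟩
    · have := hzero D hDΓ hDX hDY
      omega

theorem IsState.exists_equiv {k m : ℕ} (h : IsState φ R Γ n r) (hk : k + 1 = 2 * n)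
    (s : Fin m → Fin k) (g : Fin m → ι) (hs : Function.Injective s) (hg : Function.Injective g) :
    ∃ f : Fin k ≃ ι, ∀ t, f (s t) = g t := by
  have hcard : (Finset.univ : Finset ι).card = k := by
    have := h.card_side
    rw [Finset.card_univ]
    omega
  obtain ⟨κ, h1, -, h2⟩ := exists_numbering hcard s g hs hg fun _ => Finset.mem_univ _
  refine ⟨Equiv.ofBijective κ ((Fintype.bijective_iff_injective_and_card κ).2 ⟨h1, ?_⟩), h2⟩
  rw [Fintype.card_fin, ← Finset.card_univ, hcard]

/-- A precolored edge is a rung or an edge of one of the sides. -/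
theorem IsState.edge_cases (h : IsState φ R Γ n r) (hc : c ∈ Γ) {e : Sym2 (ι × Fin 2)}
    (he : φ e = some c) : (∃ i, e = s((i, 0), (i, 1))) ∨
      ∃ i j k, i ≠ j ∧ e = s((i, k), (j, k)) := by
  induction e using Sym2.ind with
  | _ u v =>
  obtain ⟨i, k⟩ := u
  obtain ⟨j, l⟩ := v
  have h1 := h.le ((h.mem _ _ _ he).1 hc)
  simp only [boxProd_adj, top_adj] at h1
  rcases h1 with ⟨h1, rfl⟩ | ⟨h1, rfl⟩
  · exact Or.inr ⟨i, j, k, h1, rfl⟩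
  · left
    refine ⟨i, ?_⟩
    rcases fin_two_cases h1 0 with h2 | h2
    · rw [← h2, show l = 1 by omega]
    · rw [← h2, show k = 1 by omega, Sym2.eq_swap]

theorem Proper.disjoint {V : Type*} {C : Sym2 V → Option ℕ} (hC : Proper C) {u v u' v' : V}
    (h : C s(u, v) = some c) (h' : C s(u', v') = some c) (hne : s(u, v) ≠ s(u', v')) :
    u ≠ u' ∧ u ≠ v' ∧ v ≠ u' ∧ v ≠ v' := by
  have k := h
  have k' := h'
  rw [Sym2.eq_swap] at k k'
  refine ⟨?_, ?_, ?_, ?_⟩ <;> rintro rfl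
  · exact hne (by rw [hC _ _ _ _ h h'])
  · exact hne (by rw [hC _ _ _ _ h k', Sym2.eq_swap])
  · exact hne (by rw [hC _ _ _ _ k h', Sym2.eq_swap])
  · exact hne (by rw [hC _ _ _ _ k k'])

theorem injective_pair {α : Type*} {a b : α} (h : a ≠ b) : Function.Injective ![a, b] := by
  intro i j hij
  fin_cases i <;> fin_cases j <;> simp_all

theorem injective_triple {α : Type*} {a b c : α} (h1 : a ≠ b) (h2 : a ≠ c) (h3 : b ≠ c) :
    Function.Injective ![a, b, c] := by
  intro i j hij
  fin_cases i <;> fin_cases j <;> simp_all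

theorem injective_quadruple {α : Type*} {a b c d : α} (h1 : a ≠ b) (h2 : a ≠ c) (h3 : a ≠ d)
    (h4 : b ≠ c) (h5 : b ≠ d) (h6 : c ≠ d) : Function.Injective ![a, b, c, d] := by
  intro i j hij
  fin_cases i <;> fin_cases j <;> simp_all

/-- Two classes of two edges in `K₅ □ K₂`. -/
theorem IsState.ext_of_two_pairs (h : IsState φ R Γ 3 5) {X Y : ℕ} (hX : X ∈ Γ) (hY : Y ∈ Γ)
    (hXY : X ≠ Y) (hX2 : size φ X = 2) (hY2 : size φ Y = 2)
    (hzero : ∀ d ∈ Γ, d ≠ X → d ≠ Y → size φ d = 0) : Ext φ R Γ := by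
  have hrs : ∀ i : ι, ∀ j k s, j ≠ k → φ s((i, 0), (i, 1)) = some X →
      φ s((j, s), (k, s)) = some X → Ext φ R Γ := by
    intro i j k s hjk h1 h2
    have hne : s((i, 0), (i, 1)) ≠ s((j, s), (k, s)) := by
      intro h3
      rcases Sym2.eq_iff.1 h3 with h3 | h3 <;> simp at h3 <;> omega
    have h3 := h.proper.disjoint h1 h2 hne
    have hij : i ≠ j := by
      rintro rfl
      rcases fin_two_cases zero_ne_one s with rfl | rfl <;> simp at h3
    have hik : i ≠ k := by
      rintro rfl
      rcases fin_two_cases zero_ne_one s with rfl | rfl <;> simp at h3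
    obtain ⟨f, hf⟩ := h.exists_equiv (k := 5) rfl ![0, 1, 2] ![i, j, k]
      (injective_triple (by decide) (by decide) (by decide)) (injective_triple hij hik hjk)
    have f0 : f 0 = i := hf 0
    have f1 : f 1 = j := hf 1
    have f2 : f 2 = k := hf 2
    obtain ⟨L, hL⟩ := covers_rung_side
    refine h.ext_of_covers f s hL (by decide) hX hY hXY ?_ ?_ hX2 hY2 hzero
    · rcases fin_two_cases zero_ne_one s with rfl | rfl
      · simpa [vertexEquiv, f0] using h1
      · rw [Sym2.eq_swap]
        simpa [vertexEquiv, f0] using h1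
    · simpa [vertexEquiv, f1, f2] using h2
  obtain ⟨e1, e2, hne, heX⟩ := Finset.card_eq_two.1 hX2
  have he : ∀ e ∈ ({e1, e2} : Finset _), φ e = some X := by
    intro e he
    rw [← heX] at he
    simpa using he
  have h1 := he e1 (by simp)
  have h2 := he e2 (by simp)
  rcases h.edge_cases hX h1 with ⟨i, rfl⟩ | ⟨i, j, s, hij, rfl⟩
  · rcases h.edge_cases hX h2 with ⟨j, rfl⟩ | ⟨j, k, s, hjk, rfl⟩
    · have hij : i ≠ j := by
        rintro rfl
        exact hne rfl
      obtain ⟨f, hf⟩ := h.exists_equiv (k := 5) rfl ![0, 1] ![i, j]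
        (injective_pair (by decide)) (injective_pair hij)
      have f0 : f 0 = i := hf 0
      have f1 : f 1 = j := hf 1
      obtain ⟨L, hL⟩ := covers_rung_rung
      refine h.ext_of_covers f 0 hL (by decide) hX hY hXY ?_ ?_ hX2 hY2 hzero
      · simpa [vertexEquiv, f0] using h1
      · simpa [vertexEquiv, f1] using h2
    · exact hrs i j k s hjk h1 h2
  · rcases h.edge_cases hX h2 with ⟨k, rfl⟩ | ⟨i', j', s', hij', rfl⟩
    · exact hrs k i j s hij h2 h1
    · have hd := h.proper.disjoint h1 h2 hne
      simp only [ne_eq, Prod.mk.injEq, not_and] at hd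
      by_cases hss : s = s'
      · subst hss
        simp only [not_true_eq_false, imp_false] at hd
        obtain ⟨f, hf⟩ := h.exists_equiv (k := 5) rfl ![0, 1, 2, 3] ![i, j, i', j']
          (injective_quadruple (by decide) (by decide) (by decide) (by decide) (by decide)
            (by decide)) (injective_quadruple hij hd.1 hd.2.1 hd.2.2.1 hd.2.2.2 hij')
        have f0 : f 0 = i := hf 0
        have f1 : f 1 = j := hf 1
        have f2 : f 2 = i' := hf 2
        have f3 : f 3 = j' := hf 3
        obtain ⟨L, hL⟩ := covers_side_side
        refine h.ext_of_covers f s hL (by decide) hX hY hXY ?_ ?_ hX2 hY2 hzero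
        · simpa [vertexEquiv, f0, f1] using h1
        · simpa [vertexEquiv, f2, f3] using h2
      · have hs' : (1 : Fin 2) + s = s' := by omega
        have hpath : ∀ a b c, a ≠ b → a ≠ c → b ≠ c → φ s((a, s), (b, s)) = some X →
            φ s((a, s'), (c, s')) = some X → Ext φ R Γ := by
          intro a b c h3 h4 h5 h6 h7
          obtain ⟨f, hf⟩ := h.exists_equiv (k := 5) rfl ![0, 1, 2] ![a, b, c]
            (injective_triple (by decide) (by decide) (by decide)) (injective_triple h3 h4 h5)
          have f0 : f 0 = a := hf 0
          have f1 : f 1 = b := hf 1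
          have f2 : f 2 = c := hf 2
          obtain ⟨L, hL⟩ := covers_path
          refine h.ext_of_covers f s hL (by decide) hX hY hXY ?_ ?_ hX2 hY2 hzero
          · simpa [vertexEquiv, f0, f1] using h6
          · simpa [vertexEquiv, f0, f2, hs'] using h7
        have hpar : φ s((i, s'), (j, s')) = some X → Ext φ R Γ := by
          intro h3
          obtain ⟨f, hf⟩ := h.exists_equiv (k := 5) rfl ![0, 1] ![i, j]
            (injective_pair (by decide)) (injective_pair hij)
          have f0 : f 0 = i := hf 0
          have f1 : f 1 = j := hf 1
          obtain ⟨L, hL⟩ := covers_parallel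
          refine h.ext_of_covers f s hL (by decide) hX hY hXY ?_ ?_ hX2 hY2 hzero
          · simpa [vertexEquiv, f0, f1] using h1
          · simpa [vertexEquiv, f0, f1, hs'] using h3
        have h1' := h1
        have h2' := h2
        rw [Sym2.eq_swap] at h1' h2'
        by_cases e1 : i = i'
        · subst e1
          by_cases e2 : j = j'
          · subst e2
            exact hpar h2
          · exact hpath i j j' hij hij' e2 h1 h2
        by_cases e2 : i = j'
        · subst e2
          by_cases e3 : j = i'
          · subst e3
            exact hpar h2'
          · exact hpath i j i' hij (Ne.symm hij') e3 h1 h2'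
        by_cases e3 : j = i'
        · subst e3
          exact hpath j i j' hij.symm hij' e2 h1' h2
        by_cases e4 : j = j'
        · subst e4
          exact hpath j i i' hij.symm (Ne.symm hij') e1 h1' h2'
        obtain ⟨f, hf⟩ := h.exists_equiv (k := 5) rfl ![0, 1, 2, 3] ![i, j, i', j']
          (injective_quadruple (by decide) (by decide) (by decide) (by decide) (by decide)
            (by decide)) (injective_quadruple hij e1 e2 e3 e4 hij')
        have f0 : f 0 = i := hf 0
        have f1 : f 1 = j := hf 1
        have f2 : f 2 = i' := hf 2
        have f3 : f 3 = j' := hf 3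
        obtain ⟨L, hL⟩ := covers_opposite
        refine h.ext_of_covers f s hL (by decide) hX hY hXY ?_ ?_ hX2 hY2 hzero
        · simpa [vertexEquiv, f0, f1] using h1
        · simpa [vertexEquiv, f2, f3, hs'] using h2

end

section

open scoped Classical

/-- Two disjoint edges covering `S` give a perfect matching of `S`. -/
theorem exists_mat_of_two_edges {W : Type*} {F : SimpleGraph W} {S : Finset W} {w x y z : W}
    (hS : ∀ v, v ∈ S ↔ v = w ∨ v = x ∨ v = y ∨ v = z) (hwy : w ≠ y) (hwz : w ≠ z) (hxy : x ≠ y)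
    (hxz : x ≠ z) (h1 : F.Adj w x) (h2 : F.Adj y z) :
    ∃ μ, IsMat (inside F S) μ ∧ ∀ v ∈ S, μ v ≠ v := by
  have hμ : IsMat (inside F S) (fun v => if v = w then x else if v = x then w else
      if v = y then z else if v = z then y else v) := by
    have := h1.ne
    have := h2.ne
    intro v
    by_cases hv : v ∈ S
    · have hw := (hS w).2 (by simp)
      have hx := (hS x).2 (by simp)
      have hy := (hS y).2 (by simp)
      have hz := (hS z).2 (by simp)
      have := h1.symm
      have := h2.symm
      rcases (hS v).1 hv with rfl | rfl | rfl | rfl <;> simp [inside, *] <;> grind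
    · rw [hS] at hv
      push Not at hv
      simp [hv]
  refine ⟨_, hμ, fun v hv => ?_⟩
  have := h1.ne
  have := h2.ne
  rcases (hS v).1 hv with rfl | rfl | rfl | rfl <;> grind

/-- A set of four vertices without a perfect matching has three pairwise intersecting pairs of
nonadjacent vertices. -/
theorem exists_triple_of_no_mat {W : Type*} {F : SimpleGraph W} {S : Finset W} (hS : S.card = 4)
    (hno : ¬ ∃ μ, IsMat (inside F S) μ ∧ ∀ v ∈ S, μ v ≠ v) :
    ∃ T : Finset (Sym2 W), T.card = 3 ∧
      (∀ p ∈ T, ∃ u v, p = s(u, v) ∧ u ∈ S ∧ v ∈ S ∧ u ≠ v ∧ ¬ F.Adj u v) ∧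
      ∀ p ∈ T, ∀ q ∈ T, ∃ w, w ∈ p ∧ w ∈ q := by
  obtain ⟨w, S', hw, rfl, hS'⟩ := Finset.card_eq_succ.1 hS
  obtain ⟨x, y, z, hxy, hxz, hyz, rfl⟩ := Finset.card_eq_three.1 hS'
  simp only [Finset.mem_insert, Finset.mem_singleton, not_or] at hw
  obtain ⟨hwx, hwy, hwz⟩ := hw
  have hc1 : ¬ F.Adj w x ∨ ¬ F.Adj y z := by
    by_contra! h
    exact hno (exists_mat_of_two_edges (w := w) (x := x) (y := y) (z := z)
      (fun v => by simp) hwy hwz hxy hxz h.1 h.2)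
  have hc2 : ¬ F.Adj w y ∨ ¬ F.Adj x z := by
    by_contra! h
    exact hno (exists_mat_of_two_edges (w := w) (x := y) (y := x) (z := z)
      (fun v => by simp; tauto) hwx hwz hxy.symm hyz h.1 h.2)
  have hc3 : ¬ F.Adj w z ∨ ¬ F.Adj x y := by
    by_contra! h
    exact hno (exists_mat_of_two_edges (w := w) (x := z) (y := x) (z := y)
      (fun v => by simp; tauto) hwx hwy hxz.symm hyz.symm h.1 h.2)
  have key : ∀ p q r : Sym2 W, p ≠ q → p ≠ r → q ≠ r →
      (∀ t ∈ ({p, q, r} : Finset (Sym2 W)), ∃ u v, t = s(u, v) ∧ u ∈ ({w, x, y, z} : Finset W) ∧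
        v ∈ ({w, x, y, z} : Finset W) ∧ u ≠ v ∧ ¬ F.Adj u v) → (∃ w, w ∈ p ∧ w ∈ q) →
      (∃ w, w ∈ p ∧ w ∈ r) → (∃ w, w ∈ q ∧ w ∈ r) → ∃ T : Finset (Sym2 W), T.card = 3 ∧
      (∀ p ∈ T, ∃ u v, p = s(u, v) ∧ u ∈ ({w, x, y, z} : Finset W) ∧
        v ∈ ({w, x, y, z} : Finset W) ∧ u ≠ v ∧ ¬ F.Adj u v) ∧
      ∀ p ∈ T, ∀ q ∈ T, ∃ w, w ∈ p ∧ w ∈ q := by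
    intro p q r hpq hpr hqr h1 h2 h3 h4
    refine ⟨{p, q, r}, Finset.card_eq_three.2 ⟨p, q, r, hpq, hpr, hqr, rfl⟩, h1, ?_⟩
    have hself : ∀ p : Sym2 W, ∃ w, w ∈ p ∧ w ∈ p := fun p => by
      induction p using Sym2.ind with
      | _ u v => exact ⟨u, by simp⟩
    intro a ha b hb
    simp only [Finset.mem_insert, Finset.mem_singleton] at ha hb
    have h2' : ∃ w, w ∈ q ∧ w ∈ p := h2.imp fun _ h => h.symm
    have h3' : ∃ w, w ∈ r ∧ w ∈ p := h3.imp fun _ h => h.symm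
    have h4' : ∃ w, w ∈ r ∧ w ∈ q := h4.imp fun _ h => h.symm
    rcases ha with rfl | rfl | rfl <;> rcases hb with rfl | rfl | rfl <;>
      first | assumption | exact hself _
  have hpair : ∀ u ∈ ({w, x, y, z} : Finset W), ∀ v ∈ ({w, x, y, z} : Finset W), u ≠ v →
      ¬ F.Adj u v → ∃ u' v', s(u, v) = s(u', v') ∧ u' ∈ ({w, x, y, z} : Finset W) ∧
        v' ∈ ({w, x, y, z} : Finset W) ∧ u' ≠ v' ∧ ¬ F.Adj u' v' := fun u hu v hv h1 h2 =>
    ⟨u, v, rfl, hu, hv, h1, h2⟩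
  have key' : ∀ a b c d e f : W, ¬ F.Adj a b → ¬ F.Adj c d → ¬ F.Adj e f → a ≠ b → c ≠ d → e ≠ f →
      ({a, b, c, d, e, f} : Finset W) ⊆ {w, x, y, z} → s(a, b) ≠ s(c, d) → s(a, b) ≠ s(e, f) →
      s(c, d) ≠ s(e, f) → (∃ w, w ∈ s(a, b) ∧ w ∈ s(c, d)) → (∃ w, w ∈ s(a, b) ∧ w ∈ s(e, f)) →
      (∃ w, w ∈ s(c, d) ∧ w ∈ s(e, f)) → ∃ T : Finset (Sym2 W), T.card = 3 ∧
      (∀ p ∈ T, ∃ u v, p = s(u, v) ∧ u ∈ ({w, x, y, z} : Finset W) ∧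
        v ∈ ({w, x, y, z} : Finset W) ∧ u ≠ v ∧ ¬ F.Adj u v) ∧
      ∀ p ∈ T, ∀ q ∈ T, ∃ w, w ∈ p ∧ w ∈ q := by
    intro a b c d e f h1 h2 h3 hab hcd hef hsub hp hq hr hi hj hk
    refine key s(a, b) s(c, d) s(e, f) hp hq hr ?_ hi hj hk
    intro t ht
    simp only [Finset.mem_insert, Finset.mem_singleton] at ht
    rcases ht with rfl | rfl | rfl
    · exact hpair _ (hsub (by simp)) _ (hsub (by simp)) hab h1
    · exact hpair _ (hsub (by simp)) _ (hsub (by simp)) hcd h2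
    · exact hpair _ (hsub (by simp)) _ (hsub (by simp)) hef h3
  rcases hc1 with h1 | h1 <;> rcases hc2 with h2 | h2 <;> rcases hc3 with h3 | h3 <;>
    refine key' _ _ _ _ _ _ h1 h2 h3 ?_ ?_ ?_ ?_ ?_ ?_ ?_ ?_ ?_ ?_ <;>
    first | assumption | (simp [Finset.insert_subset_iff]; done) |
      (simp [hwx, hwy, hwz, hxy, hxz, hyz,
        Ne.symm hxy, Ne.symm hxz, Ne.symm hyz, Ne.symm hwx, Ne.symm hwy, Ne.symm hwz])

end

section

open scoped Classical

variable {ι : Type*} {R : SimpleGraph (ι × Fin 2)}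
  {φ : Sym2 (ι × Fin 2) → Option ℕ} {c : ℕ} {n r : ℕ} {Γ : Finset ℕ}

theorem mem_of_sideEdge {k : Fin 2} {p : Sym2 (Option ι)} {q : Sym2 (ι × Fin 2)}
    (h : sideEdge k p = Sum.inl q) {i : ι} (hi : some i ∈ p) : (i, k) ∈ q := by
  induction p using Sym2.ind with
  | _ u v =>
  rcases u with _ | x <;> rcases v with _ | y <;> simp [sideEdge] at h hi <;> subst h <;>
    simp <;> grind

theorem exists_rung_of_sideEdge {k : Fin 2} {p : Sym2 (Option ι)} {q : Sym2 (ι × Fin 2)}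
    (h : sideEdge k p = Sum.inl q) (hn : none ∈ p) : ∃ i, q = s((i, 0), (i, 1)) := by
  induction p using Sym2.ind with
  | _ u v =>
  rcases u with _ | x <;> rcases v with _ | y <;> simp [sideEdge] at h hn <;>
    exact ⟨_, h.symm⟩

variable [Fintype ι]

/-- Three edges that keep the class of `c` from being contained in a perfect matching. -/
structure IsObstacle (φ : Sym2 (ι × Fin 2) → Option ℕ) (R : SimpleGraph (ι × Fin 2)) (c : ℕ)
    (Q : Finset (Sym2 (ι × Fin 2))) : Prop where
  card : Q.card = 3
  mem : ∀ q ∈ Q, q ∈ (others φ R c).edgeFinset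
  not_cov : ∀ q ∈ Q, ∀ v ∈ q, ¬ Cov φ R c v
  rung : ∀ i, s((i, 0), (i, 1)) ∈ Q → ∀ j, φ s((j, 0), (j, 1)) ≠ some c
  meet : ∀ p ∈ Q, ∀ q ∈ Q, (∃ v, v ∈ p ∧ v ∈ q) ∨
    (∃ i, p = s((i, 0), (i, 1))) ∧ ∃ j, q = s((j, 0), (j, 1))

theorem exists_obstacle (hfull : ((⊤ : SimpleGraph ι) □ (⊤ : SimpleGraph (Fin 2))) ≤ R) {k : Fin 2}
    {S : Finset (Option ι)} (hcard : S.card = 4) (hS : ∀ i, some i ∈ S → ¬ Cov φ R c (i, k))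
    (hn : none ∈ S → (∀ i, ¬ Cov φ R c (i, 1 - k)) ∧ ∀ j, φ s((j, 0), (j, 1)) ≠ some c)
    (hno : ¬ ∃ μ, IsMat (inside (side (avail φ R c) k) S) μ ∧ ∀ v ∈ S, μ v ≠ v) :
    ∃ Q, IsObstacle φ R c Q := by
  obtain ⟨T, hT, hTS, hTT⟩ := exists_triple_of_no_mat hcard hno
  have hoth : ∀ u v, R.Adj u v → ¬ Cov φ R c u → ¬ Cov φ R c v → ¬ (avail φ R c).Adj u v →
      (others φ R c).Adj u v := fun u v h1 h2 h3 h4 =>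
    ⟨h1, fun h5 => h4 ⟨h1, h5, h2, h3⟩, fun h5 => h2 ⟨v, h1, h5⟩⟩
  have hrung : ∀ i, none ∈ S → some i ∈ S → ¬ (avail φ R c).Adj (i, 0) (i, 1) →
      s((i, 0), (i, 1)) ∈ (others φ R c).edgeFinset ∧
      (∀ v ∈ s((i, (0 : Fin 2)), (i, 1)), ¬ Cov φ R c v) ∧
      ∀ x, s((i, (0 : Fin 2)), (i, 1)) = s((x, 0), (x, 1)) →
        ∀ j, φ s((j, 0), (j, 1)) ≠ some c := by
    intro i h1 h2 h3
    have h4 : ∀ l, ¬ Cov φ R c (i, l) := by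
      intro l
      rcases fin_two_cases (show k ≠ 1 - k by omega) l with rfl | rfl
      · exact hS i h2
      · exact (hn h1).1 i
    refine ⟨?_, ?_, fun _ _ => (hn h1).2⟩
    · rw [mem_edgeFinset, mem_edgeSet]
      exact hoth _ _ (hfull (by simp)) (h4 _) (h4 _) h3
    · intro v hv
      rcases Sym2.mem_iff.1 hv with rfl | rfl <;> exact h4 _
  have hex : ∀ p ∈ T, ∃ q, sideEdge k p = Sum.inl q ∧ q ∈ (others φ R c).edgeFinset ∧
      (∀ v ∈ q, ¬ Cov φ R c v) ∧
      ∀ i, q = s((i, 0), (i, 1)) → ∀ j, φ s((j, 0), (j, 1)) ≠ some c := by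
    intro p hp
    obtain ⟨u, v, rfl, hu, hv, huv, hadj⟩ := hTS p hp
    rcases u with _ | i <;> rcases v with _ | j
    · exact absurd rfl huv
    · rw [side_none_some] at hadj
      exact ⟨_, rfl, hrung j hu hv hadj⟩
    · rw [side_some_none] at hadj
      exact ⟨_, rfl, hrung i hv hu hadj⟩
    · rw [side_some_some] at hadj
      refine ⟨_, rfl, ?_, ?_, fun x hx => ?_⟩
      · rw [mem_edgeFinset, mem_edgeSet]
        refine hoth _ _ (hfull ?_) (hS _ hu) (hS _ hv) hadj
        simp only [boxProd_adj, top_adj]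
        exact Or.inl ⟨fun h => huv (by rw [h]), trivial⟩
      · intro v hv'
        rcases Sym2.mem_iff.1 hv' with rfl | rfl
        · exact hS _ hu
        · exact hS _ hv
      · rcases Sym2.eq_iff.1 hx with h | h <;> simp at h <;> omega
  obtain ⟨p₀, hp₀⟩ := Finset.card_pos.1 (show 0 < T.card by omega)
  have : Nonempty (Sym2 (ι × Fin 2)) := ⟨(hex p₀ hp₀).choose⟩
  choose! g hg1 hg2 hg3 hg4 using hex
  refine ⟨T.image g, ?_, ?_, ?_, ?_, ?_⟩
  · rw [Finset.card_image_of_injOn, hT]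
    intro p hp p' hp' h
    have hd : ∀ p ∈ T, ¬ p.IsDiag := by
      intro p hp
      obtain ⟨u, v, rfl, -, -, huv, -⟩ := hTS p hp
      exact huv
    exact sideEdge_inj (k := k) (hd p hp) (hd p' hp') (by rw [hg1 p hp, hg1 p' hp', h])
  · simpa using hg2
  · simpa using hg3
  · intro i hi
    obtain ⟨p, hp, hpi⟩ := Finset.mem_image.1 hi
    exact hg4 p hp i hpi
  · intro q hq q' hq'
    obtain ⟨p, hp, rfl⟩ := Finset.mem_image.1 hq
    obtain ⟨p', hp', rfl⟩ := Finset.mem_image.1 hq'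
    obtain ⟨_ | i, h1, h2⟩ := hTT p hp p' hp'
    · exact Or.inr ⟨exists_rung_of_sideEdge (hg1 p hp) h1,
        exists_rung_of_sideEdge (hg1 p' hp') h2⟩
    · exact Or.inl ⟨_, mem_of_sideEdge (hg1 p hp) h1, mem_of_sideEdge (hg1 p' hp') h2⟩

/-- A class of size one in `K₅ □ K₂` is contained in a perfect matching, or has an obstacle. -/
theorem IsState.exists_classMat_or_obstacle (h : IsState φ R Γ 3 r)
    (hfull : ((⊤ : SimpleGraph ι) □ (⊤ : SimpleGraph (Fin 2))) ≤ R) {u v : ι × Fin 2}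
    (huv : R.Adj u v) (hc : φ s(u, v) = some c)
    (hone : ∀ x y, R.Adj x y → φ s(x, y) = some c → s(x, y) = s(u, v)) :
    (∃ μ, IsClassMat φ R c μ ∧ rungs R ≤ rungs (PartialEdgeColoring.peel R μ) + 1) ∨
      ∃ Q, IsObstacle φ R c Q := by
  rw [or_iff_not_imp_right]
  intro hno
  have hcov := cov_of_single huv hc hone
  have hι := h.card_side
  obtain ⟨i, a⟩ := u
  obtain ⟨j, k⟩ := v
  by_cases hij : i = j
  · subst hij
    have hak : a ≠ k := fun h => huv.ne (by rw [h])
    have hcov' : ∀ l x, Cov φ R c (x, l) ↔ x = i := by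
      intro l x
      rw [hcov]
      rcases fin_two_cases hak l with rfl | rfl <;> simp [hak, hak.symm]
    have hcard : ∀ l, (coverSide φ R c l).card = 1 := fun l => by
      rw [Finset.card_eq_one]
      exact ⟨i, by ext x; rw [mem_coverSide, hcov', Finset.mem_singleton]⟩
    obtain ⟨μ, h1, h2⟩ := exists_classMat_odd (c := c) (R := R) h.proper (by
      intro l
      have h1 := card_freeSide (φ := φ) (R := R) (c := c) l
      have h3 := hcard l
      by_contra hmat
      exact hno (exists_obstacle hfull (by omega) (fun i hi => some_mem_freeSide.1 hi)
        (fun hn => absurd hn none_notMem_freeSide) hmat))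
    refine ⟨μ, h1, rungs_le_rungs_peel h1.isMat i fun x hx => ?_⟩
    exact (hcov' 0 x).1 ⟨_, hfull (by simp), h2 x hx⟩
  · have hak : a = k := by
      have := h.le huv
      simp only [boxProd_adj, hij] at this
      tauto
    subst hak
    have hb : a ≠ 1 - a := by omega
    have hnb : ∀ x, ¬ Cov φ R c (x, 1 - a) := fun x => by
      rw [hcov]
      simp [hb.symm]
    have hnr : ∀ y, φ s((y, 0), (y, 1)) ≠ some c := by
      intro y hy
      have hyR : R.Adj (y, 0) (y, 1) := hfull (by simp)
      rcases fin_two_cases hb 0 with h0 | h0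
      · exact hnb y (by rw [show 1 - a = 1 by omega]; exact ⟨_, hyR.symm, by rwa [Sym2.eq_swap]⟩)
      · exact hnb y (by rw [← h0]; exact ⟨_, hyR, hy⟩)
    have hca : (coverSide φ R c a).card = 2 := by
      rw [Finset.card_eq_two]
      exact ⟨i, j, hij, by ext x; rw [mem_coverSide, hcov]; simp⟩
    have hcb : (coverSide φ R c (1 - a)).card = 0 := by
      rw [Finset.card_eq_zero, Finset.eq_empty_iff_forall_notMem]
      intro x
      rw [mem_coverSide]
      exact hnb x
    obtain ⟨μ, h1, x, hx, h2⟩ := exists_classMat_even (c := c) (R := R) h.proper hb (by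
        have h1 := card_freeSide (φ := φ) (R := R) (c := c) a
        by_contra hmat
        exact hno (exists_obstacle hfull (by rw [card_insert_freeSide]; omega)
          (fun i hi => by simpa [some_mem_freeSide] using hi) (fun _ => ⟨hnb, hnr⟩) hmat)) (by
        intro x hx
        have h1 := card_freeSide (φ := φ) (R := R) (c := c) (1 - a)
        have h3 := card_erase_freeSide hx (1 - a)
        by_contra hmat
        exact hno (exists_obstacle hfull (by omega) (fun i _ => hnb i)
          (fun hn => absurd (Finset.mem_of_mem_erase hn) none_notMem_freeSide) hmat))
    exact ⟨μ, h1, rungs_le_rungs_peel h1.isMat x fun y hy => (h2 y hy).resolve_left (hnr y)⟩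

/-- Of two classes of size one, at least one is contained in a perfect matching, when there are
few other precolored edges. -/
theorem IsState.exists_classMat_or_exists_classMat (h : IsState φ R Γ 3 r)
    (hfull : ((⊤ : SimpleGraph ι) □ (⊤ : SimpleGraph (Fin 2))) ≤ R) {a b : ℕ} (ha : a ∈ Γ)
    (hb : b ∈ Γ) (hab : a ≠ b) (ha1 : size φ a = 1) (hb1 : size φ b = 1)
    (hs : ∑ d ∈ Γ, size φ d ≤ 4) :
    (∃ μ, IsClassMat φ R a μ ∧ rungs R ≤ rungs (PartialEdgeColoring.peel R μ) + 1) ∨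
      ∃ μ, IsClassMat φ R b μ ∧ rungs R ≤ rungs (PartialEdgeColoring.peel R μ) + 1 := by
  have key : ∀ c ∈ Γ, size φ c = 1 →
      (∃ μ, IsClassMat φ R c μ ∧ rungs R ≤ rungs (PartialEdgeColoring.peel R μ) + 1) ∨
      ∃ Q, IsObstacle φ R c Q ∧ Q = (others φ R c).edgeFinset := by
    intro c hc hc1
    obtain ⟨u, v, huv, hcuv⟩ := h.exists_edge hc hc1.ge
    refine (h.exists_classMat_or_obstacle hfull huv hcuv fun x y _ hxy =>
      eq_of_size_le_one hc1.le hxy hcuv).imp_right fun ⟨Q, hQ⟩ => ⟨Q, hQ, ?_⟩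
    have h1 := Finset.sum_erase_add Γ (size φ) hc
    have h2 := h.card_others_le (c := c)
    exact Finset.eq_of_subset_of_card_le hQ.mem (by rw [hQ.card]; omega)
  rcases key a ha ha1 with h1 | ⟨Q, hQ, hQe⟩
  · exact Or.inl h1
  rcases key b hb hb1 with h1 | ⟨Q', hQ', hQe'⟩
  · exact Or.inr h1
  exfalso
  obtain ⟨u, v, huv, huva⟩ := h.exists_edge ha ha1.ge
  obtain ⟨p, hp, hpb⟩ : ∃ p ∈ Q, φ p ≠ some b := by
    by_contra! hall
    have := Finset.card_le_card (s := Q) (t := Finset.univ.filter fun e => φ e = some b)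
      fun q hq => by simpa using hall q hq
    have h3 := hQ.card
    unfold size at hb1
    omega
  have hpa := hQ.mem p hp
  induction p using Sym2.ind with
  | _ x y =>
  rw [mem_edgeFinset, mem_edgeSet] at hpa
  have hpQ' : s(x, y) ∈ Q' := by
    rw [hQe', mem_edgeFinset, mem_edgeSet]
    exact ⟨hpa.1, hpa.2.1, hpb⟩
  have haQ' : s(u, v) ∈ Q' := by
    rw [hQe', mem_edgeFinset, mem_edgeSet]
    exact ⟨huv, by simp [huva], by simp [huva, hab]⟩
  rcases hQ'.meet _ hpQ' _ haQ' with ⟨w, hw1, hw2⟩ | ⟨⟨i, hi⟩, ⟨j, hj⟩⟩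
  · refine hQ.not_cov _ hp w hw1 ?_
    rcases Sym2.mem_iff.1 hw2 with rfl | rfl
    · exact ⟨_, huv, huva⟩
    · exact ⟨_, huv.symm, by rwa [Sym2.eq_swap]⟩
  · rw [hi] at hp
    exact hQ.rung i hp j (hj ▸ huva)

end

section

open scoped Classical

variable {ι : Type*} [Fintype ι] {R : SimpleGraph (ι × Fin 2)}
  {φ : Sym2 (ι × Fin 2) → Option ℕ} {c : ℕ} {n r : ℕ} {Γ : Finset ℕ}

theorem exists_sum_erase {S : Finset ℕ} {f : ℕ → ℕ} {k : ℕ}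
    (hone : ∀ d ∈ S, f d ≤ 1) (hs : ∑ d ∈ S, f d = k + 1) :
    ∃ e ∈ S, f e = 1 ∧ ∑ d ∈ S.erase e, f d = k := by
  obtain ⟨e, he, h1⟩ := exists_pos_of_sum (S := S) (f := f) (by omega)
  have h2 := Finset.sum_erase_add S f he
  have h3 := hone e he
  exact ⟨e, he, by omega, by omega⟩

/-- Two of four elements of weight one determine the other two. -/
theorem exists_other_pair {S : Finset ℕ} {s : ℕ → ℕ} (hone : ∀ d ∈ S, s d ≤ 1)
    (hs : ∑ d ∈ S, s d = 4) {f g : ℕ} (hf : f ∈ S) (hg : g ∈ S) (hfg : f ≠ g) (hf1 : s f = 1)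
    (hg1 : s g = 1) : ∃ a ∈ S, ∃ b ∈ S, a ≠ b ∧ s a = 1 ∧ s b = 1 ∧ a ≠ f ∧ a ≠ g ∧ b ≠ f ∧
      b ≠ g ∧ ∀ d ∈ S, d ≠ a → d ≠ b → d ≠ f → d ≠ g → s d = 0 := by
  have h1 := Finset.sum_erase_add S s hf
  have h2 := Finset.sum_erase_add (S.erase f) s (Finset.mem_erase.2 ⟨hfg.symm, hg⟩)
  obtain ⟨a, ha, ha1, h3⟩ := exists_sum_erase (S := (S.erase f).erase g) (f := s) (k := 1)
    (fun d hd => hone d (Finset.mem_of_mem_erase (Finset.mem_of_mem_erase hd))) (by omega)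
  obtain ⟨b, hb, hb1, h4⟩ := exists_sum_erase (S := ((S.erase f).erase g).erase a) (f := s) (k := 0)
    (fun d hd => hone d (Finset.mem_of_mem_erase (Finset.mem_of_mem_erase
      (Finset.mem_of_mem_erase hd)))) h3
  rw [Finset.sum_eq_zero_iff] at h4
  simp only [Finset.mem_erase] at ha hb h4
  exact ⟨a, ha.2.2, b, hb.2.2.2, Ne.symm hb.1, ha1, hb1, ha.2.1, ha.1, hb.2.2.1, hb.2.1,
    fun d hd h5 h6 h7 h8 => h4 d ⟨h6, h5, h8, h7, hd⟩⟩

theorem rungs_of_full (hfull : ((⊤ : SimpleGraph ι) □ (⊤ : SimpleGraph (Fin 2))) ≤ R) :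
    rungs R = Fintype.card ι := by
  rw [rungs, Finset.filter_true_of_mem fun i _ => hfull (by simp), Finset.card_univ]

/-- One of two classes of size one in `K₅ □ K₂` can be extended to a perfect matching. -/
theorem IsState.ext_of_or (h : IsState φ R Γ 3 5)
    (hfull : ((⊤ : SimpleGraph ι) □ (⊤ : SimpleGraph (Fin 2))) ≤ R)
    (hs : ∑ d ∈ Γ, size φ d ≤ 4) {a b : ℕ} (ha : a ∈ Γ) (hb : b ∈ Γ) (hab : a ≠ b)
    (ha1 : size φ a = 1) (hb1 : size φ b = 1)
    (hrest : ∀ c d, (c = a ∧ d = b ∨ c = b ∧ d = a) → c ∈ Γ → d ∈ Γ.erase c → size φ d = 1 →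
      ∀ Q, IsState φ Q (Γ.erase c) 3 4 → 4 ≤ rungs Q → Ext φ Q (Γ.erase c)) : Ext φ R Γ := by
  have hrungs := rungs_of_full hfull
  have hι := h.card_side
  rcases h.exists_classMat_or_exists_classMat hfull ha hb hab ha1 hb1 hs with
    ⟨μ, hμ, h1⟩ | ⟨μ, hμ, h1⟩
  · exact hμ.ext ha (hrest a b (Or.inl ⟨rfl, rfl⟩) ha (Finset.mem_erase.2 ⟨hab.symm, hb⟩) hb1 _
      (h.peel ha hμ) (by omega))
  · exact hμ.ext hb (hrest b a (Or.inr ⟨rfl, rfl⟩) hb (Finset.mem_erase.2 ⟨hab, ha⟩) ha1 _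
      (h.peel hb hμ) (by omega))

theorem IsState.ext_of_four_singles (h : IsState φ R Γ 3 5)
    (hfull : ((⊤ : SimpleGraph ι) □ (⊤ : SimpleGraph (Fin 2))) ≤ R)
    (hs : ∑ d ∈ Γ, size φ d = 4) (hone : ∀ d ∈ Γ, size φ d ≤ 1) : Ext φ R Γ := by
  have hone' : ∀ c, ∀ d ∈ Γ.erase c, size φ d ≤ 1 := fun c d hd =>
    hone d (Finset.mem_of_mem_erase hd)
  by_cases hadj : ∃ u v w f g, f ∈ Γ ∧ g ∈ Γ ∧ φ s(u, v) = some f ∧ φ s(u, w) = some g ∧ f ≠ g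
  · obtain ⟨u, v, w, f, g, hf, hg, huv, huw, hfg⟩ := hadj
    obtain ⟨a, ha, b, hb, hab, ha1, hb1, haf, hag, hbf, hbg, hzero⟩ := exists_other_pair hone hs
      hf hg hfg (le_antisymm (hone f hf) (size_pos huv)) (le_antisymm (hone g hg) (size_pos huw))
    refine h.ext_of_or hfull hs.le ha hb hab ha1 hb1 fun c d hcd hc hd _ Q hQ _ => ?_
    refine hQ.ext_of_adjacent (hone' c) hd huv huw fun x hx h1 h2 h3 => ?_
    rw [Finset.mem_erase] at hx
    rcases hcd with ⟨rfl, rfl⟩ | ⟨rfl, rfl⟩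
    · exact hzero x hx.2 hx.1 h1 h2 h3
    · exact hzero x hx.2 h1 hx.1 h2 h3
  push Not at hadj
  rcases h.cases_of_disjoint hs hone fun u v w f g hf hg h1 h2 => hadj u v w f g hf hg h1 h2 with
    ⟨f, hf, g, hg, hfg, ⟨i, j, hij⟩, i', j', hij'⟩ |
      ⟨e, he, f, hf, g, hg, hef, heg, hfg, ⟨i, hi⟩, ⟨j, hj⟩, k, hk⟩
  · have hf1 := hone f hf
    have hg1 := hone g hg
    obtain ⟨a, ha, b, hb, hab, ha1, hb1, haf, hag, hbf, hbg, hzero⟩ := exists_other_pair hone hs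
      hf hg hfg (le_antisymm hf1 (size_pos hij)) (le_antisymm hg1 (size_pos hij'))
    refine h.ext_of_or hfull hs.le ha hb hab ha1 hb1 fun c d hcd hc hd hd1 Q hQ hrungs => ?_
    refine hQ.ext_of_triple le_rfl le_rfl hrungs hd
      (Finset.mem_erase.2 ⟨by rintro rfl; rcases hcd with ⟨rfl, rfl⟩ | ⟨rfl, rfl⟩ <;> contradiction,
        hf⟩) (by rintro rfl; rcases hcd with ⟨rfl, rfl⟩ | ⟨rfl, rfl⟩ <;> contradiction) hd1 hf1 hg1
      (fun x hx h1 h2 h3 => ?_) (fun k => ?_)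
      (Or.inr fun x => ⟨rung_ne_of_hor hf1 hij x, rung_ne_of_hor hg1 hij' x⟩)
    · rw [Finset.mem_erase] at hx
      rcases hcd with ⟨rfl, rfl⟩ | ⟨rfl, rfl⟩
      · exact hzero x hx.2 hx.1 h1 h2 h3
      · exact hzero x hx.2 h1 hx.1 h2 h3
    · rcases fin_two_cases zero_ne_one k with rfl | rfl
      · exact Or.inr (hor_ne_of_hor hg1 one_ne_zero hij')
      · exact Or.inl (hor_ne_of_hor hf1 zero_ne_one hij)
  · have he1 := le_antisymm (hone e he) (size_pos hi)
    have hf1 := le_antisymm (hone f hf) (size_pos hj)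
    have hg1 := le_antisymm (hone g hg) (size_pos hk)
    obtain ⟨a, ha, b, hb, hab, ha1, hb1, hae, haf, hbe, hbf, hzero⟩ := exists_other_pair hone hs
      he hf hef he1 hf1
    obtain ⟨x, hx, hx1, hxe, hxf, hxg, hzero⟩ : ∃ x ∈ Γ, size φ x = 1 ∧ x ≠ e ∧ x ≠ f ∧ x ≠ g ∧
        ∀ d ∈ Γ, d ≠ e → d ≠ f → d ≠ g → d ≠ x → size φ d = 0 := by
      by_cases hga : g = a
      · subst hga
        exact ⟨b, hb, hb1, hbe, hbf, hab.symm, fun d hd h1 h2 h3 h4 => hzero d hd h3 h4 h1 h2⟩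
      · by_cases hgb : g = b
        · subst hgb
          exact ⟨a, ha, ha1, hae, haf, hab, fun d hd h1 h2 h3 h4 => hzero d hd h4 h3 h1 h2⟩
        · have := hzero g hg hga hgb heg.symm hfg.symm
          omega
    refine h.ext_of_or hfull hs.le he hf hef he1 hf1 fun c d hcd hc hd hd1 Q hQ hrungs => ?_
    refine hQ.ext_of_triple le_rfl le_rfl hrungs hd (f := x) (g := g)
      (Finset.mem_erase.2 ⟨by rintro rfl; rcases hcd with ⟨rfl, rfl⟩ | ⟨rfl, rfl⟩ <;> contradiction,
        hx⟩) (by rintro rfl; rcases hcd with ⟨rfl, rfl⟩ | ⟨rfl, rfl⟩ <;> contradiction) hd1 hx1.le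
      hg1.le (fun y hy h1 h2 h3 => ?_) (fun _ => Or.inr (hor_ne_of_rung hg1.le hk _)) (Or.inl ?_)
    · rw [Finset.mem_erase] at hy
      rcases hcd with ⟨rfl, rfl⟩ | ⟨rfl, rfl⟩
      · exact hzero y hy.2 hy.1 h1 h3 h2
      · exact hzero y hy.2 h1 hy.1 h3 h2
    · rcases hcd with ⟨rfl, rfl⟩ | ⟨rfl, rfl⟩
      · exact ⟨j, hj⟩
      · exact ⟨i, hi⟩

theorem IsState.ext_of_three (h : IsState φ R Γ 3 5)
    (hfull : ((⊤ : SimpleGraph ι) □ (⊤ : SimpleGraph (Fin 2))) ≤ R)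
    (hs : ∑ d ∈ Γ, size φ d ≤ 4) : Ext φ R Γ := by
  have hrungs := rungs_of_full hfull
  have hι := h.card_side
  obtain ⟨E, hE, hmax⟩ := Finset.exists_max_image Γ (size φ)
    (Finset.card_pos.1 (by rw [h.card]; omega))
  have hsumE := Finset.sum_erase_add Γ (size φ) hE
  by_cases hex : ∃ Y ∈ Γ, Y ≠ E ∧ 2 ≤ size φ Y
  · obtain ⟨Y, hY, hYE, hY2⟩ := hex
    have h1 := hmax Y hY
    have h2 := Finset.sum_erase_add (Γ.erase E) (size φ) (Finset.mem_erase.2 ⟨hYE, hY⟩)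
    refine h.ext_of_two_pairs hE hY hYE.symm (by omega) (by omega) fun d hd hdE hdY => ?_
    have h3 : ∑ d ∈ (Γ.erase E).erase Y, size φ d = 0 := by omega
    rw [Finset.sum_eq_zero_iff] at h3
    exact h3 d (by simp [*])
  push Not at hex
  have hone : ∀ d ∈ Γ, d ≠ E → size φ d ≤ 1 := fun d hd hdE => Nat.lt_succ_iff.1 (hex d hd hdE)
  by_cases h3 : ∑ d ∈ Γ, size φ d ≤ 3
  · exact h.ext_of_singles rfl (by omega) (Or.inr ⟨le_rfl, h3⟩) hE hone
  have hone' : ∀ d ∈ Γ.erase E, size φ d ≤ 1 := fun d hd =>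
    hone d (Finset.mem_of_mem_erase hd) (Finset.ne_of_mem_erase hd)
  rcases Nat.lt_trichotomy (size φ E) 2 with h4 | h4 | h4
  · exact h.ext_of_four_singles hfull (by omega) fun d hd => (hmax d hd).trans (by omega)
  · obtain ⟨f, hf, hf1, h5⟩ := exists_sum_erase (k := 1) hone' (by omega)
    obtain ⟨g, hg, hg1, h6⟩ := exists_sum_erase (k := 0)
      (fun d hd => hone' d (Finset.mem_of_mem_erase hd)) h5
    simp only [Finset.mem_erase] at hf hg
    refine h.ext_of_or hfull hs hf.2 hg.2.2 (Ne.symm hg.1) hf1 hg1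
      fun c d hcd hc hd hd1 Q hQ _ => ?_
    have hcE : c ≠ E := by
      rcases hcd with ⟨rfl, -⟩ | ⟨rfl, -⟩
      · exact hf.1
      · exact hg.2.1
    have hc1 : size φ c = 1 := by
      rcases hcd with ⟨rfl, -⟩ | ⟨rfl, -⟩
      · exact hf1
      · exact hg1
    refine hQ.ext_of_le_one (c := E) (Finset.mem_erase.2 ⟨hcE.symm, hE⟩) ?_
    have h7 := Finset.sum_erase_add (Γ.erase E) (size φ) (Finset.mem_erase.2 ⟨hcE, hc⟩)
    rw [Finset.erase_right_comm]
    omega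
  · exact h.ext_of_le_one hE (by omega)

/-- Extension by a given proper coloring `C` of `K₃ □ K₂`. -/
theorem IsState.ext_of_table (h : IsState φ R Γ 2 3) (hs : ∑ d ∈ Γ, size φ d = 3)
    (hone : ∀ d ∈ Γ, size φ d ≤ 1) (p : Fin 3 ≃ ι) (C : Fin 3 × Fin 2 → Fin 3 × Fin 2 → Fin 4)
    (hsymm : ∀ u v, C u v = C v u)
    (hC : ∀ u v, u ≠ v → (u.1 = v.1 ∨ u.2 = v.2) → ∀ w, u ≠ w → (u.1 = w.1 ∨ u.2 = w.2) →
      v ≠ w → C u v ≠ C u w)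
    (a b : Fin 3 → Fin 3 × Fin 2) (D : Fin 3 → ℕ) (hD : Function.Injective D)
    (hDΓ : ∀ t, D t ∈ Γ) (hab : ∀ t, C (a t) (b t) = t.castSucc)
    (hφ : ∀ t, φ s((p (a t).1, (a t).2), (p (b t).1, (b t).2)) = some (D t)) : Ext φ R Γ := by
  obtain ⟨κ, hκ, hκΓ, hκD⟩ := exists_numbering (m := 3) (k := 4) h.card Fin.castSucc D
    (Fin.castSucc_injective 3) hD hDΓ
  have hcases : ∀ d ∈ Γ, 1 ≤ size φ d → ∃ t, d = D t := by
    intro d hd hd1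
    by_contra hno
    push Not at hno
    have h1 : insert d (Finset.univ.image D) ⊆ Γ := by
      intro x hx
      simp only [Finset.mem_insert, Finset.mem_image, Finset.mem_univ, true_and] at hx
      rcases hx with rfl | ⟨t, rfl⟩
      · exact hd
      · exact hDΓ t
    have h2 := Finset.sum_le_sum_of_subset (f := size φ) h1
    rw [Finset.sum_insert (by simpa using fun t => (hno t).symm),
      Finset.sum_image fun x _ y _ hxy => hD hxy] at h2
    have h3 := Finset.sum_le_sum fun t (_ : t ∈ Finset.univ) => size_pos (hφ t)
    simp only [Finset.sum_const, Finset.card_univ, Fintype.card_fin] at h3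
    simp only [smul_eq_mul] at h3
    omega
  have hadj : ∀ u v, R.Adj (p.prodCongr (Equiv.refl _) u) (p.prodCongr (Equiv.refl _) v) →
      u ≠ v ∧ (u.1 = v.1 ∨ u.2 = v.2) := by
    intro u v huv
    refine ⟨fun huv' => huv.ne (by rw [huv']), ?_⟩
    have h1 := h.le huv
    simp only [boxProd_adj, top_adj, Equiv.prodCongr_apply, Prod.map_fst, Prod.map_snd,
      Equiv.refl_apply, EmbeddingLike.apply_eq_iff_eq] at h1
    tauto
  refine Ext.of_equiv (p.prodCongr (Equiv.refl _)) (fun u v => (C u v : ℕ))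
    (fun u v => by rw [hsymm]) κ hκ hκΓ (fun u v huv => ⟨(C u v).isLt, fun w huw hvw h1 => ?_⟩)
    fun u v d huv hd => ⟨(C u v).isLt, ?_⟩
  · have h2 := hadj u v huv
    have h3 := hadj u w huw
    exact hC u v h2.1 h2.2 w h3.1 h3.2 hvw (Fin.ext h1)
  · obtain ⟨t, rfl⟩ := hcases d ((h.mem _ _ _ hd).2 huv) (size_pos hd)
    rw [← hκD, ← hab]
    have h1 := eq_of_size_le_one (hone _ (hDΓ t)) hd (hφ t)
    have h2 : s(u, v) = s(a t, b t) :=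
      Sym2.map.injective (p.prodCongr (Equiv.refl (Fin 2))).injective h1
    rcases Sym2.eq_iff.1 h2 with ⟨rfl, rfl⟩ | ⟨rfl, rfl⟩
    · rfl
    · exact congrArg κ (hsymm _ _)

theorem IsState.ext_of_triangular_prism (h : IsState φ R Γ 2 3) (hs : ∑ d ∈ Γ, size φ d ≤ 3) :
    Ext φ R Γ := by
  obtain ⟨E, hE, hmax⟩ := Finset.exists_max_image Γ (size φ)
    (Finset.card_pos.1 (by rw [h.card]; omega))
  by_cases hsing : ∑ d ∈ Γ.erase E, size φ d ≤ 1
  · exact h.ext_of_le_one hE hsing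
  have hsumE := Finset.sum_erase_add Γ (size φ) hE
  obtain ⟨d, hd, hd1⟩ := exists_pos_of_sum (S := Γ.erase E) (f := size φ) (by omega)
  have hdE := hmax d (Finset.mem_of_mem_erase hd)
  have hone : ∀ d ∈ Γ, size φ d ≤ 1 := fun d hd => (hmax d hd).trans (by omega)
  have hs : ∑ d ∈ Γ, size φ d = 3 := by omega
  have hthird : ∀ f ∈ Γ, ∀ g ∈ Γ, f ≠ g → size φ f = 1 → size φ g = 1 → ∃ e ∈ Γ, size φ e = 1 ∧
      e ≠ f ∧ e ≠ g ∧ ∀ d ∈ Γ, d ≠ e → d ≠ f → d ≠ g → size φ d = 0 := by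
    intro f hf g hg hfg hf1 hg1
    have h1 := Finset.sum_erase_add Γ (size φ) hf
    have h2 := Finset.sum_erase_add (Γ.erase f) (size φ) (Finset.mem_erase.2 ⟨hfg.symm, hg⟩)
    obtain ⟨e, he, he1, h3⟩ := exists_sum_erase (S := (Γ.erase f).erase g) (f := size φ) (k := 0)
      (fun d hd => hone d (Finset.mem_of_mem_erase (Finset.mem_of_mem_erase hd))) (by omega)
    rw [Finset.sum_eq_zero_iff] at h3
    simp only [Finset.mem_erase] at he h3
    exact ⟨e, he.2.2, he1, he.2.1, he.1, fun d hd h4 h5 h6 => h3 d ⟨h4, h6, h5, hd⟩⟩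
  by_cases hadj : ∃ u v w f g, f ∈ Γ ∧ g ∈ Γ ∧ φ s(u, v) = some f ∧ φ s(u, w) = some g ∧ f ≠ g
  · obtain ⟨u, v, w, f, g, hf, hg, huv, huw, hfg⟩ := hadj
    obtain ⟨e, he, -, -, -, hzero⟩ := hthird f hf g hg hfg
      (le_antisymm (hone f hf) (size_pos huv)) (le_antisymm (hone g hg) (size_pos huw))
    exact h.ext_of_adjacent hone he huv huw hzero
  push Not at hadj
  have hdis : ∀ u v u' v' f g, f ∈ Γ → g ∈ Γ → f ≠ g → φ s(u, v) = some f →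
      φ s(u', v') = some g → u ≠ u' ∧ u ≠ v' ∧ v ≠ u' ∧ v ≠ v' := by
    intro u v u' v' f g hf hg hfg h1 h2
    have k1 := h1
    have k2 := h2
    rw [Sym2.eq_swap] at k1 k2
    refine ⟨?_, ?_, ?_, ?_⟩ <;> rintro rfl
    · exact hfg (hadj _ _ _ _ _ hf hg h1 h2)
    · exact hfg (hadj _ _ _ _ _ hf hg h1 k2)
    · exact hfg (hadj _ _ _ _ _ hf hg k1 h2)
    · exact hfg (hadj _ _ _ _ _ hf hg k1 k2)
  have hcard : Fintype.card ι = 3 := by have := h.card_side; omega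
  rcases h.cases_of_disjoint hs hone fun u v w f g hf hg h1 h2 => hadj u v w f g hf hg h1 h2 with
    ⟨f, hf, g, hg, hfg, ⟨i, j, hi⟩, i', j', hi'⟩ |
      ⟨e, he, f, hf, g, hg, hef, heg, hfg, ⟨i, hi⟩, ⟨j, hj⟩, k, hk⟩
  · obtain ⟨e, he, he1, hef, heg, -⟩ := hthird f hf g hg hfg
      (le_antisymm (hone f hf) (size_pos hi)) (le_antisymm (hone g hg) (size_pos hi'))
    have hij : i ≠ j := by
      rintro rfl
      exact ((h.mem _ _ _ hi).1 hf).ne rfl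
    have hij' : i' ≠ j' := by
      rintro rfl
      exact ((h.mem _ _ _ hi').1 hg).ne rfl
    have hno : ∀ (i j i' j' : ι) (k : Fin 2) (c d : ℕ), c ∈ Γ → d ∈ Γ → c ≠ d → i ≠ j → i' ≠ j' →
        φ s((i, k), (j, k)) = some c → φ s((i', k), (j', k)) ≠ some d := by
      intro i j i' j' k c d hc hd hcd hij hij' h1 h2
      have h3 := hdis _ _ _ _ _ _ hc hd hcd h1 h2
      simp only [ne_eq, Prod.mk.injEq, and_true] at h3
      have := Fintype.card_le_of_injective _
        (injective_quadruple hij h3.1 h3.2.1 h3.2.2.1 h3.2.2.2 hij')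
      rw [Fintype.card_fin] at this
      omega
    obtain ⟨u, v, -, huv⟩ := h.exists_edge he he1.ge
    rcases h.edge_cases he huv with ⟨x, hx⟩ | ⟨x, y, k, hxy, hx⟩ <;> rw [hx] at huv
    · have h1 := hdis _ _ _ _ _ _ he hf hef huv hi
      have h2 := hdis _ _ _ _ _ _ he hg heg huv hi'
      simp only [ne_eq, Prod.mk.injEq, and_true] at h1 h2
      obtain ⟨p, hp⟩ := h.exists_equiv (k := 3) rfl ![0, 1, 2] ![x, i, j]
        (injective_triple (by decide) (by decide) (by decide)) (injective_triple h1.1 h1.2.1 hij)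
      have p0 : p 0 = x := hp 0
      have p1 : p 1 = i := hp 1
      have p2 : p 2 = j := hp 2
      have hg' : φ s((i, 1), (j, 1)) = some g := by
        have key : ∀ z, ¬ x = z → z = i ∨ z = j := by
          intro z hz
          obtain ⟨t, rfl⟩ := p.surjective z
          rw [← p0, ← p1, ← p2] at *
          simp only [EmbeddingLike.apply_eq_iff_eq] at hz ⊢
          omega
        rcases key i' h2.2.2.1 with rfl | rfl <;> rcases key j' h2.2.2.2 with rfl | rfl
        · exact absurd rfl hij'
        · exact hi'
        · rwa [Sym2.eq_swap]
        · exact absurd rfl hij'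
      refine h.ext_of_table hs hone p
        (fun u v => if u.1 = v.1 then 0 else if u.1.val + v.1.val = 2 then 3 else
          if u.1.val + v.1.val = 3 ↔ u.2 = 0 ∧ v.2 = 0 then 1 else 2) ?_ ?_
          ![(0, 0), (1, 0), (1, 1)]
        ![(0, 1), (2, 0), (2, 1)] ![e, f, g] (injective_triple hef heg hfg) ?_ ?_ ?_
      · decide
      · decide
      · intro t
        fin_cases t <;> simp [he, hf, hg]
      · decide
      · intro t
        fin_cases t <;> simp [p0, p1, p2, huv, hi, hg']
    · rcases fin_two_cases zero_ne_one k with rfl | rfl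
      · exact absurd huv (hno _ _ _ _ _ _ _ hf he hef.symm hij hxy hi)
      · exact absurd huv (hno _ _ _ _ _ _ _ hg he heg.symm hij' hxy hi')
  · have key : ∀ {i j : ι} {c d : ℕ}, c ≠ d → φ s((i, 0), (i, 1)) = some c →
        φ s((j, 0), (j, 1)) = some d → i ≠ j := by
      rintro i j c d hcd h1 h2 rfl
      exact hcd (Option.some.inj (h1.symm.trans h2))
    obtain ⟨p, hp⟩ := h.exists_equiv (k := 3) rfl ![0, 1, 2] ![i, j, k]
      (injective_triple (by decide) (by decide) (by decide))
      (injective_triple (key hef hi hj) (key heg hi hk) (key hfg hj hk))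
    have p0 : p 0 = i := hp 0
    have p1 : p 1 = j := hp 1
    have p2 : p 2 = k := hp 2
    refine h.ext_of_table hs hone p
      (fun u v => if u.1 = v.1 then u.1.castSucc else 3 - u.1.castSucc - v.1.castSucc) ?_ ?_
      ![(0, 0), (1, 0), (2, 0)] ![(0, 1), (1, 1), (2, 1)] ![e, f, g]
      (injective_triple hef heg hfg) ?_ ?_ ?_
    · decide
    · decide
    · intro t
      fin_cases t <;> simp [he, hf, hg]
    · decide
    · intro t
      fin_cases t <;> simp [p0, p1, p2, hi, hj, hk]

end

section

open scoped Classical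

theorem proper_of_isPartialProperEdgeColoring {V : Type*} {G : SimpleGraph V}
    {φ : Sym2 V → Option ℕ} (hφ : IsPartialProperEdgeColoring G φ) : Proper φ := by
  intro u v w c huv huw
  by_contra hvw
  have h1 := hφ.1 s(u, v) (by simp [huv])
  have h2 := hφ.1 s(u, w) (by simp [huw])
  refine hφ.2 ⟨h1, h2, fun h3 => hvw (Sym2.congr_right.1 h3), u, ?_, ?_⟩ (by simp [huv])
    (huv.trans huw.symm)
  · simp
  · simp

theorem Ext.extendable {V : Type*} {G : SimpleGraph V} {φ : Sym2 V → Option ℕ} {t : ℕ}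
    (hφ : IsPartialProperEdgeColoring G φ) (h : Ext φ G (Finset.range t)) :
    Extendable G φ t := by
  obtain ⟨C, h1, h2, h3⟩ := h
  refine ⟨C, ?_, ?_, ?_⟩
  · rintro e f ⟨he, hf, hne, v, hve, hvf⟩ hC
    obtain ⟨x, rfl⟩ := hve
    obtain ⟨y, rfl⟩ := hvf
    exact hne (by rw [h1 v x y he hf hC])
  · intro e he
    induction e using Sym2.ind with
    | _ u v => exact Finset.mem_range.1 (h2 u v he)
  · intro e a hea
    have h4 := hφ.1 e (by simp [hea])
    induction e using Sym2.ind with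
    | _ u v => exact h3 u v a h4 hea

theorem sum_size_le {ι : Type*} [Fintype ι] (φ : Sym2 (ι × Fin 2) → Option ℕ) (Γ : Finset ℕ) :
    ∑ d ∈ Γ, size φ d ≤ (Precolored φ).ncard := by
  simp only [size]
  rw [← Finset.card_biUnion, ← Set.ncard_coe_finset]
  · refine Set.ncard_le_ncard ?_ (Set.toFinite _)
    intro e he
    simp only [Finset.coe_biUnion, Set.mem_iUnion, Finset.coe_filter] at he
    obtain ⟨d, -, -, hd⟩ := he
    simp [Precolored, hd]
  · intro c _ d _ hcd
    rw [Function.onFun, Finset.disjoint_filter]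
    intro e _ h1 h2
    exact hcd (Option.some.inj (h1.symm.trans h2))

theorem isState_boxProd {n : ℕ} (hn : 0 < n) {φ : Sym2 (Fin (2 * n - 1) × Fin 2) → Option ℕ}
    (hφ : IsPartialProperEdgeColoring
      ((⊤ : SimpleGraph (Fin (2 * n - 1))) □ (⊤ : SimpleGraph (Fin 2))) φ)
    (hc : UsesColors φ (2 * n)) :
    IsState φ ((⊤ : SimpleGraph (Fin (2 * n - 1))) □ (⊤ : SimpleGraph (Fin 2)))
      (Finset.range (2 * n)) n (2 * n - 1) where
  proper := proper_of_isPartialProperEdgeColoring hφ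
  card_side := by rw [Fintype.card_fin]; omega
  le := le_rfl
  reg v := by
    have h1 : ∀ {α : Type} [Fintype α] (x : α)
        [Fintype ((⊤ : SimpleGraph α).neighborSet x)],
        (⊤ : SimpleGraph α).degree x = Fintype.card α - 1 := fun x _ => by
      convert complete_graph_degree x
    have h2 := degree_boxProd (G := (⊤ : SimpleGraph (Fin (2 * n - 1))))
      (H := (⊤ : SimpleGraph (Fin 2))) v
    rw [h1, h1, Fintype.card_fin, Fintype.card_fin] at h2
    convert h2.trans (show _ = 2 * n - 1 by omega)
  card := by rw [Finset.card_range]; omega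
  mem u v c h := ⟨fun _ => hφ.1 s(u, v) (by simp [h]), fun _ => Finset.mem_range.2 (hc _ _ h)⟩

theorem extendable_of_ncard_le {n : ℕ} (hn : 2 ≤ n)
    {φ : Sym2 (Fin (2 * n - 1) × Fin 2) → Option ℕ}
    (hφ : IsPartialProperEdgeColoring
      ((⊤ : SimpleGraph (Fin (2 * n - 1))) □ (⊤ : SimpleGraph (Fin 2))) φ)
    (hc : UsesColors φ (2 * n)) (hcard : (Precolored φ).ncard ≤ n + 1) :
    Extendable ((⊤ : SimpleGraph (Fin (2 * n - 1))) □ (⊤ : SimpleGraph (Fin 2))) φ (2 * n) := by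
  have h := isState_boxProd (by omega) hφ hc
  have hs := (sum_size_le φ (Finset.range (2 * n))).trans hcard
  refine Ext.extendable hφ ?_
  rcases Nat.lt_or_ge n 4 with h4 | h4
  · obtain rfl | rfl : n = 2 ∨ n = 3 := by omega
    · exact h.ext_of_triangular_prism hs
    · exact h.ext_of_three le_rfl hs
  · refine h.ext_of_four_le (by omega) h4 ?_ hs
    rw [rungs_of_full le_rfl, Fintype.card_fin]

end

end PartialEdgeColoring

theorem stmt13 (n : ℕ) (hn : 2 ≤ n) (φ : Sym2 (Fin (2*n-1) × Fin 2) → Option ℕ)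
    (hφ : IsPartialProperEdgeColoring
      ((⊤ : SimpleGraph (Fin (2*n-1))).boxProd (⊤ : SimpleGraph (Fin 2))) φ)
    (hc : UsesColors φ (2*n)) (hcard : (Precolored φ).ncard ≤ n + 1) :
    Extendable ((⊤ : SimpleGraph (Fin (2*n-1))).boxProd (⊤ : SimpleGraph (Fin 2)))
      φ (2*n) :=
  PartialEdgeColoring.extendable_of_ncard_le hn hφ hc hcard
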